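/- Fix a real number T > 0 and an integer n ≥ 1, and let a = (a_1,…,a_n) and b = (b_1,…,b_n) be tuples of admissible functions on [0,T]. Suppose the equation E(a) determines a center and that every moment of a equals the corresponding moment of b, i.e., m^{n_1,…,n_j}_{i_1,…,i_{j+1}}(a) = m^{n_1,…,n_j}_{i_1,…,i_{j+1}}(b) for all j ≥ 0, all positive integers n_1,…,n_j and all indices. Then the equation E(b) determines a center. -/

import Mathlib

open MeasureTheory Set Filter Topology

noncomputable section

/-- Iterated integral over the simplex `0 ≤ s₁ ≤ … ≤ s_m ≤ x`; the head of the
list is attached to the outermost (largest) variable. -/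
def simplexInt : List (ℝ → ℂ) → ℝ → ℂ
  | [] => fun _ => 1
  | f :: fs => fun x => ∫ s in (0:ℝ)..x, f s * simplexInt fs s

/-- The basic iterated integral `I_{i₁,…,i_m}(a)`. -/
def iterInt (T : ℝ) {n : ℕ} (a : Fin n → ℝ → ℂ) (l : List (Fin n)) : ℂ :=
  simplexInt ((l.map a).reverse) T

/-- `ã(x) = ∫_0^x a(s) ds`. -/
def primitive (a : ℝ → ℂ) (x : ℝ) : ℂ := ∫ s in (0:ℝ)..x, a s

/-- The moment `m^{n₁,…,n_j}_{i₁,…,i_{j+1}}(a)`, encoded by the list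
`ps = [(i₁,n₁),…,(i_j,n_j)]` of index/exponent pairs and the final index `i`. -/
def moment (T : ℝ) {n : ℕ} (a : Fin n → ℝ → ℂ) (ps : List (Fin n × ℕ)) (i : Fin n) : ℂ :=
  ∫ s in (0:ℝ)..T, (ps.map fun q => primitive (a q.1) s ^ q.2).prod * a i s

/-- A function is admissible if on `[0,T]` it is a polynomial in `x`
or a finite linear combination of the exponentials `e^{2πijx/T}`, `j ∈ ℤ`. -/
def Admissible (T : ℝ) (f : ℝ → ℂ) : Prop :=
  (∃ p : Polynomial ℂ, ∀ x ∈ Icc (0:ℝ) T, f x = p.eval (x : ℂ)) ∨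
  (∃ (s : Finset ℤ) (c : ℤ → ℂ), ∀ x ∈ Icc (0:ℝ) T,
    f x = ∑ j ∈ s, c j * Complex.exp (2 * (Real.pi : ℂ) * Complex.I * (j : ℂ) * (x : ℂ) / (T : ℂ)))

/-- The equation `dv/dx = Σ_{i=1}^n a_i(x) v^{i+1}` determines a center. -/
def DeterminesCenter (T : ℝ) {n : ℕ} (a : Fin n → ℝ → ℂ) : Prop :=
  ∃ ε > (0:ℝ), ∀ v : ℝ → ℂ,
    (∀ x ∈ Icc (0:ℝ) T, v x = v 0 + ∫ s in (0:ℝ)..x, ∑ i, a i s * v s ^ ((i : ℕ) + 2)) →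
    ‖v 0‖ < ε → v T = v 0

section
open Complex
open Metric (ball closedBall ball_mem_nhds isOpen_ball mem_ball_self eventually_nhds_iff_ball)
open Finset (sum_congr prod_congr mul_sum sum_mul prod_ne_zero_iff sum_sub_distrib sum_add_distrib)
open Polynomial (eval_mul eval_pow eval_C eval_X eval_sub eval_add natDegree_X_pow)
open Real (lt_log_iff_exp_lt)
section
def ee (c : ℕ → ℂ) : ℕ → ℂ
  | 0 => 1
  | m + 1 => -(1 / ((m : ℂ) + 1)) * ∑ k : Fin (m + 1), c (k + 1) * ee c (m - k)
decreasing_by omega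
def EE (c : ℕ → ℂ) : PowerSeries ℂ := PowerSeries.mk (ee c)
def CC (c : ℕ → ℂ) : PowerSeries ℂ := PowerSeries.mk fun m => c (m + 1)
open PowerSeries in
lemma EE_deriv_iff (c : ℕ → ℂ) (F : PowerSeries ℂ) :
    (coeff 0 F = 1 ∧ derivative ℂ F = - CC c * F) ↔ F = EE c := by
  have key : ∀ G : PowerSeries ℂ, derivative ℂ G = - CC c * G ↔ ∀ m, coeff (m+1) G = -(1 / ((m : ℂ) + 1)) * ∑ k : Fin (m + 1), c (k + 1) * coeff (m - k) G := by
    intro G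
    rw [PowerSeries.ext_iff]
    refine forall_congr' fun m => ?_
    rw [coeff_derivative, neg_mul, map_neg, coeff_mul, Finset.Nat.sum_antidiagonal_eq_sum_range_succ_mk, ← Fin.sum_univ_eq_sum_range (fun k => coeff k (CC c) * coeff (m-k) G)]
    simp only [CC, coeff_mk]
    have : (m:ℂ) + 1 ≠ 0 := by exact_mod_cast Nat.succ_ne_zero m
    constructor
    · intro h
      field_simp
      linear_combination h
    · intro h
      rw [h]; field_simp
  have hE : ∀ m, ee c (m+1) = -(1 / ((m : ℂ) + 1)) * ∑ k : Fin (m + 1), c (k + 1) * ee c (m - k) := by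
    intro m; rw [ee]
  constructor
  · rintro ⟨my, me⟩
    rw [key] at me
    ext m
    simp only [EE, coeff_mk]
    induction m using Nat.strong_induction_on with
    | _ m ih =>
      cases m with
      | zero => rw [my, ee]
      | succ m =>
        rw [me, hE]
        congr 1
        refine sum_congr rfl fun k _ => ?_
        rw [ih _ (by omega)]
  · rintro rfl
    refine ⟨by simp [EE, ee], (key _).2 fun m => ?_⟩
    simp only [EE, coeff_mk]
    exact hE m
lemma EE_add (c d : ℕ → ℂ) : EE (c + d) = EE c * EE d := by
  symm
  obtain ⟨my, me⟩ := (EE_deriv_iff c _).2 rfl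
  obtain ⟨we, us⟩ := (EE_deriv_iff d _).2 rfl
  refine (EE_deriv_iff _ _).1 ⟨by simp_all, ?_⟩
  have : CC (c + d) = CC c + CC d := by ext; simp [CC]
  rw [Derivation.leibniz, me, us, this]
  simp only [smul_eq_mul]; ring
lemma EE_zero : EE 0 = 1 := by
  symm
  refine (EE_deriv_iff _ _).1 ⟨by simp, ?_⟩
  have : CC 0 = 0 := by ext; simp [CC]
  rw [this]; simp
def lin (α : ℂ) : Polynomial ℂ := 1 - Polynomial.C α * Polynomial.X
def pw (α : ℂ) : ℕ → ℂ := fun m => α ^ m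
open PowerSeries in
lemma EE_pw (α : ℂ) : EE (pw α) = (lin α : PowerSeries ℂ) := by
  symm
  refine (EE_deriv_iff _ _).1 ⟨by simp [lin], ?_⟩
  have h : CC (pw α) * (lin α : PowerSeries ℂ) = PowerSeries.C α := by
    ext m
    simp only [lin, Polynomial.coe_sub, Polynomial.coe_one, Polynomial.coe_mul, Polynomial.coe_C, Polynomial.coe_X, mul_sub, mul_one, map_sub]
    cases m with
    | zero => simp [CC, pw]
    | succ m =>
      rw [← mul_assoc, coeff_succ_mul_X, mul_comm (CC _), coeff_C_mul]
      simp [CC, pw]; ring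
  rw [neg_mul, h]
  ext m
  simp [lin, PowerSeries.coeff_C]
lemma EE_ne (c) : EE c ≠ 0 := fun h => by
  have := ((EE_deriv_iff c _).2 rfl).1
  rw [h] at this; simp at this
lemma lin_ne (α : ℂ) : lin α ≠ 0 := fun h => by
  have := congrArg (Polynomial.eval 0) h
  simp [lin] at this
lemma lin_deg (α : ℂ) : (lin α).natDegree ≤ 1 := by
  unfold lin; compute_degree
def RatD (n d : ℕ) (c : ℕ → ℂ) : Prop := ∃ Q P : Polynomial ℂ, Q ≠ 0 ∧ Q.natDegree ≤ d ∧ P.natDegree ≤ n ∧ EE c * (Q : PowerSeries ℂ) = P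
def Rat' (c : ℕ → ℂ) : Prop := ∃ D, RatD D D c
lemma RatD.mono {n d n' d' c} (h : RatD n d c) (hn : n ≤ n') (hd : d ≤ d') : RatD n' d' c := by
  obtain ⟨Q, P, me, we, us, up⟩ := h
  exact ⟨Q, P, me, we.trans hd, us.trans hn, up⟩
lemma RatD.add {n d c} (h : RatD n d c) (α) : RatD (n+1) d (c + pw α) := by
  obtain ⟨Q, P, me, we, us, up⟩ := h
  refine ⟨Q, P * lin α, me, we, (Polynomial.natDegree_mul_le).trans (add_le_add us (lin_deg _)), ?_⟩
  rw [EE_add, EE_pw, Polynomial.coe_mul, ← up]; ring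
lemma RatD.sub {n d c} (h : RatD n d c) (α) : RatD n (d+1) (c - pw α) := by
  obtain ⟨Q, P, me, we, us, up⟩ := h
  refine ⟨Q * lin α, P, mul_ne_zero me (lin_ne _), (Polynomial.natDegree_mul_le).trans (add_le_add we (lin_deg _)), us, ?_⟩
  rw [← up, Polynomial.coe_mul, ← EE_pw, mul_comm (Q : PowerSeries ℂ), ← mul_assoc, ← EE_add, sub_add_cancel]
lemma RatD.zero : RatD 0 0 0 := ⟨1, 1, one_ne_zero, by simp, by simp, by simp [EE_zero]⟩
lemma Rat'.zsmul {c} (h : Rat' c) (α : ℂ) (k : ℤ) : Rat' (c + k • pw α) := by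
  induction k using Int.induction_on with
  | zero => simpa using h
  | succ k ih =>
    obtain ⟨D, hD⟩ := ih
    exact ⟨D+1, by rw [add_smul, one_smul, ← add_assoc]; exact (hD.add α).mono le_rfl (by omega)⟩
  | pred k ih =>
    obtain ⟨D, hD⟩ := ih
    exact ⟨D+1, by rw [sub_smul, one_smul, ← add_sub_assoc]; exact (hD.sub α).mono (by omega) le_rfl⟩
lemma Rat'.sum {c} (h : Rat' c) {ι} (J : Finset ι) (α : ι → ℂ) (k : ι → ℤ) : Rat' (c + ∑ j ∈ J, k j • pw (α j)) := by
  classical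
  induction J using Finset.induction_on with
  | empty => simpa using h
  | insert a s ha ih =>
    rw [Finset.sum_insert ha, add_comm (k a • _), ← add_assoc]
    exact ih.zsmul _ _
end

section
lemma minors {ι : Type*} {N : ℕ} (R : ι → Fin N → ℂ) :
    (∃ Q : Fin N → ℂ, Q ≠ 0 ∧ ∀ m, ∑ k, R m k * Q k = 0) ↔ ∀ f : Fin N → ι, (Matrix.of fun i k => R (f i) k).det = 0 := by
  constructor
  · rintro ⟨Q, hQ, h⟩ f
    rw [← Matrix.exists_mulVec_eq_zero_iff]
    exact ⟨Q, hQ, by ext i; simpa [Matrix.mulVec, dotProduct] using h (f i)⟩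
  · intro h
    have hlt : Submodule.span ℂ (range R) < ⊤ := by
      rw [lt_top_iff_ne_top]
      intro htop
      obtain ⟨b, hb, hs, hli⟩ := exists_linearIndependent ℂ (range R)
      rw [htop] at hs
      let B : Module.Basis b ℂ (Fin N → ℂ) := Module.Basis.mk hli (by simp [hs])
      have : Finite b := B.linearIndependent.finite
      have := Fintype.ofFinite b
      have hc : Fintype.card b = N := by
        rw [← Module.finrank_eq_card_basis B]; simp
      let e : Fin N ≃ b := (Fintype.equivFinOfCardEq hc).symm
      choose f hf using fun i => hb (e i).2
      have me : LinearIndependent ℂ (Matrix.of fun i k => R (f i) k).row := by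
        have := hli.comp e e.injective
        have he : (Matrix.of fun i k => R (f i) k).row = Subtype.val ∘ e := by
          ext i k; simp [Matrix.row, hf]
        rw [he]; exact this
      rw [Matrix.linearIndependent_rows_iff_isUnit, Matrix.isUnit_iff_isUnit_det] at me
      exact me.ne_zero (h f)
    obtain ⟨g, hg, hk⟩ := Submodule.exists_le_ker_of_lt_top _ hlt
    refine ⟨fun k => g (Pi.single k 1), ?_, fun m => ?_⟩
    · intro my
      apply hg
      refine LinearMap.pi_ext' fun i => ?_
      ext; simpa using congrFun my i
    · have : g (R m) = 0 := hk (Submodule.subset_span ⟨m, rfl⟩)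
      rw [← this]
      conv_rhs => rw [← Finset.univ_sum_single (R m), map_sum]
      refine sum_congr rfl fun k _ => ?_
      have : (Pi.single k (R m k) : Fin N → ℂ) = R m k • Pi.single k 1 := by
        rw [← Pi.single_smul]; simp
      rw [this, map_smul, smul_eq_mul]
def erow (c : ℕ → ℂ) (m k : ℕ) : ℂ := if k ≤ m then ee c (m - k) else 0
lemma coeff_EE_mul (c : ℕ → ℂ) (Q : Polynomial ℂ) {d : ℕ} (hQ : Q.natDegree ≤ d) (m : ℕ) :
    PowerSeries.coeff m (EE c * (Q : PowerSeries ℂ)) = ∑ k : Fin (d+1), erow c m k * Q.coeff k := by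
  rw [mul_comm, PowerSeries.coeff_mul, Finset.Nat.sum_antidiagonal_eq_sum_range_succ_mk,
    Fin.sum_univ_eq_sum_range (fun k => erow c m k * Q.coeff k)]
  have me : ∀ N ≥ m + 1, ∑ k ∈ Finset.range N, erow c m k * Q.coeff k = ∑ k ∈ Finset.range (m+1), erow c m k * Q.coeff k := by
    intro N hN
    symm
    refine Finset.sum_subset (by simpa using hN) fun x _ hx => ?_
    rw [erow, if_neg (by simpa using hx), zero_mul]
  have we : ∀ N ≥ d + 1, ∑ k ∈ Finset.range N, erow c m k * Q.coeff k = ∑ k ∈ Finset.range (d+1), erow c m k * Q.coeff k := by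
    intro N hN
    symm
    refine Finset.sum_subset (by simpa using hN) fun x _ hx => ?_
    rw [Polynomial.coeff_eq_zero_of_natDegree_lt, mul_zero]
    simp at hx; omega
  rw [← we (max (m+1) (d+1)) (le_max_right _ _), me _ (le_max_left _ _)]
  refine sum_congr rfl fun k hk => ?_
  rw [erow, if_pos (by simp at hk; omega)]
  simp [EE, mul_comm]
lemma RatD_iff {n d : ℕ} {c : ℕ → ℂ} : RatD n d c ↔
    ∀ f : Fin (d+1) → {m : ℕ // n < m}, (Matrix.of fun i (k : Fin (d+1)) => erow c (f i) k).det = 0 := by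
  rw [← minors (fun (m : {m : ℕ // n < m}) (k : Fin (d+1)) => erow c m k)]
  constructor
  · rintro ⟨Q, P, me, we, us, up⟩
    refine ⟨fun k => Q.coeff k, ?_, fun m => ?_⟩
    · intro my
      apply me
      ext k
      by_cases hk : k ≤ d
      · simpa using congrFun my ⟨k, by omega⟩
      · exact Polynomial.coeff_eq_zero_of_natDegree_lt (by omega)
    · rw [← coeff_EE_mul c Q we, up, Polynomial.coeff_coe]
      exact Polynomial.coeff_eq_zero_of_natDegree_lt (lt_of_le_of_lt us m.2)
  · rintro ⟨Q, me, we⟩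
    let q : Polynomial ℂ := ∑ k : Fin (d+1), Polynomial.monomial k (Q k)
    have hq : ∀ k : Fin (d+1), q.coeff k = Q k := by
      intro k
      simp only [q, Polynomial.finsetSum_coeff, Polynomial.coeff_monomial]
      simp [Fin.val_inj]
    have hd : q.natDegree ≤ d := Polynomial.natDegree_sum_le_of_forall_le _ _ fun k _ =>
      (Polynomial.natDegree_monomial_le _).trans (by omega)
    refine ⟨q, PowerSeries.trunc (n+1) (EE c * (q : PowerSeries ℂ)), ?_, hd, ?_, ?_⟩
    · intro my
      apply me; ext k; rw [← hq, my]; simp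
    · have := PowerSeries.natDegree_trunc_lt (EE c * (q : PowerSeries ℂ)) n
      omega
    · ext m
      rw [Polynomial.coeff_coe, PowerSeries.coeff_trunc]
      split_ifs with h
      · rfl
      · rw [coeff_EE_mul c q hd]
        simp_rw [hq]
        exact we ⟨m, by omega⟩
lemma ee_analytic {c : ℕ → ℂ → ℂ} {U : Set ℂ} (hc : ∀ m, AnalyticOnNhd ℂ (c m) U) (m : ℕ) :
    AnalyticOnNhd ℂ (fun u => ee (fun m => c m u) m) U := by
  induction m using Nat.strong_induction_on with
  | _ m ih =>
    cases m with
    | zero => simp only [ee]; exact analyticOnNhd_const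
    | succ m =>
      simp only [ee]
      refine analyticOnNhd_const.mul (Finset.univ.analyticOnNhd_fun_sum fun k _ => ?_)
      exact (hc _).mul (ih _ (by omega))
lemma det_analytic {c : ℕ → ℂ → ℂ} {U : Set ℂ} (hc : ∀ m, AnalyticOnNhd ℂ (c m) U) {N : ℕ} (f : Fin N → ℕ) :
    AnalyticOnNhd ℂ (fun u => (Matrix.of fun i (k : Fin N) => erow (fun m => c m u) (f i) k).det) U := by
  simp only [Matrix.det_apply']
  refine Finset.univ.analyticOnNhd_fun_sum fun σ _ => ?_
  refine analyticOnNhd_const.mul (Finset.univ.analyticOnNhd_fun_prod fun k _ => ?_)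
  simp only [Matrix.of_apply, erow]
  split_ifs
  · exact ee_analytic hc _
  · exact analyticOnNhd_const
lemma RatD_ident {c : ℕ → ℂ → ℂ} {U V : Set ℂ} (hc : ∀ m, AnalyticOnNhd ℂ (c m) U) (hU : IsPreconnected U)
    (hV : IsOpen V) (hne : V.Nonempty) (hVU : V ⊆ U) {n d : ℕ} (h : ∀ u ∈ V, RatD n d fun m => c m u) :
    ∀ u ∈ U, RatD n d fun m => c m u := by
  intro u hu
  rw [RatD_iff]
  intro f
  obtain ⟨v, hv⟩ := hne
  refine (det_analytic hc (fun i => (f i : ℕ))).eqOn_of_preconnected_of_eventuallyEq (g := fun _ => 0) analyticOnNhd_const hU (hVU hv) ?_ hu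
  filter_upwards [hV.mem_nhds hv] with x hx
  exact RatD_iff.1 (h x hx) f
lemma Rat_ident {c : ℕ → ℂ → ℂ} {U V : Set ℂ} (hc : ∀ m, AnalyticOnNhd ℂ (c m) U) (hU : IsPreconnected U)
    (hV : IsOpen V) (hne : V.Nonempty) (hVU : V ⊆ U) (h : ∀ u ∈ V, Rat' fun m => c m u) :
    ∃ D, ∀ u ∈ U, RatD D D fun m => c m u := by
  obtain ⟨v, hv⟩ := hne
  obtain ⟨r, hr, hrV⟩ := Metric.nhds_basis_closedBall.mem_iff.1 (hV.mem_nhds hv)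
  let S : ℕ → Set ℂ := fun D => {u ∈ closedBall v r | RatD D D fun m => c m u}
  have hS : ∀ D, IsClosed (S D ∪ (ball v r)ᶜ) := by
    intro D
    have : IsClosed (S D) := by
      have : S D = ⋂ f : Fin (D+1) → {m : ℕ // D < m}, {u ∈ closedBall v r | (Matrix.of fun i (k : Fin (D+1)) => erow (fun m => c m u) (f i) k).det ∈ ({0} : Set ℂ)} := by
        ext u
        simp only [S, RatD_iff, mem_ofPred_eq, mem_iInter, mem_singleton_iff]
        constructor
        · exact fun h f => ⟨h.1, h.2 f⟩
        · intro h
          exact ⟨(h fun _ => ⟨D+1, by omega⟩).1, fun f => (h f).2⟩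
      rw [this]
      refine isClosed_iInter fun f => ?_
      exact ((det_analytic hc (fun i => (f i : ℕ))).continuousOn.mono (hrV.trans hVU)).preimage_isClosed_of_isClosed Metric.isClosed_closedBall isClosed_singleton
    exact this.union isOpen_ball.isClosed_compl
  have hu : ⋃ D, (S D ∪ (ball v r)ᶜ) = univ := by
    rw [eq_univ_iff_forall]
    intro u
    by_cases hu : u ∈ ball v r
    · obtain ⟨D, hD⟩ := h u (hrV (Metric.ball_subset_closedBall hu))
      exact mem_iUnion.2 ⟨D, Or.inl ⟨Metric.ball_subset_closedBall hu, hD⟩⟩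
    · exact mem_iUnion.2 ⟨0, Or.inr hu⟩
  have hd := dense_iUnion_interior_of_closed hS hu
  obtain ⟨x, hx, hx'⟩ := hd.inter_open_nonempty _ isOpen_ball ⟨v, mem_ball_self hr⟩
  obtain ⟨D, hD⟩ := mem_iUnion.1 hx'
  refine ⟨D, RatD_ident hc hU (isOpen_interior.inter isOpen_ball) ⟨x, hD, hx⟩ ?_ ?_⟩
  · exact fun u hu => hVU (hrV (Metric.ball_subset_closedBall hu.2))
  · rintro u ⟨hu, hu'⟩
    rcases interior_subset hu with h | h
    · exact h.2
    · exact absurd hu' h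
lemma EE_nsmul (c : ℕ → ℂ) (r : ℕ) : EE (r • c) = EE c ^ r := by
  induction r with
  | zero => simp [EE_zero]
  | succ r ih => rw [add_smul, one_smul, EE_add, ih, pow_succ]
lemma EE_sum {ι} (J : Finset ι) (c : ι → ℕ → ℂ) : EE (∑ j ∈ J, c j) = ∏ j ∈ J, EE (c j) := by
  classical
  induction J using Finset.induction_on with
  | empty => simp [EE_zero]
  | insert a s ha ih => rw [Finset.sum_insert ha, Finset.prod_insert ha, EE_add, ih]
lemma EE_zsmul_pw (α : ℂ) (k : ℤ) : EE (k • pw α) * (lin α ^ (-k).toNat : Polynomial ℂ) = ((lin α ^ k.toNat : Polynomial ℂ) : PowerSeries ℂ) := by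
  rw [Polynomial.coe_pow, Polynomial.coe_pow, ← EE_pw, ← EE_nsmul, ← EE_nsmul, ← EE_add, ← natCast_zsmul, ← add_smul, ← natCast_zsmul]
  congr 2; omega
lemma lin_mult {α β : ℂ} (hβ : β ≠ 0) : (lin α).rootMultiplicity β⁻¹ = if α = β then 1 else 0 := by
  split_ifs with h
  · have : lin α = Polynomial.C (-β) * (Polynomial.X - Polynomial.C β⁻¹) := by
      simp only [lin, h, mul_sub, ← Polynomial.C_mul]; simp [hβ]; ring
    rw [this, Polynomial.rootMultiplicity_mul (by rw [← this]; exact lin_ne _), Polynomial.rootMultiplicity_X_sub_C_self, Polynomial.rootMultiplicity_C]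
  · rw [Polynomial.rootMultiplicity_eq_zero_iff]
    intro me
    exfalso; apply h
    simp only [lin, Polynomial.IsRoot, eval_sub, eval_mul, Polynomial.eval_one, eval_C, eval_X] at me
    field_simp at me
    linear_combination -me
lemma rm_pow {p : Polynomial ℂ} (x : ℂ) (k : ℕ) (_ : p ≠ 0) : (p ^ k).rootMultiplicity x = k * p.rootMultiplicity x := by
  rw [← Polynomial.count_roots, Polynomial.roots_pow, Multiset.count_nsmul, Polynomial.count_roots]
lemma rm_prod {ι} (J : Finset ι) (p : ι → Polynomial ℂ) (x : ℂ) (hp : ∀ j ∈ J, p j ≠ 0) : (∏ j ∈ J, p j).rootMultiplicity x = ∑ j ∈ J, (p j).rootMultiplicity x := by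
  classical
  induction J using Finset.induction_on with
  | empty => simp [← Polynomial.C_1, Polynomial.rootMultiplicity_C, -map_one]
  | insert a s ha ih =>
    have we : ∀ j ∈ s, p j ≠ 0 := fun j hj => hp j (Finset.mem_insert_of_mem hj)
    rw [Finset.prod_insert ha, Finset.sum_insert ha, Polynomial.rootMultiplicity_mul, ih we]
    exact mul_ne_zero (hp a (Finset.mem_insert_self _ _)) (prod_ne_zero_iff.2 we)
lemma rm_le {p : Polynomial ℂ} (x : ℂ) : p.rootMultiplicity x ≤ p.natDegree := by
  by_cases hp : p = 0
  · simp [hp]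
  rw [← Polynomial.count_roots]
  exact (Multiset.count_le_card _ _).trans (Polynomial.card_roots' p)
lemma coe_prod' {ι} (J : Finset ι) (p : ι → Polynomial ℂ) : ((∏ j ∈ J, p j : Polynomial ℂ) : PowerSeries ℂ) = ∏ j ∈ J, (p j : PowerSeries ℂ) :=
  map_prod (Polynomial.coeToPowerSeries.ringHom) _ _
lemma cancel_sum {ι} (J : Finset ι) (β : ι → ℂ) (k : ι → ℤ) {c : ℕ → ℂ} {D : ℕ}
    (h : ∀ r : ℕ, RatD D D (c + r • ∑ j ∈ J, k j • pw (β j))) {x : ℂ} (hx : x ≠ 0) :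
    ∑ j ∈ J with β j = x, k j = 0 := by
  obtain ⟨Q, P, me, we, us, up⟩ := h 0
  set S := ∑ j ∈ J, k j • pw (β j) with hS
  set Sp : Polynomial ℂ := ∏ j ∈ J, lin (β j) ^ (k j).toNat with hSp
  set Sm : Polynomial ℂ := ∏ j ∈ J, lin (β j) ^ (-k j).toNat with hSm
  have hE : EE S * Sm = (Sp : PowerSeries ℂ) := by
    rw [hS, EE_sum, hSm, hSp, coe_prod', coe_prod', ← Finset.prod_mul_distrib]
    exact prod_congr rfl fun j _ => EE_zsmul_pw _ _
  have hSp0 : Sp ≠ 0 := prod_ne_zero_iff.2 fun j _ => pow_ne_zero _ (lin_ne _)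
  have hSm0 : Sm ≠ 0 := prod_ne_zero_iff.2 fun j _ => pow_ne_zero _ (lin_ne _)
  have nz : ∀ {c' : ℕ → ℂ} {Q' P' : Polynomial ℂ}, Q' ≠ 0 → EE c' * (Q' : PowerSeries ℂ) = P' → P' ≠ 0 := by
    rintro c' Q' P' hQ he rfl
    rw [Polynomial.coe_zero, mul_eq_zero] at he
    rcases he with he | he
    · exact EE_ne _ he
    · exact hQ (by exact_mod_cast he)
  have hP := nz me up
  obtain ⟨Q', P', h1', h2', h3', h4'⟩ := h (2 * D + 1)
  have hP' := nz h1' h4'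
  rw [EE_add, EE_nsmul] at h4'
  simp only [zero_smul, add_zero] at up
  have key : P * Q' * Sp ^ (2*D+1) = P' * Q * Sm ^ (2*D+1) := by
    have : ((P * Q' * Sp ^ (2*D+1) : Polynomial ℂ) : PowerSeries ℂ) = (P' * Q * Sm ^ (2*D+1) : Polynomial ℂ) := by
      push_cast
      rw [← up, ← h4', ← hE]; ring
    exact_mod_cast this
  have key2 := congrArg (Polynomial.rootMultiplicity x⁻¹) key
  rw [Polynomial.rootMultiplicity_mul (mul_ne_zero (mul_ne_zero hP h1') (pow_ne_zero _ hSp0)),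
    Polynomial.rootMultiplicity_mul (mul_ne_zero (mul_ne_zero hP' me) (pow_ne_zero _ hSm0)),
    Polynomial.rootMultiplicity_mul (mul_ne_zero hP h1'), Polynomial.rootMultiplicity_mul (mul_ne_zero hP' me),
    rm_pow _ _ hSp0, rm_pow _ _ hSm0] at key2
  have am := (rm_le (p := P) x⁻¹).trans us
  have ok := (rm_le (p := P') x⁻¹).trans h3'
  have de := (rm_le (p := Q) x⁻¹).trans we
  have e4 := (rm_le (p := Q') x⁻¹).trans h2'
  have hpq : Sp.rootMultiplicity x⁻¹ = Sm.rootMultiplicity x⁻¹ := by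
    rcases lt_trichotomy (Sp.rootMultiplicity x⁻¹) (Sm.rootMultiplicity x⁻¹) with h | h | h
    · nlinarith
    · exact h
    · nlinarith
  rw [hSp, hSm, rm_prod _ _ _ fun j _ => pow_ne_zero _ (lin_ne _), rm_prod _ _ _ fun j _ => pow_ne_zero _ (lin_ne _)] at hpq
  simp only [rm_pow _ _ (lin_ne _), lin_mult hx, mul_ite, mul_one, mul_zero, ← Finset.sum_filter] at hpq
  have hz : ((∑ j ∈ J with β j = x, (k j).toNat : ℕ) : ℤ) = (∑ j ∈ J with β j = x, (-k j).toNat : ℕ) := by rw [hpq]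
  push_cast at hz
  rw [← sub_eq_zero, ← sum_sub_distrib] at hz
  rw [← hz]
  exact sum_congr rfl fun j _ => by omega
lemma cancel_pos {ι} (J : Finset ι) (β : ι → ℂ) (k : ι → ℤ) {c : ℕ → ℂ} {D : ℕ}
    (h : ∀ r : ℕ, RatD D D (c + r • ∑ j ∈ J, k j • pw (β j))) {j : ι} (hj : j ∈ J) (hb : β j ≠ 0) (hk : k j ≠ 0) :
    ∃ i ∈ J, β i = β j ∧ k i * k j < 0 := by
  have := cancel_sum J β k h hb
  by_contra! hcon
  have we : ∑ i ∈ J with β i = β j, k i * k j = 0 := by rw [← sum_mul, this, zero_mul]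
  rw [Finset.sum_eq_zero_iff_of_nonneg (fun i hi => by
    rw [Finset.mem_filter] at hi; exact hcon i hi.1 hi.2)] at we
  have := we j (by simp [hj])
  simp [hk] at this
lemma coprime_roots {ι ι'} (J : Finset ι) (J' : Finset ι') (α : ι → ℂ) (β : ι' → ℂ) (x : ℂ) (hα : ∀ j ∈ J, α j ≠ 0)
    (h : RatD (J.card - 1) J'.card (∑ j ∈ J, pw (α j) - ∑ j ∈ J', pw (β j) - pw x)) (hJ : J.Nonempty) :
    (∃ j ∈ J, α j = x) ∨ ∃ j ∈ J, ∃ i ∈ J', α j = β i := by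
  by_contra! hcon
  obtain ⟨Q, P, me, we, us, up⟩ := h
  have hE : EE (∑ j ∈ J, pw (α j) - ∑ j ∈ J', pw (β j) - pw x) * (((∏ j ∈ J', lin (β j)) * lin x : Polynomial ℂ) : PowerSeries ℂ) = (∏ j ∈ J, lin (α j) : Polynomial ℂ) := by
    rw [Polynomial.coe_mul, coe_prod', coe_prod']
    simp only [← EE_pw]
    rw [← EE_sum, ← EE_add, ← EE_add, ← EE_sum]
    congr 1; abel
  have key : Q * ∏ j ∈ J, lin (α j) = P * ((∏ j ∈ J', lin (β j)) * lin x) := by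
    have : ((Q * ∏ j ∈ J, lin (α j) : Polynomial ℂ) : PowerSeries ℂ) = (P * ((∏ j ∈ J', lin (β j)) * lin x) : Polynomial ℂ) := by
      rw [Polynomial.coe_mul, Polynomial.coe_mul, ← hE, ← up]; ring
    exact_mod_cast this
  have hcop : ∀ a b : ℂ, a ≠ b → IsCoprime (lin a) (lin b) := by
    intro a b hab
    refine ⟨Polynomial.C (-b / (a - b)), Polynomial.C (a / (a-b)), ?_⟩
    have : a - b ≠ 0 := sub_ne_zero.2 hab
    apply Polynomial.funext; intro y
    simp [lin]; field_simp; ring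
  have hdvd : (∏ j ∈ J, lin (α j)) ∣ P := by
    refine IsCoprime.dvd_of_dvd_mul_right (z := (∏ j ∈ J', lin (β j)) * lin x) ?_ ⟨Q, by rw [← key]; ring⟩
    refine IsCoprime.mul_right ?_ ?_
    · exact IsCoprime.prod_left fun i hi => IsCoprime.prod_right fun j hj => hcop _ _ (hcon.2 i hi j hj)
    · exact IsCoprime.prod_left fun i hi => hcop _ _ (hcon.1 i hi)
  have hP0 : P ≠ 0 := by
    rintro rfl
    rw [zero_mul, mul_eq_zero, Finset.prod_eq_zero_iff] at key
    rcases key with h | ⟨j, _, h⟩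
    · exact me h
    · exact lin_ne _ h
  have hdeg := Polynomial.natDegree_le_of_dvd hdvd hP0
  rw [Polynomial.natDegree_prod _ _ fun j _ => lin_ne _] at hdeg
  have : ∀ j ∈ J, (lin (α j)).natDegree = 1 := by
    intro j hj
    have : lin (α j) = Polynomial.C (-α j) * Polynomial.X + Polynomial.C 1 := by simp [lin]; ring
    rw [this, Polynomial.natDegree_linear (neg_ne_zero.2 (hα j hj))]
  rw [sum_congr rfl this] at hdeg
  simp at hdeg
  have := hJ.card_pos
  omega
end

section
lemma LOG {f : ℂ → ℂ} {z : ℂ} (hf : AnalyticAt ℂ f z) (h : ¬ ∀ᶠ x in 𝓝 z, f x = 0) :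
    ∃ (l : ℕ) (L : ℂ → ℂ), AnalyticAt ℂ L z ∧ (∀ᶠ x in 𝓝 z, f x = (x - z) ^ l * exp (L x)) ∧ (l = 0 ↔ f z ≠ 0) := by
  obtain ⟨l, g, hg, hg0, he⟩ := hf.exists_eventuallyEq_pow_smul_nonzero_iff.2 h
  refine ⟨l, fun x => log (g z) + log (g x / g z), ?_, ?_, ?_⟩
  · refine analyticAt_const.add ((hg.div analyticAt_const hg0).clog ?_)
    simp [hg0]
  · filter_upwards [he, hg.continuousAt.eventually_ne hg0] with x hx lo
    rw [hx, exp_add, exp_log hg0, exp_log (div_ne_zero lo hg0), smul_eq_mul]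
    field_simp
  · have := he.self_of_nhds
    rw [this]
    rcases Nat.eq_zero_or_pos l with my | my
    · simp [my, hg0]
    · simp [my.ne']
lemma LLL {q : ℂ → ℂ} {z : ℂ} (hq : AnalyticAt ℂ q z) (h : ¬ ∀ᶠ x in 𝓝 z, q x = q z) :
    ∃ (k : ℕ) (ψ φ : ℂ → ℂ), 0 < k ∧ AnalyticAt ℂ ψ z ∧ ψ z = 0 ∧ AnalyticAt ℂ φ 0 ∧ φ 0 = z ∧
      (∀ᶠ x in 𝓝 z, q x = q z + ψ x ^ k) ∧ (∀ᶠ x in 𝓝 z, φ (ψ x) = x) ∧ (∀ᶠ s in 𝓝 0, ψ (φ s) = s) := by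
  obtain ⟨k, L, hL, he, my⟩ := LOG (f := fun x => q x - q z) (hq.sub analyticAt_const) (by simpa [sub_eq_zero] using h)
  have hk : 0 < k := by rw [Nat.pos_iff_ne_zero]; simp [my]
  have hk0 : (k : ℂ) ≠ 0 := by exact_mod_cast hk.ne'
  set ψ : ℂ → ℂ := fun x => (x - z) * exp (L x / k) with hψ
  have hψa : AnalyticAt ℂ ψ z := (analyticAt_id.sub analyticAt_const).mul (hL.div analyticAt_const hk0).cexp
  have hz : ψ z = 0 := by simp [hψ]
  have hd : deriv ψ z ≠ 0 := by
    have me : HasDerivAt (fun x : ℂ => exp (L x / k)) _ z := (hL.div analyticAt_const hk0).cexp.differentiableAt.hasDerivAt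
    have := ((hasDerivAt_id z).sub_const z).mul me
    rw [show ψ = (fun x => id x - z) * fun x : ℂ => exp (L x / k) from rfl, this.deriv]
    simp
  refine ⟨k, ψ, hψa.hasStrictDerivAt.localInverse _ _ _ hd, hk, hψa, hz, ?_, ?_, ?_, ?_, ?_⟩
  · have := hψa.analyticAt_localInverse hd
    rwa [hz] at this
  · conv_lhs => rw [← hz]
    exact HasStrictFDerivAt.localInverse_apply_image ..
  · filter_upwards [he] with x hx
    rw [hψ]; simp only [mul_pow, ← exp_nat_mul]
    rw [mul_div_cancel₀ _ hk0, ← hx]; ring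
  · exact HasStrictFDerivAt.eventually_left_inverse ..
  · have : ∀ᶠ y in 𝓝 (ψ z), ψ (hψa.hasStrictDerivAt.localInverse _ _ _ hd y) = y := HasStrictFDerivAt.eventually_right_inverse ..
    rwa [hz] at this
lemma entire_const {q : ℂ → ℂ} (hq : Differentiable ℂ q) {z w : ℂ} (h : ∃ᶠ x in 𝓝[≠] z, q x = w) : ∀ x, q x = w := by
  have := AnalyticOnNhd.eqOn_of_preconnected_of_frequently_eq (f := q) (g := fun _ => w) (U := univ)
    (fun x _ => hq.analyticAt x) (fun x _ => analyticAt_const) isPreconnected_univ (mem_univ z) h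
  exact fun x => this (mem_univ x)
lemma LLb {q : ℂ → ℂ} (hq : Differentiable ℂ q) (hc : ¬ ∃ w, ∀ x, q x = w) (w : ℂ) {R : ℝ}
    (hR : ∀ x, ‖x‖ = R → q x ≠ w) :
    ∃ K₀ > 0, ∀ K > 0, K₀ ∣ K → ∃ (ι : Type) (_ : Fintype ι) (ξ : ι → ℂ → ℂ),
      (∀ j, AnalyticAt ℂ (ξ j) 0) ∧ (∀ x, ‖x‖ ≤ R → q x = w → ∃ j, ξ j 0 = x) ∧ ∀ᶠ s in 𝓝 (0:ℂ),
      (∀ j, q (ξ j s) = w + s ^ K ∧ ‖ξ j s‖ < R) ∧ (s ≠ 0 → Function.Injective fun j => ξ j s) ∧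
      ∀ x ∈ closedBall (0:ℂ) R, q x = w + s ^ K → ∃ j, ξ j s = x := by
  classical
  have hnc : ∀ z w, ¬ ∃ᶠ x in 𝓝[≠] z, q x = w := fun z w h => hc ⟨w, entire_const hq h⟩
  have hfin : ({x ∈ closedBall (0:ℂ) R | q x = w}).Finite := by
    by_contra hinf
    obtain ⟨z, _, hz⟩ := Set.Infinite.exists_accPt_of_subset_isCompact hinf (isCompact_closedBall (0:ℂ) R) (fun x hx => hx.1)
    exact hnc z w ((accPt_iff_frequently_nhdsNE.1 hz).mono fun x hx => hx.2)
  set Z : Type := {x : ℂ // x ∈ closedBall (0:ℂ) R ∧ q x = w}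
  have : Finite Z := hfin
  have := Fintype.ofFinite Z
  choose k ψ φ hk hψ hψ0 hφ hφ0 me we us using fun z : Z => LLL (hq.analyticAt z.1) (fun h => hnc z.1 (q z.1) (by
    exact (h.filter_mono nhdsWithin_le_nhds).frequently))
  refine ⟨∏ z, k z, Finset.prod_pos fun z _ => hk z, fun K hK hdvd => ?_⟩
  have hl : ∀ z, ∃ l, K = k z * l := fun z => (Finset.dvd_prod_of_mem k (Finset.mem_univ z)).trans hdvd
  choose l hl using hl
  have hl0 : ∀ z, l z ≠ 0 := fun z h => by have := hl z; rw [h] at this; omega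
  have hprim := fun z => isPrimitiveRoot_exp (k z) (hk z).ne'
  set ω : Z → ℂ := fun z => exp (2 * Real.pi * I / k z)
  set p : (Σ z : Z, Fin (k z)) → ℂ → ℂ := fun j s => ω j.1 ^ (j.2 : ℕ) * s ^ l j.1 with hp
  have hp0 : ∀ j, p j 0 = 0 := fun j => by simp [hp, hl0]
  have hpa : ∀ j, AnalyticAt ℂ (p j) 0 := fun j => by simp only [hp]; fun_prop
  have hpt : ∀ j, Tendsto (p j) (𝓝 0) (𝓝 0) := fun j => by
    have := (hpa j).continuousAt.tendsto; rwa [hp0] at this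
  have hpk : ∀ j s, p j s ^ k j.1 = s ^ K := fun j s => by
    rw [hl j.1, hp]; simp only [mul_pow, ← pow_mul]
    rw [mul_comm (j.2 : ℕ), pow_mul, (hprim j.1).pow_eq_one, one_pow, one_mul, mul_comm]
  set ξ : (Σ z : Z, Fin (k z)) → ℂ → ℂ := fun j s => φ j.1 (p j s) with hξ
  have hξa : ∀ j, AnalyticAt ℂ (ξ j) 0 := fun j => AnalyticAt.fun_comp (by rw [hp0]; exact hφ _) (hpa j)
  have hξ0 : ∀ j, ξ j 0 = j.1.1 := fun j => by simp only [hξ, hp0, hφ0]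
  have hξt : ∀ j, Tendsto (ξ j) (𝓝 0) (𝓝 j.1.1) := fun j => by
    have := (hξa j).continuousAt.tendsto; rwa [hξ0] at this
  have hin : ∀ z : Z, ‖z.1‖ < R := fun z => lt_of_le_of_ne (by simpa using z.2.1) fun h => hR _ h z.2.2
  refine ⟨_, inferInstance, ξ, hξa, ?_, ?_⟩
  · intro x hx hqx
    exact ⟨⟨⟨x, by simpa using hx, hqx⟩, ⟨0, hk _⟩⟩, hξ0 _⟩
  have am : ∀ᶠ s in 𝓝 (0:ℂ), ∀ j, q (ξ j s) = w + s ^ K ∧ ‖ξ j s‖ < R := by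
    rw [eventually_all]
    intro j
    filter_upwards [(hξt j).eventually (me j.1), (hpt j).eventually (us j.1), (hξt j).norm.eventually (eventually_lt_nhds (hin j.1))] with s er il a3
    refine ⟨?_, a3⟩
    rw [er, j.1.2.2, show ψ j.1 (ξ j s) = p j s from il, hpk]
  have ok : ∀ᶠ s in 𝓝 (0:ℂ), ∀ j j', s ≠ 0 → ξ j s = ξ j' s → j = j' := by
    rw [eventually_all]; intro j
    rw [eventually_all]; intro j'
    by_cases hjj : j.1 = j'.1
    · obtain ⟨z, a⟩ := j
      obtain ⟨z', b⟩ := j'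
      obtain rfl : z = z' := hjj
      filter_upwards [(hpt ⟨z, a⟩).eventually (us z), (hpt ⟨z, b⟩).eventually (us z)] with s er il hs he
      have : p ⟨z, a⟩ s = p ⟨z, b⟩ s := by rw [← er, ← il]; exact congrArg _ he
      have := mul_right_cancel₀ (pow_ne_zero _ hs) this
      have := (hprim z).pow_inj a.2 b.2 this
      rw [Fin.ext this]
    · have : j.1.1 ≠ j'.1.1 := fun h => hjj (Subtype.ext h)
      filter_upwards [((hξt j).prodMk_nhds (hξt j')).eventually ((isOpen_ne_fun continuous_fst continuous_snd).mem_nhds this)] with s er _ he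
      exact absurd he er
  have de : ∀ᶠ s in 𝓝 (0:ℂ), ∀ x ∈ closedBall (0:ℂ) R, q x = w + s ^ K → ∃ j, ξ j s = x := by
    refine (isCompact_closedBall (0:ℂ) R).eventually_forall_of_forall_eventually fun x hx => ?_
    have cx : Tendsto (fun y : ℂ × ℂ => y.2) (𝓝 (0, x)) (𝓝 x) := (continuous_snd.tendsto ((0:ℂ), x))
    by_cases hqx : q x = w
    · set z : Z := ⟨x, hx, hqx⟩ with hz
      have er := cx.eventually (me z)
      have il := cx.eventually (we z)
      filter_upwards [er, il] with y er il he
      rw [er] at he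
      have hps : ψ z y.2 ^ k z = (y.1 ^ l z) ^ k z := by
        rw [← pow_mul, mul_comm, ← hl z]
        have : q (z : ℂ) = w := hqx
        rw [this] at he
        exact add_left_cancel he
      by_cases hs : y.1 = 0
      · refine ⟨⟨z, ⟨0, hk z⟩⟩, ?_⟩
        rw [hs, zero_pow (hl0 z), zero_pow (hk z).ne'] at hps
        rw [hs, hξ0]
        rw [pow_eq_zero_iff (hk z).ne'] at hps
        rw [← il, hps, hφ0]
      · have : NeZero (k z) := ⟨(hk z).ne'⟩
        have hsl := pow_ne_zero (l z) hs
        obtain ⟨i, hi, hie⟩ := (hprim z).eq_pow_of_pow_eq_one (ξ := ψ z y.2 / y.1 ^ l z) (by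
          rw [div_pow, hps, div_self (pow_ne_zero _ hsl)])
        refine ⟨⟨z, ⟨i, hi⟩⟩, ?_⟩
        have : p ⟨z, ⟨i, hi⟩⟩ y.1 = ψ z y.2 := by
          simp only [hp, ω]; rw [hie]; field_simp
        simp only [hξ]; rw [this, il]
    · have t : Tendsto (fun y : ℂ × ℂ => q y.2 - (w + y.1 ^ K)) (𝓝 (0, x)) (𝓝 (q x - (w + 0 ^ K))) :=
        Continuous.tendsto (by have := hq.continuous; fun_prop) ((0:ℂ), x)
      have := t.eventually_ne (b₂ := 0) (by simpa [hK.ne', sub_eq_zero] using hqx)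
      filter_upwards [this] with y hy he
      exact absurd (sub_eq_zero.2 he) hy
  filter_upwards [am, ok, de] with s er il a3
  exact ⟨er, fun hs j j' h => il j j' hs h, a3⟩
end

section
lemma CI {f q : ℝ → ℂ} {a b : ℝ} (hf : ContinuousOn f (uIcc a b)) (hq : ContinuousOn q (uIcc a b)) {w : ℂ}
    (hw : w ∉ q '' uIcc a b) : AnalyticAt ℂ (fun w => ∫ t in a..b, f t / (w - q t)) w := by
  have hcl : IsClosed (q '' uIcc a b) := (isCompact_uIcc.image_of_continuousOn hq).isClosed
  rw [analyticAt_iff_eventually_differentiableAt]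
  filter_upwards [hcl.isOpen_compl.mem_nhds hw] with w hw
  obtain ⟨δ, hδ, hb⟩ := Metric.isOpen_iff.1 hcl.isOpen_compl w hw
  have hne : ∀ je ∈ ball w δ, ∀ t ∈ uIcc a b, je - q t ≠ 0 := fun je et t ht h =>
    hb et ⟨t, ht, (sub_eq_zero.1 h).symm⟩
  have hdist : ∀ t ∈ uIcc a b, δ ≤ ‖w - q t‖ := fun t ht => by
    by_contra! h
    exact hb (by rwa [Metric.mem_ball, dist_eq_norm, norm_sub_rev]) ⟨t, ht, rfl⟩
  have hsub := uIoc_subset_uIcc (a := a) (b := b)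
  refine (intervalIntegral.hasDerivAt_integral_of_dominated_loc_of_deriv_le (s := ball w (δ/2)) (F' := fun w t => - f t / (w - q t)^2) (bound := fun t => ‖f t‖ / (δ/2)^2) (ball_mem_nhds w (half_pos hδ)) ?_ ?_ ?_ ?_ ?_ ?_).2.differentiableAt
  · filter_upwards [ball_mem_nhds w hδ] with je et
    exact ((hf.div (continuousOn_const.sub hq) (hne je et)).mono hsub).aestronglyMeasurable measurableSet_uIoc
  · exact (hf.div (continuousOn_const.sub hq) (hne w (mem_ball_self hδ))).intervalIntegrable
  · exact ((hf.neg.div ((continuousOn_const.sub hq).pow 2) fun t ht => pow_ne_zero 2 (hne w (mem_ball_self hδ) t ht)).mono hsub).aestronglyMeasurable measurableSet_uIoc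
  · refine Eventually.of_forall fun t ht je et => ?_
    rw [norm_div, norm_neg, norm_pow]
    have me := hdist t (hsub ht)
    have we : ‖w - q t‖ ≤ ‖je - q t‖ + ‖je - w‖ := by
      have := norm_sub_le (je - q t) (je - w); simpa using this
    rw [Metric.mem_ball, dist_eq_norm] at et
    gcongr; linarith
  · exact (hf.norm.div_const _).intervalIntegrable
  · refine Eventually.of_forall fun t ht je et => ?_
    have my := hne je (Metric.ball_subset_ball (by linarith) et) t (hsub ht)
    have := ((hasDerivAt_id je).sub_const (q t)).fun_inv my
    simp only [div_eq_mul_inv (f t)]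
    refine (this.const_mul (f t)).congr_deriv ?_
    simp only [id]; ring
def Lam (T : ℝ) (ξ : ℂ) : ℂ := ∫ x in (0:ℝ)..T, 1 / (ξ - x)
lemma exp_Lam {T : ℝ} (hT : 0 < T) {ξ : ℂ} (h : ∀ x ∈ Icc 0 T, (x : ℂ) ≠ ξ) : exp (Lam T ξ) = ξ / (ξ - T) := by
  have hne : ∀ x ∈ Icc 0 T, ξ - (x:ℂ) ≠ 0 := fun x hx => sub_ne_zero.2 (h x hx).symm
  set F : ℝ → ℂ := fun t => (ξ - t) * exp (∫ x in (0:ℝ)..t, 1 / (ξ - x)) with hF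
  have hcont : ContinuousOn (fun x : ℝ => 1 / (ξ - (x:ℂ))) (Icc 0 T) := continuousOn_const.div (by fun_prop) hne
  have hint : IntervalIntegrable (fun x : ℝ => 1 / (ξ - (x:ℂ))) volume 0 T := (by rwa [uIcc_of_le hT.le] : ContinuousOn _ (uIcc 0 T)).intervalIntegrable
  have hFc : ContinuousOn F (Icc 0 T) := by
    refine ContinuousOn.mul (by fun_prop) (ContinuousOn.cexp ?_)
    have := intervalIntegral.continuousOn_primitive_interval' hint left_mem_uIcc
    rwa [uIcc_of_le hT.le] at this
  have hd : ∀ x ∈ Ico 0 T, HasDerivWithinAt F 0 (Ici x) x := by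
    intro x hx
    have hxI : x ∈ Icc 0 T := Ico_subset_Icc_self hx
    have hnh : Icc 0 T ∈ 𝓝[>] x := mem_of_superset (Ioc_mem_nhdsGT hx.2) fun y hy => ⟨hx.1.trans hy.1.le, hy.2⟩
    have me : HasDerivWithinAt (fun t => ∫ x in (0:ℝ)..t, 1 / (ξ - (x:ℂ))) (1 / (ξ - x)) (Ici x) x := by
      refine intervalIntegral.integral_hasDerivWithinAt_right (t := Ioi x) (hint.mono_set (uIcc_subset_uIcc_left (by rwa [uIcc_of_le hT.le]))) ?_ ?_
      · exact ⟨Icc 0 T, hnh, hcont.aestronglyMeasurable measurableSet_Icc⟩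
      · have hc : ContinuousAt (fun x : ℝ => 1 / (ξ - (x:ℂ))) x :=
          continuousAt_const.div (by fun_prop) (hne x hxI)
        exact hc.continuousWithinAt
    have we : HasDerivWithinAt (fun t : ℝ => ξ - (t:ℂ)) (-1) (Ici x) x := by
      simpa using ((ofRealCLM.hasDerivAt (x := x)).const_sub ξ).hasDerivWithinAt
    have := we.fun_mul me.cexp
    refine this.congr_deriv ?_
    have := hne x hxI
    field_simp; ring
  have := constant_of_has_deriv_right_zero hFc hd T (right_mem_Icc.2 hT.le)
  simp only [hF, intervalIntegral.integral_same, exp_zero, mul_one, ofReal_zero, sub_zero] at this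
  have my := hne T (right_mem_Icc.2 hT.le)
  rw [eq_div_iff my, mul_comm]; exact this
lemma dslope_diff {f : ℂ → ℂ} (hf : Differentiable ℂ f) (a : ℂ) : Differentiable ℂ (dslope f a) := by
  rw [← differentiableOn_univ] at hf ⊢
  exact (differentiableOn_dslope univ_mem).2 hf
lemma factor (s : Finset ℂ) {f : ℂ → ℂ} (hf : Differentiable ℂ f) (my : ∀ z ∈ s, f z = 0) :
    ∃ h : ℂ → ℂ, Differentiable ℂ h ∧ ∀ y, f y = (∏ z ∈ s, (y - z)) * h y := by
  induction s using Finset.induction_on with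
  | empty => exact ⟨f, hf, by simp⟩
  | insert a s ha ih =>
    obtain ⟨h, hd, hh⟩ := ih fun z hz => my z (Finset.mem_insert_of_mem hz)
    refine ⟨dslope h a, dslope_diff hd a, fun y => ?_⟩
    have me := my a (Finset.mem_insert_self _ _)
    rw [hh, mul_eq_zero, Finset.prod_eq_zero_iff] at me
    have we : h a = 0 := me.resolve_left (by
      rintro ⟨z, hz, hz'⟩; exact ha (by rwa [sub_eq_zero.1 hz']))
    rw [Finset.prod_insert ha, hh y]
    have := sub_smul_dslope h a y
    rw [we, sub_zero, smul_eq_mul] at this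
    rw [← this]; ring
lemma RES {q φ : ℂ → ℂ} (hq : Differentiable ℂ q) (hφ : Differentiable ℂ φ) {w : ℂ} {ρ : ℝ} (s : Finset ℂ)
    (hs : ∀ z, z ∈ s ↔ ‖z‖ ≤ ρ ∧ q z = w) (nu : ∀ z ∈ s, ‖z‖ < ρ ∧ deriv q z ≠ 0) {x : ℂ} (hx : ‖x‖ < ρ) (hqx : q x ≠ w) :
    φ x * deriv q x / (w - q x) = (2 * Real.pi * I)⁻¹ * (∮ y in C(0, ρ), φ y * deriv q y / (w - q y) / (y - x)) + ∑ z ∈ s, φ z / (z - x) := by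
  obtain ⟨h, hd, hh⟩ := factor s (f := fun y => q y - w) (hq.sub_const w) fun z hz => sub_eq_zero.2 ((hs z).1 hz).2
  have hh0 : ∀ y, ‖y‖ ≤ ρ → h y ≠ 0 := by
    intro y hy my
    have hqy : q y = w := by have := hh y; rw [my, mul_zero] at this; exact sub_eq_zero.1 this
    have hys := (hs y).2 ⟨hy, hqy⟩
    apply (nu y hys).2
    have e : q = fun y => (∏ z ∈ s, (y - z)) * h y + w := by ext y; rw [← hh]; ring
    have hp : DifferentiableAt ℂ (fun y => ∏ z ∈ s, (y - z)) y := by fun_prop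
    have := (hp.hasDerivAt.fun_mul (hd y).hasDerivAt).add_const w
    rw [e, this.deriv, my, Finset.prod_eq_zero hys (sub_self y)]; ring
  set D : ℂ → ℂ := fun y => - φ y * (deriv h y / h y) - ∑ z ∈ s, dslope φ z y with hD
  have hDd : DifferentiableOn ℂ D (closedBall 0 ρ) := by
    intro y hy
    have me : DifferentiableAt ℂ (fun y => - φ y * (deriv h y / h y)) y :=
      (hφ y).neg.fun_mul ((hd.analyticAt y).deriv.differentiableAt.fun_div (hd y) (hh0 y (by simpa using hy)))
    exact (me.sub (DifferentiableAt.fun_sum fun z _ => dslope_diff hφ z y)).differentiableWithinAt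
  have hG : ∀ y, ‖y‖ ≤ ρ → q y ≠ w → φ y * deriv q y / (w - q y) = D y - ∑ z ∈ s, φ z / (y - z) := by
    intro y hy hqy
    have hys : ∀ z ∈ s, y - z ≠ 0 := fun z hz my => hqy (by rw [sub_eq_zero.1 my]; exact ((hs z).1 hz).2)
    have e : logDeriv (fun y => q y - w) y = ∑ z ∈ s, 1 / (y - z) + deriv h y / h y := by
      rw [show (fun y => q y - w) = fun y => (∏ z ∈ s, (y - z)) * h y from funext hh]
      rw [logDeriv_mul y (prod_ne_zero_iff.2 hys) (hh0 y hy) (by fun_prop) (hd y), logDeriv_prod hys (fun z _ => by fun_prop)]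
      simp [logDeriv_apply]
    rw [logDeriv_apply, deriv_sub_const] at e
    have ok : φ y * deriv q y / (w - q y) = - φ y * (deriv q y / (q y - w)) := by
      rw [← neg_sub (q y) w, div_neg]; ring
    rw [ok, e, hD]
    have : ∀ z ∈ s, dslope φ z y = (φ y - φ z) / (y - z) := fun z hz => by
      rw [dslope_of_ne _ (sub_ne_zero.1 (hys z hz)), slope_def_field]
    simp only
    rw [sum_congr rfl this, mul_add, mul_sum]
    simp only [sub_div, sum_sub_distrib]
    simp only [mul_one_div, neg_div, Finset.sum_neg_distrib]
    ring
  have hρ : 0 < ρ := (norm_nonneg x).trans_lt hx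
  have hpi : (2 * Real.pi * I : ℂ) ≠ 0 := by simp [Real.pi_ne_zero]
  have hxb : x ∈ ball (0:ℂ) ρ := by simpa using hx
  have hC := hDd.circleIntegral_sub_inv_smul hxb
  have hxs : ∀ z ∈ s, x - z ≠ 0 := fun z hz my => hqx (by rw [sub_eq_zero.1 my]; exact ((hs z).1 hz).2)
  have hci : ∀ z, ‖z‖ < ρ → CircleIntegrable (fun y => (y - z)⁻¹) 0 ρ := fun z hz =>
    circleIntegrable_sub_inv_iff.2 (Or.inr (by simp [abs_of_pos hρ]; exact hz.ne))
  have hz : ∀ z ∈ s, CircleIntegrable (fun y => φ z / (y - z) / (y - x)) 0 ρ ∧ (∮ y in C(0, ρ), φ z / (y - z) / (y - x)) = 0 := by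
    intro z hz
    have e : EqOn (fun y => φ z / (y - z) / (y - x)) (fun y => (φ z / (x - z)) * ((y - x)⁻¹ - (y - z)⁻¹)) (Metric.sphere 0 ρ) := by
      intro y hy
      have hy' : ‖y‖ = ρ := by simpa using hy
      have me : y - x ≠ 0 := sub_ne_zero.2 (by rintro rfl; linarith)
      have we : y - z ≠ 0 := sub_ne_zero.2 (by rintro rfl; linarith [(nu _ hz).1])
      have us := hxs z hz
      simp only; field_simp; ring
    have c1 : CircleIntegrable (fun y => (φ z / (x - z)) * ((y - x)⁻¹ - (y - z)⁻¹)) 0 ρ :=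
      ((hci x hx).fun_sub (hci z (nu z hz).1)).const_mul _
    refine ⟨(circleIntegrable_congr (by rwa [abs_of_pos hρ])).2 c1, ?_⟩
    rw [circleIntegral.integral_congr hρ.le e, circleIntegral.integral_const_mul, circleIntegral.integral_sub (hci x hx) (hci z (nu z hz).1),
      circleIntegral.integral_sub_inv_of_mem_ball hxb, circleIntegral.integral_sub_inv_of_mem_ball (by simpa using (nu z hz).1)]
    ring
  have hDc : CircleIntegrable (fun y => D y / (y - x)) 0 ρ := by
    refine ContinuousOn.circleIntegrable hρ.le ((hDd.continuousOn.mono Metric.sphere_subset_closedBall).div (by fun_prop) fun y hy => ?_)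
    have hy' : ‖y‖ = ρ := by simpa using hy
    exact sub_ne_zero.2 (by rintro rfl; linarith)
  have hI : (∮ y in C(0, ρ), φ y * deriv q y / (w - q y) / (y - x)) = 2 * Real.pi * I * D x := by
    have : (∮ y in C(0, ρ), φ y * deriv q y / (w - q y) / (y - x)) = ∮ y in C(0, ρ), (D y / (y - x) - ∑ z ∈ s, φ z / (y - z) / (y - x)) := by
      refine circleIntegral.integral_congr hρ.le fun y hy => ?_
      have hy' : ‖y‖ = ρ := by simpa using hy
      rw [hG y hy'.le fun h => by linarith [(nu y ((hs y).2 ⟨hy'.le, h⟩)).1], sub_div, Finset.sum_div]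
    rw [this, circleIntegral.integral_sub hDc (CircleIntegrable.fun_sum _ fun z h => (hz z h).1), circleIntegral.integral_fun_sum fun z h => (hz z h).1,
      Finset.sum_eq_zero fun z h => (hz z h).2, sub_zero]
    rw [smul_eq_mul] at hC
    rw [← hC]
    congr 1; ext y; rw [smul_eq_mul]; ring
  rw [hI, hG x hx.le hqx, inv_mul_cancel_left₀ hpi, sub_eq_add_neg, ← Finset.sum_neg_distrib]
  congr 1
  refine sum_congr rfl fun z _ => ?_
  rw [← neg_sub x z, div_neg]
end

section
lemma Lam_an {T : ℝ} (hT : 0 < T) {y : ℂ} (hy : T < ‖y‖) : AnalyticAt ℂ (Lam T) y := by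
  refine CI (f := fun _ => 1) (q := fun x : ℝ => (x:ℂ)) continuousOn_const (by fun_prop) ?_
  rintro ⟨x, hx, rfl⟩
  rw [uIcc_of_le hT.le] at hx
  simp [abs_of_nonneg hx.1] at hy
  linarith [hx.2]
def HH (T ρ : ℝ) (q φ : ℂ → ℂ) (w : ℂ) : ℂ := (2 * Real.pi * I)⁻¹ * ∮ y in C(0, ρ), φ y * deriv q y / (w - q y) * Lam T y
lemma HH_an {T ρ : ℝ} (hT : 0 < T) (hρ : T < ρ) {q φ : ℂ → ℂ} (hq : Differentiable ℂ q) (hφ : Differentiable ℂ φ) {w : ℂ} (hw : ∀ y, ‖y‖ = ρ → q y ≠ w) :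
    AnalyticAt ℂ (HH T ρ q φ) w := by
  have hn : ∀ θ, ‖circleMap 0 ρ θ‖ = ρ := fun θ => by simp [norm_circleMap_zero, abs_of_pos (hT.trans hρ)]
  have h := CI (f := fun θ => deriv (circleMap 0 ρ) θ * (φ (circleMap 0 ρ θ) * deriv q (circleMap 0 ρ θ) * Lam T (circleMap 0 ρ θ))) (q := fun θ => q (circleMap 0 ρ θ)) (a := 0) (b := 2 * Real.pi) (w := w) ?_ ?_ ?_
  · refine analyticAt_const.mul (h.congr (Eventually.of_forall fun w => ?_))
    simp only [circleIntegral, smul_eq_mul]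
    congr 1; ext θ; ring
  · have me : Continuous (deriv (circleMap 0 ρ)) := (contDiff_circleMap 0 ρ).continuous_deriv_one
    have we : Continuous (deriv q) := (hq.contDiff (n := 1)).continuous_deriv_one
    have us : Continuous fun θ => Lam T (circleMap 0 ρ θ) := continuous_iff_continuousAt.2 fun θ =>
      ContinuousAt.comp (f := circleMap 0 ρ) (Lam_an hT (by rw [hn]; exact hρ)).continuousAt (continuous_circleMap 0 ρ).continuousAt
    have up := continuous_circleMap 0 ρ
    exact (me.mul (((hφ.continuous.comp up).mul (we.comp up)).mul us)).continuousOn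
  · exact (hq.continuous.comp (continuous_circleMap 0 ρ)).continuousOn
  · rintro ⟨θ, _, h⟩; exact hw _ (hn θ) h
lemma INT {T ρ : ℝ} (hT : 0 < T) (hρ : T < ρ) {q φ : ℂ → ℂ} (hq : Differentiable ℂ q) (hφ : Differentiable ℂ φ) {w : ℂ} (s : Finset ℂ)
    (hs : ∀ z, z ∈ s ↔ ‖z‖ ≤ ρ ∧ q z = w) (nu : ∀ z ∈ s, ‖z‖ < ρ ∧ deriv q z ≠ 0) (hw : ∀ x ∈ Icc 0 T, q (x:ℝ) ≠ w) :
    ∫ x in (0:ℝ)..T, φ x * deriv q x / (w - q x) = HH T ρ q φ w + ∑ z ∈ s, φ z * Lam T z := by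
  have hn : ∀ θ, ‖circleMap 0 ρ θ‖ = ρ := fun θ => by simp [norm_circleMap_zero, abs_of_pos (hT.trans hρ)]
  have hnx : ∀ x ∈ Icc 0 T, ‖(x:ℂ)‖ < ρ := fun x hx => by simp [abs_of_nonneg hx.1]; linarith [hx.2]
  have hqs : ∀ θ, w - q (circleMap 0 ρ θ) ≠ 0 := fun θ h => by
    have := nu _ ((hs _).2 ⟨(hn θ).le, (sub_eq_zero.1 h).symm⟩)
    linarith [hn θ, this.1]
  have we : Continuous (deriv q) := (hq.contDiff (n := 1)).continuous_deriv_one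
  set g : ℝ → ℂ := fun θ => deriv (circleMap 0 ρ) θ * (φ (circleMap 0 ρ θ) * deriv q (circleMap 0 ρ θ) / (w - q (circleMap 0 ρ θ))) with hg
  have hgc : Continuous g := by
    have me : Continuous (deriv (circleMap 0 ρ)) := (contDiff_circleMap 0 ρ).continuous_deriv_one
    have up := continuous_circleMap 0 ρ
    exact me.mul (((hφ.continuous.comp up).mul (we.comp up)).div (continuous_const.sub (hq.continuous.comp up)) hqs)
  have hden : ∀ x ∈ Icc 0 T, ∀ θ, circleMap 0 ρ θ - (x:ℂ) ≠ 0 := fun x hx θ h => by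
    have := hnx x hx; rw [← sub_eq_zero.1 h, hn] at this; exact lt_irrefl _ this
  have hcc : ContinuousOn (fun p : ℝ × ℝ => g p.2 / (circleMap 0 ρ p.2 - (p.1:ℂ))) (Icc 0 T ×ˢ univ) := by
    refine ContinuousOn.div (hgc.comp continuous_snd).continuousOn ?_ fun p hp => hden p.1 hp.1 p.2
    have := continuous_circleMap 0 ρ
    fun_prop
  have hsw : ∫ x in (0:ℝ)..T, ∫ θ in (0:ℝ)..2 * Real.pi, g θ / (circleMap 0 ρ θ - (x:ℂ)) = ∫ θ in (0:ℝ)..2 * Real.pi, ∫ x in (0:ℝ)..T, g θ / (circleMap 0 ρ θ - (x:ℂ)) := by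
    refine intervalIntegral_intervalIntegral_swap (F := fun x θ => g θ / (circleMap 0 ρ θ - (x:ℂ))) ?_
    have : IntegrableOn (fun p : ℝ × ℝ => g p.2 / (circleMap 0 ρ p.2 - (p.1:ℂ))) (Icc 0 T ×ˢ Icc 0 (2 * Real.pi)) :=
      (hcc.mono (prod_mono le_rfl (subset_univ _))).integrableOn_compact (isCompact_Icc.prod isCompact_Icc)
    refine this.mono_set (prod_mono ?_ ?_)
    · rw [uIoc_of_le hT.le]; exact Ioc_subset_Icc_self
    · rw [uIoc_of_le Real.two_pi_pos.le]; exact Ioc_subset_Icc_self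
  have hzne : ∀ z ∈ s, ∀ x ∈ Icc 0 T, z - ((x:ℝ):ℂ) ≠ 0 := fun z hz x hx h => hw x hx (by rw [← sub_eq_zero.1 h]; exact ((hs z).1 hz).2)
  have hzc : ∀ z ∈ s, IntervalIntegrable (fun x : ℝ => φ z / (z - (x:ℂ))) volume 0 T := fun z hz => by
    refine ContinuousOn.intervalIntegrable (continuousOn_const.div (by fun_prop) ?_)
    rw [uIcc_of_le hT.le]; exact hzne z hz
  have hzs : IntervalIntegrable (fun x : ℝ => ∑ z ∈ s, φ z / (z - (x:ℂ))) volume 0 T := by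
    have := IntervalIntegrable.sum s hzc
    rwa [Finset.sum_fn] at this
  have hic : IntervalIntegrable (fun x : ℝ => (2 * Real.pi * I)⁻¹ * ∫ θ in (0:ℝ)..2 * Real.pi, g θ / (circleMap 0 ρ θ - (x:ℂ))) volume 0 T := by
    have hsum : IntervalIntegrable (fun x : ℝ => φ x * deriv q x / (w - q x) - ∑ z ∈ s, φ z / (z - (x:ℂ))) volume 0 T := by
      refine IntervalIntegrable.sub (ContinuousOn.intervalIntegrable (ContinuousOn.div ?_ ?_ ?_)) hzs
      · have := hφ.continuous; fun_prop
      · have := hq.continuous; fun_prop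
      · rw [uIcc_of_le hT.le]; exact fun x hx h => hw x hx (sub_eq_zero.1 h).symm
    refine hsum.congr fun x hx => ?_
    rw [uIoc_of_le hT.le] at hx
    have hx' := Ioc_subset_Icc_self hx
    rw [RES hq hφ s hs nu (hnx x hx') (hw x hx'), add_sub_cancel_right]
    simp only [circleIntegral, smul_eq_mul, hg]
    congr 2; ext θ; ring
  calc ∫ x in (0:ℝ)..T, φ x * deriv q x / (w - q x)
      = ∫ x in (0:ℝ)..T, ((2 * Real.pi * I)⁻¹ * (∫ θ in (0:ℝ)..2 * Real.pi, g θ / (circleMap 0 ρ θ - (x:ℂ))) + ∑ z ∈ s, φ z / (z - (x:ℂ))) := by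
        refine intervalIntegral.integral_congr fun x hx => ?_
        rw [uIcc_of_le hT.le] at hx
        rw [RES hq hφ s hs nu (hnx x hx) (hw x hx)]
        simp only [circleIntegral, smul_eq_mul, hg]
        congr 3; ext θ; ring
    _ = _ := by
        rw [intervalIntegral.integral_add hic hzs, intervalIntegral.integral_const_mul, hsw, intervalIntegral.integral_finsetSum hzc]
        congr 1
        · simp only [HH, circleIntegral, smul_eq_mul, hg, Lam]
          congr 2; ext θ
          rw [← mul_assoc, ← intervalIntegral.integral_const_mul]
          congr 1; ext x; ring
        · refine sum_congr rfl fun z _ => ?_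
          rw [Lam, ← intervalIntegral.integral_const_mul]
          congr 1; ext x; ring
lemma exists_radius {q : ℂ → ℂ} (hq : Differentiable ℂ q) (hc : ¬ ∃ w, ∀ x, q x = w) (w : ℂ) (r : ℝ) : ∃ ρ > r, ∀ x, ‖x‖ = ρ → q x ≠ w := by
  have hfin : ({x ∈ closedBall (0:ℂ) (r+1) | q x = w}).Finite := by
    by_contra hinf
    obtain ⟨z, _, hz⟩ := Set.Infinite.exists_accPt_of_subset_isCompact hinf (isCompact_closedBall (0:ℂ) (r+1)) (fun x hx => hx.1)
    exact hc ⟨w, entire_const hq ((accPt_iff_frequently_nhdsNE.1 hz).mono fun x hx => hx.2)⟩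
  obtain ⟨ρ, me, we⟩ := ((Ioo_infinite (show r < r + 1 by linarith)).sdiff (hfin.image norm)).nonempty
  refine ⟨ρ, me.1, fun x hx hqx => we ⟨x, ⟨?_, hqx⟩, hx⟩⟩
  simpa [hx] using me.2.le
structure Br (T : ℝ) (q : ℂ → ℂ) (w : ℂ) (K : ℕ) (r : ℝ) {ι : Type} [Fintype ι] (ξ Λ : ι → ℂ → ℂ) (κ : ι → ℤ) (H : (ℂ → ℂ) → ℂ → ℂ) : Prop where
  an : ∀ j, AnalyticOnNhd ℂ (ξ j) (ball 0 r)
  eq : ∀ j, ∀ s ∈ ball (0:ℂ) r, q (ξ j s) = w + s ^ K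
  Λan : ∀ j, AnalyticOnNhd ℂ (Λ j) {u | u.re < Real.log r}
  per : ∀ j u, Λ j (u + 2 * Real.pi * I) = Λ j u + 2 * Real.pi * I * κ j
  pos : ∀ j, 0 < κ j ↔ ξ j 0 = 0
  neg : ∀ j, κ j < 0 ↔ ξ j 0 = T
  ends : (¬ ∃ w, ∀ x, q x = w) → ∀ x : ℂ, (x = 0 ∨ x = T) → q x = w → ∃ j, ξ j 0 = x
  Han : ∀ φ : ℂ → ℂ, Differentiable ℂ φ → AnalyticOnNhd ℂ (H φ) (ball w (r ^ K))
  form : ∀ u : ℂ, u.re < Real.log r → (∀ x ∈ Icc 0 T, q (x:ℝ) ≠ w + exp (K * u)) → ∃ N : ι → ℤ, ∀ φ : ℂ → ℂ, Differentiable ℂ φ →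
    ∫ x in (0:ℝ)..T, φ x * deriv q x / (w + exp (K * u) - q x) = 2 * Real.pi * I * (H φ (w + exp (K * u)) +
      ∑ j, φ (ξ j (exp u)) * (Λ j u / (2 * Real.pi * I) + N j))
lemma exists_Br {T : ℝ} (hT : 0 < T) {q : ℂ → ℂ} (hq : Differentiable ℂ q) (w : ℂ) : ∃ K₀ > 0, ∀ K > 0, K₀ ∣ K →
    ∃ (ι : Type) (_ : Fintype ι) (ξ Λ : ι → ℂ → ℂ) (κ : ι → ℤ) (H : (ℂ → ℂ) → ℂ → ℂ) (r₀ : ℝ), 0 < r₀ ∧ ∀ r, 0 < r → r ≤ r₀ → Br T q w K r ξ Λ κ H := by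
  by_cases hc : ∃ w, ∀ x, q x = w
  · obtain ⟨je, et⟩ := hc
    have hd : ∀ x, deriv q x = 0 := fun x => by rw [funext et]; simp
    refine ⟨1, one_pos, fun K hK _ => ⟨Empty, inferInstance, fun j => j.elim, fun j => j.elim, fun j => j.elim, 0, 1, one_pos, fun r hr _ => ?_⟩⟩
    exact ⟨fun j => j.elim, fun j => j.elim, fun j => j.elim, fun j => j.elim, fun j => j.elim, fun j => j.elim, fun h => absurd ⟨je, et⟩ h,
      fun φ _ => analyticOnNhd_const, fun u _ _ => ⟨fun j => j.elim, fun φ _ => by simp [hd]⟩⟩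
  obtain ⟨ρ, hρ, hρw⟩ := exists_radius hq hc w T
  obtain ⟨K₀, hK₀, h⟩ := LLb hq hc w hρw
  refine ⟨K₀, hK₀, fun K hK hdvd => ?_⟩
  obtain ⟨ι, _, ξ, ha, hends, hev⟩ := h K hK hdvd
  have hpi : (2 * Real.pi * I : ℂ) ≠ 0 := by simp [Real.pi_ne_zero]
  have hnc : ∀ j (c : ℂ), ¬ ∀ᶠ s in 𝓝 (0:ℂ), ξ j s - c = 0 := by
    intro j c my
    have me : ∀ᶠ s in 𝓝 (0:ℂ), s ^ K = 0 := by
      have h00 := my.self_of_nhds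
      have hev0 := (hev.self_of_nhds.1 j).1
      filter_upwards [my, hev] with s we us
      have := (us.1 j).1
      rw [sub_eq_zero.1 we] at this
      rw [sub_eq_zero.1 h00, zero_pow hK.ne', add_zero] at hev0
      rw [hev0] at this
      simpa using this.symm
    have we : ∀ᶠ s in 𝓝[≠] (0:ℂ), False := by
      filter_upwards [me.filter_mono nhdsWithin_le_nhds, self_mem_nhdsWithin] with s me we
      exact pow_ne_zero K we me
    exact we.exists.elim fun _ h => h
  choose l L hL hl hl0 using fun j => LOG (ha j) (by simpa using hnc j 0)
  choose l' L' hL' hl' hl0' using fun j => LOG ((ha j).fun_sub (analyticAt_const (v := (T:ℂ)))) (hnc j T)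
  have hcl : IsClosed (q '' Metric.sphere 0 ρ) := ((isCompact_sphere (0:ℂ) ρ).image hq.continuous).isClosed
  obtain ⟨δ, hδ, hδb⟩ := Metric.isOpen_iff.1 hcl.isOpen_compl w (by
    rintro ⟨x, hx, h⟩; exact hρw x (by simpa using hx) h)
  have hall : ∀ᶠ s in 𝓝 (0:ℂ), ∀ j, AnalyticAt ℂ (ξ j) s ∧ AnalyticAt ℂ (L j) s ∧ AnalyticAt ℂ (L' j) s ∧ ξ j s = s ^ l j * exp (L j s) ∧ ξ j s - T = s ^ l' j * exp (L' j s) := by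
    rw [eventually_all]
    intro j
    filter_upwards [(ha j).eventually_analyticAt, (hL j).eventually_analyticAt, (hL' j).eventually_analyticAt, hl j, hl' j] with s a b c d e
    exact ⟨a, b, c, by simpa using d, by simpa using e⟩
  obtain ⟨r₁, hr₁, hb⟩ := eventually_nhds_iff_ball.1 (hall.and hev)
  refine ⟨ι, inferInstance, ξ, fun j u => l j * u + L j (exp u) - (l' j * u + L' j (exp u)), fun j => (l j : ℤ) - l' j, fun φ w => HH T ρ q φ w / (2 * Real.pi * I), min r₁ (min δ 1), by positivity, fun r hr hrr => ?_⟩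
  have hr1 : r ≤ r₁ := hrr.trans (min_le_left _ _)
  have hrδ : r ≤ δ := hrr.trans ((min_le_right _ _).trans (min_le_left _ _))
  have hr2 : r ≤ 1 := hrr.trans ((min_le_right _ _).trans (min_le_right _ _))
  have hb' : ∀ s ∈ ball (0:ℂ) r, s ∈ ball (0:ℂ) r₁ := fun s hs => Metric.ball_subset_ball hr1 hs
  have hrK : r ^ K ≤ δ := (pow_le_of_le_one hr.le hr2 hK.ne').trans hrδ
  have hexp : ∀ u : ℂ, u.re < Real.log r → exp u ∈ ball (0:ℂ) r := fun u hu => by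
    rw [mem_ball_zero_iff, norm_exp]; exact (lt_log_iff_exp_lt hr).1 hu
  have hT0 : (T:ℂ) ≠ 0 := by exact_mod_cast hT.ne'
  have hcase : ∀ j, (l j ≠ 0 ↔ ξ j 0 = 0) ∧ (l' j ≠ 0 ↔ ξ j 0 = T) := fun j =>
    ⟨by rw [not_iff_comm, hl0 j], by rw [not_iff_comm, hl0' j, Ne, sub_eq_zero]⟩
  have hexcl : ∀ j, ¬ (l j ≠ 0 ∧ l' j ≠ 0) := fun j h => hT0 (by rw [← (hcase j).2.1 h.2, (hcase j).1.1 h.1])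
  refine ⟨fun j s hs => ((hb s (hb' s hs)).1 j).1, fun j s hs => ((hb s (hb' s hs)).2.1 j).1, fun j u hu => ?_, fun j u => ?_, fun j => ?_, fun j => ?_, fun _ x hx hqx => ?_, fun φ hφ je et => ?_, fun u hu hw => ?_⟩
  · have me := (hb _ (hb' _ (hexp u hu))).1 j
    have he : AnalyticAt ℂ exp u := analyticAt_cexp
    exact ((analyticAt_const.mul analyticAt_id).add (me.2.1.fun_comp he)).sub ((analyticAt_const.mul analyticAt_id).add (me.2.2.1.fun_comp he))
  · simp only [exp_add, exp_two_pi_mul_I, mul_one]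
    push_cast; ring
  · rw [← (hcase j).1]; have := hexcl j; omega
  · rw [← (hcase j).2]; have := hexcl j; omega
  · refine hends x ?_ hqx
    rcases hx with rfl | rfl
    · simpa using (hT.trans hρ).le
    · simpa [abs_of_pos hT] using hρ.le
  · refine (HH_an hT hρ hq hφ fun y hy h => ?_).div analyticAt_const hpi
    exact hδb (Metric.ball_subset_ball hrK et) ⟨y, by simpa using hy, h⟩
  · have hsb := hexp u hu
    set s := exp u with hs
    have na : s ≠ 0 := exp_ne_zero u
    have hsK : exp (K * u) = s ^ K := by rw [hs, exp_nat_mul]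
    rw [hsK] at hw ⊢
    obtain ⟨me, we, us, up⟩ := hb s (hb' s hsb)
    have hlam : ∀ j, ∃ N : ℤ, Lam T (ξ j s) = (l j * u + L j s - (l' j * u + L' j s)) + N * (2 * Real.pi * I) := by
      intro j
      rw [← exp_eq_exp_iff_exists_int, exp_Lam hT fun x hx h => hw x hx (by rw [h, (we j).1]), (me j).2.2.2.2, exp_sub, exp_add, exp_add, exp_nat_mul, exp_nat_mul, ← (me j).2.2.2.1]
    choose N hN using hlam
    refine ⟨N, fun φ hφ => ?_⟩
    have hder : ∀ j, deriv q (ξ j s) ≠ 0 := by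
      intro j my
      have am : HasDerivAt (fun s => q (ξ j s)) (deriv q (ξ j s) * deriv (ξ j) s) s :=
        (hq (ξ j s)).hasDerivAt.comp s (me j).1.differentiableAt.hasDerivAt
      have ok : HasDerivAt (fun s : ℂ => w + s ^ K) (K * s ^ (K-1)) s := (hasDerivAt_pow K s).const_add w
      have de : (fun s => q (ξ j s)) =ᶠ[𝓝 s] fun s => w + s ^ K := by
        filter_upwards [isOpen_ball.mem_nhds (hb' s hsb)] with s hs
        exact ((hb s hs).2.1 j).1
      have := (am.congr_of_eventuallyEq de.symm).unique ok
      rw [my, zero_mul] at this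
      exact mul_ne_zero (by exact_mod_cast hK.ne') (pow_ne_zero _ na) this.symm
    classical
    rw [INT hT hρ hq hφ (Finset.univ.image fun j => ξ j s) ?_ ?_ hw, Finset.sum_image (fun a _ b _ hab => us na hab), mul_add, mul_div_cancel₀ _ hpi, mul_sum]
    · congr 1
      refine sum_congr rfl fun j _ => ?_
      rw [hN j]; field_simp
    · intro z
      simp only [Finset.mem_image, Finset.mem_univ, true_and]
      constructor
      · rintro ⟨j, rfl⟩; exact ⟨(we j).2.le, (we j).1⟩
      · rintro ⟨hz, hqz⟩; exact up z (by simpa using hz) hqz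
    · intro z hz
      simp only [Finset.mem_image, Finset.mem_univ, true_and] at hz
      obtain ⟨j, rfl⟩ := hz
      exact ⟨(we j).2, hder j⟩
end

section
def cc (T : ℝ) (q g : ℂ → ℂ) (m : ℕ) (w : ℂ) : ℂ := (2 * Real.pi * I)⁻¹ * ∫ x in (0:ℝ)..T, g x ^ m * deriv q x / (w - q x)
lemma pi2_ne : (2 * Real.pi * I : ℂ) ≠ 0 := by simp [Real.pi_ne_zero]
lemma exp_2piN (u : ℂ) (R : ℕ) : exp (u + 2 * Real.pi * I * R) = exp u := by
  rw [exp_add, mul_comm _ (R:ℂ), exp_nat_mul_two_pi_mul_I, mul_one]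
lemma pws {ι} [Fintype ι] (k : ι → ℤ) (b : ι → ℂ) (m : ℕ) : (∑ j, k j • pw (b j)) m = ∑ j, (k j : ℂ) * b j ^ m := by
  rw [Finset.sum_apply]; exact sum_congr rfl fun j _ => by rw [Pi.smul_apply, zsmul_eq_mul, pw]
lemma ET1 {T : ℝ} {qA qB : ℂ → ℂ} {no : ℂ} {K : ℕ} {r : ℝ} (hr : 0 < r) (hK : 0 < K) {ι ι' : Type} [Fintype ι] [Fintype ι']
    {ξ Λ : ι → ℂ → ℂ} {κ : ι → ℤ} {H} {ξ' Λ' : ι' → ℂ → ℂ} {κ' : ι' → ℤ} {H'}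
    (bA : Br T qA no K r ξ Λ κ H) (bB : Br T qB no K r ξ' Λ' κ' H') {g el : ℂ → ℂ} (hg : Differentiable ℂ g) (hg' : Differentiable ℂ el) :
    ∃ F : ℕ → ℂ → ℂ, (∀ m, AnalyticOnNhd ℂ (F m) {u | u.re < Real.log r}) ∧
      (∀ u : ℂ, u.re < Real.log r → (∀ x ∈ Icc 0 T, qA (x:ℝ) ≠ no + exp (K * u)) → (∀ x ∈ Icc 0 T, qB (x:ℝ) ≠ no + exp (K * u)) →
        ∃ N : ι ⊕ ι' → ℤ, (fun m => cc T qA g m (no + exp (K * u)) - cc T qB el m (no + exp (K * u))) =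
          (fun m => F m u) + ∑ j, N j • pw (Sum.elim (fun j => g (ξ j (exp u))) (fun j => el (ξ' j (exp u))) j)) ∧
      ∀ u : ℂ, u.re < Real.log r → ∀ R : ℕ, (fun m => F m (u + 2 * Real.pi * I * R)) = (fun m => F m u) +
        R • ∑ j, (Sum.elim κ (fun j => - κ' j) j) • pw (Sum.elim (fun j => g (ξ j (exp u))) (fun j => el (ξ' j (exp u))) j) := by
  have hpi := pi2_ne
  have hexp : ∀ u : ℂ, u.re < Real.log r → exp u ∈ ball (0:ℂ) r := fun u hu => by
    rw [mem_ball_zero_iff, norm_exp]; exact (lt_log_iff_exp_lt hr).1 hu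
  have hexpK : ∀ u : ℂ, u.re < Real.log r → no + exp (K * u) ∈ ball no (r ^ K) := fun u hu => by
    have := hexp u hu
    rw [mem_ball_zero_iff] at this
    rw [mem_ball_iff_norm, add_sub_cancel_left, exp_nat_mul, norm_pow]
    exact pow_lt_pow_left₀ this (norm_nonneg _) hK.ne'
  have perN : ∀ j u (R : ℕ), Λ j (u + 2 * Real.pi * I * R) = Λ j u + 2 * Real.pi * I * κ j * R := by
    intro j u R
    induction R with
    | zero => simp
    | succ R ih => push_cast; rw [mul_add, mul_one, ← add_assoc, bA.per, ih]; ring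
  have perN' : ∀ j u (R : ℕ), Λ' j (u + 2 * Real.pi * I * R) = Λ' j u + 2 * Real.pi * I * κ' j * R := by
    intro j u R
    induction R with
    | zero => simp
    | succ R ih => push_cast; rw [mul_add, mul_one, ← add_assoc, bB.per, ih]; ring
  refine ⟨fun m u => (H (fun x => g x ^ m) (no + exp (K * u)) - H' (fun x => el x ^ m) (no + exp (K * u))) +
    (∑ j, g (ξ j (exp u)) ^ m * (Λ j u / (2 * Real.pi * I)) - ∑ j, el (ξ' j (exp u)) ^ m * (Λ' j u / (2 * Real.pi * I))), fun m u hu => ?_, fun u hu hA hB => ?_, fun u hu R => ?_⟩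
  · have he : AnalyticAt ℂ (fun u => no + exp (K * u)) u := by fun_prop
    have he' : AnalyticAt ℂ exp u := by fun_prop
    have me := AnalyticAt.fun_comp (f := fun u => no + exp (K * u)) (bA.Han _ (hg.fun_pow m) _ (hexpK u hu)) he
    have we := AnalyticAt.fun_comp (f := fun u => no + exp (K * u)) (bB.Han _ (hg'.fun_pow m) _ (hexpK u hu)) he
    refine (me.sub we).add (AnalyticAt.sub (Finset.analyticAt_fun_sum _ fun j _ => AnalyticAt.mul (AnalyticAt.pow ?_ m) ((bA.Λan j u hu).div analyticAt_const hpi)) (Finset.analyticAt_fun_sum _ fun j _ => AnalyticAt.mul (AnalyticAt.pow ?_ m) ((bB.Λan j u hu).div analyticAt_const hpi)))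
    · exact (hg.analyticAt _).fun_comp ((bA.an j _ (hexp u hu)).fun_comp he')
    · exact (hg'.analyticAt _).fun_comp ((bB.an j _ (hexp u hu)).fun_comp he')
  · obtain ⟨N, hN⟩ := bA.form u hu hA
    obtain ⟨N', hN'⟩ := bB.form u hu hB
    refine ⟨Sum.elim N (fun j => - N' j), ?_⟩
    ext m
    have am := hN (fun x => g x ^ m) (hg.pow m)
    have ok := hN' (fun x => el x ^ m) (hg'.pow m)
    rw [Pi.add_apply, pws]
    simp only [cc, am, ok, inv_mul_cancel_left₀ hpi, Fintype.sum_sum_type, Sum.elim_inl, Sum.elim_inr, Int.cast_neg, neg_mul, Finset.sum_neg_distrib, mul_add, sum_add_distrib]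
    have de : ∀ x y : ℂ, x * y = y * x := mul_comm
    simp only [de ((N _ : ℤ) : ℂ), de ((N' _ : ℤ) : ℂ)]
    ring
  · ext m
    have hexK : exp (K * (u + 2 * Real.pi * I * R)) = exp (K * u) := by
      rw [exp_nat_mul, exp_2piN, ← exp_nat_mul]
    rw [Pi.add_apply, Pi.smul_apply, pws]
    simp only [hexK, perN, perN', exp_2piN, Fintype.sum_sum_type, Sum.elim_inl, Sum.elim_inr, Int.cast_neg, neg_mul, Finset.sum_neg_distrib, nsmul_eq_mul]
    have e : ∀ a k l : ℂ, a * ((l + 2 * Real.pi * I * k * R) / (2 * Real.pi * I)) = a * (l / (2 * Real.pi * I)) + R * (k * a) := fun a k l => by field_simp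
    simp only [e, sum_add_distrib, ← mul_sum]
    ring
def Off (T : ℝ) (qA qB : ℂ → ℂ) (w : ℂ) : Prop := (∀ x ∈ Icc 0 T, qA (x:ℝ) ≠ w) ∧ (∀ x ∈ Icc 0 T, qB (x:ℝ) ≠ w)
lemma off_open {T : ℝ} {qA qB : ℂ → ℂ} (hA : Differentiable ℂ qA) (hB : Differentiable ℂ qB) : IsOpen {w | Off T qA qB w} := by
  have e : {w | Off T qA qB w} = ((fun x : ℝ => qA x) '' Icc 0 T)ᶜ ∩ ((fun x : ℝ => qB x) '' Icc 0 T)ᶜ := by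
    ext w; simp [Off]
  rw [e]
  have hA' : Continuous fun x : ℝ => qA x := hA.continuous.comp continuous_ofReal
  have hB' : Continuous fun x : ℝ => qB x := hB.continuous.comp continuous_ofReal
  exact ((isCompact_Icc.image hA').isClosed.isOpen_compl).inter ((isCompact_Icc.image hB').isClosed.isOpen_compl)
lemma off_dense {T : ℝ} {qA qB : ℂ → ℂ} (hA : Differentiable ℂ qA) (hB : Differentiable ℂ qB) : Dense {w | Off T qA qB w} := by
  have key : ∀ {q : ℂ → ℂ}, Differentiable ℂ q → Dense (range fun x : ℝ => q x)ᶜ := fun {q} hq => by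
    refine ContDiff.dense_compl_range_of_finrank_lt_finrank ?_ (by simp [finrank_real_complex])
    exact ((hq.contDiff (n := 1)).restrict_scalars ℝ).comp ofRealCLM.contDiff
  have key' : ∀ {q : ℂ → ℂ}, Differentiable ℂ q → Dense ((fun x : ℝ => q x) '' Icc 0 T)ᶜ := fun {q} hq =>
    (key hq).mono (compl_subset_compl.2 (image_subset_range _ _))
  have e : {w | Off T qA qB w} = ((fun x : ℝ => qA x) '' Icc 0 T)ᶜ ∩ ((fun x : ℝ => qB x) '' Icc 0 T)ᶜ := by
    ext w; simp [Off]
  rw [e]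
  refine (key' hA).inter_of_isOpen_left (key' hB) ?_
  exact (isCompact_Icc.image (hA.continuous.comp continuous_ofReal)).isClosed.isOpen_compl
lemma cc_hasSum {T R : ℝ} (hT : 0 < T) {f q : ℝ → ℂ} (hf : Continuous f) (hq : Continuous q) (hR : ∀ x ∈ Icc 0 T, ‖q x‖ ≤ R) {w : ℂ} (hw : R < ‖w‖) :
    HasSum (fun k : ℕ => (w ^ (k+1))⁻¹ * ∫ x in (0:ℝ)..T, f x * q x ^ k) (∫ x in (0:ℝ)..T, f x / (w - q x)) := by
  have hR0 : 0 ≤ R := (norm_nonneg _).trans (hR 0 ⟨le_rfl, hT.le⟩)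
  have hw0 : 0 < ‖w‖ := hR0.trans_lt hw
  have hr1 : R / ‖w‖ < 1 := (div_lt_one hw0).2 hw
  have hr0 : 0 ≤ R / ‖w‖ := by positivity
  have h := intervalIntegral.hasSum_integral_of_dominated_convergence (μ := volume) (a := 0) (b := T) (F := fun (k:ℕ) x => (w ^ (k+1))⁻¹ * (f x * q x ^ k)) (f := fun x => f x / (w - q x))
    (fun k x => ‖f x‖ * (‖w‖⁻¹ * (R / ‖w‖) ^ k)) ?_ ?_ ?_ ?_ ?_
  · simpa only [intervalIntegral.integral_const_mul] using h
  · intro k; exact (by fun_prop : Continuous _).aestronglyMeasurable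
  · intro k; refine Eventually.of_forall fun x hx => ?_
    rw [uIoc_of_le hT.le] at hx
    have := hR x (Ioc_subset_Icc_self hx)
    rw [norm_mul, norm_mul, norm_inv, norm_pow, norm_pow, div_pow, pow_succ]
    have : ‖q x‖ ^ k ≤ R ^ k := by gcongr
    calc (‖w‖^k * ‖w‖)⁻¹ * (‖f x‖ * ‖q x‖^k) ≤ (‖w‖^k * ‖w‖)⁻¹ * (‖f x‖ * R^k) := by gcongr
      _ = _ := by field_simp
  · refine Eventually.of_forall fun x hx => ?_
    exact ((summable_geometric_of_lt_one hr0 hr1).mul_left _).mul_left _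
  · simp only [tsum_mul_left]
    exact (hf.norm.mul continuous_const).intervalIntegrable _ _
  · refine Eventually.of_forall fun x hx => ?_
    rw [uIoc_of_le hT.le] at hx
    have me := hR x (Ioc_subset_Icc_self hx)
    have hw0' : w ≠ 0 := norm_pos_iff.1 hw0
    have hn : ‖q x / w‖ < 1 := by rw [norm_div, div_lt_one hw0]; linarith
    have we := (hasSum_geometric_of_norm_lt_one hn).mul_left (f x * w⁻¹)
    have hne : w - q x ≠ 0 := fun h => by rw [sub_eq_zero.1 h] at hw; linarith
    have e : f x * w⁻¹ * (1 - q x / w)⁻¹ = f x / (w - q x) := by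
      have : 1 - q x / w ≠ 0 := by
        rw [one_sub_div hw0']; exact div_ne_zero hne hw0'
      rw [one_sub_div hw0']; field_simp
    rw [e] at we
    refine we.congr_fun fun k => ?_
    rw [div_pow]; field_simp; ring
end

section
lemma ET2 {T : ℝ} {qA qB : ℂ → ℂ} {no : ℂ} {K : ℕ} {r : ℝ} (hr : 0 < r) (hK : 0 < K) {ι ι' : Type} [Fintype ι] [Fintype ι']
    {β : ι ⊕ ι' → ℂ → ℂ} {F : ℕ → ℂ → ℂ} {g el : ℂ → ℂ} (me : ∀ m, AnalyticOnNhd ℂ (F m) {u | u.re < Real.log r})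
    (we : ∀ u : ℂ, u.re < Real.log r → (∀ x ∈ Icc 0 T, qA (x:ℝ) ≠ no + exp (K * u)) → (∀ x ∈ Icc 0 T, qB (x:ℝ) ≠ no + exp (K * u)) →
        ∃ N : ι ⊕ ι' → ℤ, (fun m => cc T qA g m (no + exp (K * u)) - cc T qB el m (no + exp (K * u))) =
          (fun m => F m u) + ∑ j, N j • pw (β j u)) {V : Set ℂ} (hV : IsOpen V) (hne : V.Nonempty)
    (hVb : ∀ w ∈ V, w ∈ ball no (r ^ K) ∧ w ≠ no ∧ Off T qA qB w ∧ Rat' fun m => cc T qA g m w - cc T qB el m w) :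
    ∃ D, ∀ u : ℂ, u.re < Real.log r → RatD D D fun m => F m u := by
  have hUo : IsOpen {u : ℂ | u.re < Real.log r} := isOpen_lt continuous_re continuous_const
  refine Rat_ident (U := {u : ℂ | u.re < Real.log r}) (V := {u : ℂ | u.re < Real.log r} ∩ (fun u => no + exp (K * u)) ⁻¹' V) me ?_ ?_ ?_ inter_subset_left ?_
  · exact (convex_halfSpace_re_lt _).isPreconnected
  · exact hUo.inter (hV.preimage (by fun_prop))
  · obtain ⟨w, hw⟩ := hne
    obtain ⟨hb, hn, -⟩ := hVb w hw
    have hK0 : (K:ℂ) ≠ 0 := by exact_mod_cast hK.ne'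
    have e : exp (K * (log (w - no) / K)) = w - no := by
      rw [mul_div_cancel₀ _ hK0, exp_log (sub_ne_zero.2 hn)]
    refine ⟨log (w - no) / K, ?_, ?_⟩
    · rw [mem_ball_iff_norm, ← e, exp_nat_mul, norm_pow] at hb
      have := lt_of_pow_lt_pow_left₀ K hr.le hb
      rw [norm_exp] at this
      exact (lt_log_iff_exp_lt hr).2 this
    · rw [mem_preimage, e, add_sub_cancel]; exact hw
  · rintro u ⟨hu, hv⟩
    obtain ⟨-, -, hoff, hR⟩ := hVb _ hv
    obtain ⟨N, hN⟩ := we u hu hoff.1 hoff.2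
    rw [hN] at hR
    have := hR.sum Finset.univ (fun j => β j u) (fun j => - N j)
    simpa only [neg_smul, Finset.sum_neg_distrib, add_neg_cancel_right] using this
lemma exists_Br2 {T : ℝ} (hT : 0 < T) {qA qB : ℂ → ℂ} (hA : Differentiable ℂ qA) (hB : Differentiable ℂ qB) (w : ℂ) :
    ∃ (K : ℕ) (r : ℝ) (ι : Type) (_ : Fintype ι) (ξ Λ : ι → ℂ → ℂ) (κ : ι → ℤ) (H : (ℂ → ℂ) → ℂ → ℂ)
      (ι' : Type) (_ : Fintype ι') (ξ' Λ' : ι' → ℂ → ℂ) (κ' : ι' → ℤ) (H' : (ℂ → ℂ) → ℂ → ℂ), 0 < K ∧ 0 < r ∧ Br T qA w K r ξ Λ κ H ∧ Br T qB w K r ξ' Λ' κ' H' := by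
  obtain ⟨K₀, hK₀, h⟩ := exists_Br hT hA w
  obtain ⟨K₁, hK₁, h'⟩ := exists_Br hT hB w
  obtain ⟨ι, i1, ξ, Λ, κ, H, r₀, hr₀, h⟩ := h (K₀ * K₁) (Nat.mul_pos hK₀ hK₁) (dvd_mul_right _ _)
  obtain ⟨ι', i2, ξ', Λ', κ', H', r₁, hr₁, h'⟩ := h' (K₀ * K₁) (Nat.mul_pos hK₀ hK₁) (dvd_mul_left _ _)
  exact ⟨K₀ * K₁, min r₀ r₁, ι, i1, ξ, Λ, κ, H, ι', i2, ξ', Λ', κ', H', Nat.mul_pos hK₀ hK₁, lt_min hr₀ hr₁, h _ (lt_min hr₀ hr₁) (min_le_left _ _), h' _ (lt_min hr₀ hr₁) (min_le_right _ _)⟩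
lemma ET3 {T : ℝ} (hT : 0 < T) {qA qB g el : ℂ → ℂ} (hA : Differentiable ℂ qA) (hB : Differentiable ℂ qB) (hg : Differentiable ℂ g) (hg' : Differentiable ℂ el)
    (hmom : ∀ m k : ℕ, ∫ x in (0:ℝ)..T, g x ^ m * deriv qA x * qA x ^ k = ∫ x in (0:ℝ)..T, el x ^ m * deriv qB x * qB x ^ k) (no : ℂ) :
    ∃ δ > 0, ∀ w ∈ ball no δ, w ≠ no → Off T qA qB w → Rat' fun m => cc T qA g m w - cc T qB el m w := by
  have hAc : Continuous fun x : ℝ => qA x := hA.continuous.comp continuous_ofReal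
  have hBc : Continuous fun x : ℝ => qB x := hB.continuous.comp continuous_ofReal
  have hdA : Continuous fun x : ℝ => deriv qA x := ((hA.contDiff (n := 1)).continuous_deriv_one).comp continuous_ofReal
  have hdB : Continuous fun x : ℝ => deriv qB x := ((hB.contDiff (n := 1)).continuous_deriv_one).comp continuous_ofReal
  have hgc : Continuous fun x : ℝ => g x := hg.continuous.comp continuous_ofReal
  have hgc' : Continuous fun x : ℝ => el x := hg'.continuous.comp continuous_ofReal
  set G : Set ℂ := {no | ∃ δ > 0, ∀ w ∈ ball no δ, w ≠ no → Off T qA qB w → Rat' fun m => cc T qA g m w - cc T qB el m w} with hG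
  suffices hGu : G = univ by
    have : no ∈ G := hGu ▸ mem_univ _
    exact this
  refine IsClopen.eq_univ ⟨?_, ?_⟩ ?_
  · rw [← isOpen_compl_iff, Metric.isOpen_iff]
    intro no hw1
    obtain ⟨K, r, ι, _, ξ, Λ, κ, H, ι', _, ξ', Λ', κ', H', hK, hr, bA, bB⟩ := exists_Br2 hT hA hB no
    obtain ⟨F, me, we, us⟩ := ET1 hr hK bA bB hg hg'
    refine ⟨r ^ K, by positivity, fun es hw2 hw2G => hw1 ?_⟩
    obtain ⟨δ, hδ, hw⟩ := hw2G
    have hop : IsOpen (((ball no (r ^ K) ∩ ball es δ) \ {no, es} ) ∩ {w | Off T qA qB w}) :=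
      (((isOpen_ball.inter isOpen_ball).sdiff (Set.toFinite _).isClosed)).inter (off_open hA hB)
    have hX := ET2 (F := F) hr hK me we hop ?_ ?_
    · obtain ⟨D, hD⟩ := hX
      refine ⟨r ^ K, by positivity, fun w hwb hne hoff => ?_⟩
      have hK0 : (K:ℂ) ≠ 0 := by exact_mod_cast hK.ne'
      have e : exp (K * (log (w - no) / K)) = w - no := by
        rw [mul_div_cancel₀ _ hK0, exp_log (sub_ne_zero.2 hne)]
      set u := log (w - no) / K
      have hu : u.re < Real.log r := by
        rw [mem_ball_iff_norm, ← e, exp_nat_mul, norm_pow] at hwb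
        have := lt_of_pow_lt_pow_left₀ K hr.le hwb
        rw [norm_exp] at this
        exact (lt_log_iff_exp_lt hr).2 this
      have et : no + exp (K * u) = w := by rw [e, add_sub_cancel]
      obtain ⟨N, hN⟩ := we u hu (by rw [et]; exact hoff.1) (by rw [et]; exact hoff.2)
      rw [et] at hN
      rw [hN]
      exact Rat'.sum ⟨D, hD u hu⟩ _ _ _
    · refine (off_dense hA hB).inter_open_nonempty _ ((isOpen_ball.inter isOpen_ball).sdiff (Set.toFinite _).isClosed) ?_
      have hn : (ball no (r ^ K) ∩ ball es δ) ∈ 𝓝 es := (isOpen_ball.inter isOpen_ball).mem_nhds ⟨hw2, mem_ball_self hδ⟩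
      exact ((infinite_of_mem_nhds es hn).sdiff (Set.toFinite _)).nonempty
    · rintro w ⟨⟨⟨hb1, hb2⟩, hn⟩, hoff⟩
      simp only [mem_insert_iff, mem_singleton_iff, not_or] at hn
      exact ⟨hb1, hn.1, hoff, hw w hb2 hn.2 hoff⟩
  · rw [Metric.isOpen_iff]
    rintro no ⟨δ, hδ, h⟩
    refine ⟨δ, hδ, fun es hw2 => ?_⟩
    by_cases h12 : es = no
    · rw [h12]; exact ⟨δ, hδ, h⟩
    have hop : IsOpen (ball no δ \ {no}) := isOpen_ball.sdiff isClosed_singleton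
    obtain ⟨δ', hδ', hs⟩ := Metric.isOpen_iff.1 hop es ⟨hw2, h12⟩
    exact ⟨δ', hδ', fun w hw _ ho => h w (hs hw).1 (hs hw).2 ho⟩
  · obtain ⟨R, hR⟩ := isCompact_Icc.exists_bound_of_continuousOn (s := Icc 0 T) hAc.continuousOn
    obtain ⟨R', hR'⟩ := isCompact_Icc.exists_bound_of_continuousOn (s := Icc 0 T) hBc.continuousOn
    refine ⟨((|R| + |R'| + 2 : ℝ) : ℂ), 1, one_pos, fun w hw _ _ => ?_⟩
    have et : |R| + |R'| + 1 < ‖w‖ := by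
      rw [mem_ball_iff_norm] at hw
      have me := norm_sub_norm_le ((|R| + |R'| + 2 : ℝ) : ℂ) w
      rw [norm_sub_rev, norm_real, Real.norm_eq_abs, abs_of_pos (by positivity)] at me
      linarith
    have : (fun m => cc T qA g m w - cc T qB el m w) = 0 := by
      ext m
      have am := cc_hasSum (T := T) (R := |R|) (w := w) (f := fun x => g x ^ m * deriv qA x) (q := fun x => qA x) hT ((hgc.pow m).mul hdA) hAc (fun x hx => (hR x hx).trans (le_abs_self R)) (by linarith [abs_nonneg R'])
      have ok := cc_hasSum (T := T) (R := |R'|) (w := w) (f := fun x => el x ^ m * deriv qB x) (q := fun x => qB x) hT ((hgc'.pow m).mul hdB) hBc (fun x hx => (hR' x hx).trans (le_abs_self R')) (by linarith [abs_nonneg R])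
      simp only [hmom] at am
      simp only [cc, am.unique ok, sub_self, Pi.zero_apply]
    rw [this]
    exact ⟨0, RatD.zero⟩
lemma ET4 {T : ℝ} (hT : 0 < T) {qA qB g el : ℂ → ℂ} (hA : Differentiable ℂ qA) (hB : Differentiable ℂ qB) (hg : Differentiable ℂ g) (hg' : Differentiable ℂ el)
    (hmom : ∀ m k : ℕ, ∫ x in (0:ℝ)..T, g x ^ m * deriv qA x * qA x ^ k = ∫ x in (0:ℝ)..T, el x ^ m * deriv qB x * qB x ^ k)
    {no : ℂ} {K : ℕ} {r : ℝ} (hr : 0 < r) (hK : 0 < K) {ι ι' : Type} [Fintype ι] [Fintype ι']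
    {ξ Λ : ι → ℂ → ℂ} {κ : ι → ℤ} {H} {ξ' Λ' : ι' → ℂ → ℂ} {κ' : ι' → ℤ} {H'}
    (bA : Br T qA no K r ξ Λ κ H) (bB : Br T qB no K r ξ' Λ' κ' H') {s : ℂ} (na : s ≠ 0) (hs : ‖s‖ < r) (j : ι ⊕ ι')
    (hk : Sum.elim κ (fun j => - κ' j) j ≠ 0) (hb : Sum.elim (fun j => g (ξ j s)) (fun j => el (ξ' j s)) j ≠ 0) :
    ∃ i, Sum.elim (fun j => g (ξ j s)) (fun j => el (ξ' j s)) i = Sum.elim (fun j => g (ξ j s)) (fun j => el (ξ' j s)) j ∧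
      Sum.elim κ (fun j => - κ' j) i * Sum.elim κ (fun j => - κ' j) j < 0 := by
  obtain ⟨F, me, we, us⟩ := ET1 hr hK bA bB hg hg'
  obtain ⟨δ, hδ, hδw⟩ := ET3 hT hA hB hg hg' hmom no
  have hX := ET2 (F := F) hr hK me we (V := ((ball no (r ^ K) ∩ ball no δ) \ {no}) ∩ {w | Off T qA qB w}) ?_ ?_ ?_
  · obtain ⟨D, hD⟩ := hX
    have he := exp_log na
    have hu : (log s).re < Real.log r := by rw [log_re]; exact Real.log_lt_log (norm_pos_iff.2 na) hs
    have hc : ∀ R : ℕ, RatD D D ((fun m => F m (log s)) + R • ∑ j, (Sum.elim κ (fun j => - κ' j) j) • pw (Sum.elim (fun j => g (ξ j s)) (fun j => el (ξ' j s)) j)) := by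
      intro R
      have := us _ hu R
      rw [he] at this
      rw [← this]
      exact hD _ (by simpa using hu)
    obtain ⟨i, -, hi⟩ := cancel_pos Finset.univ _ _ hc (Finset.mem_univ j) hb hk
    exact ⟨i, hi⟩
  · exact ((isOpen_ball.inter isOpen_ball).sdiff isClosed_singleton).inter (off_open hA hB)
  · refine (off_dense hA hB).inter_open_nonempty _ ((isOpen_ball.inter isOpen_ball).sdiff isClosed_singleton) ?_
    have hn : (ball no (r ^ K) ∩ ball no δ) ∈ 𝓝 no := (isOpen_ball.inter isOpen_ball).mem_nhds ⟨mem_ball_self (by positivity), mem_ball_self hδ⟩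
    exact ((infinite_of_mem_nhds no hn).sdiff (Set.toFinite _)).nonempty
  · rintro w ⟨⟨⟨hb1, hb2⟩, hn⟩, hoff⟩
    exact ⟨hb1, hn, hoff, hδw w hb2 hn hoff⟩
end

section
def ev {n : ℕ} (P : MvPolynomial (Fin n) ℂ) (A : Fin n → ℂ → ℂ) (x : ℂ) : ℂ := MvPolynomial.eval (fun i => A i x) P
lemma ev_diff {n : ℕ} (P : MvPolynomial (Fin n) ℂ) {A : Fin n → ℂ → ℂ} (hA : ∀ i, Differentiable ℂ (A i)) : Differentiable ℂ (ev P A) := by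
  unfold ev
  simp only [MvPolynomial.eval_eq]
  fun_prop
def MomEq (T : ℝ) {n : ℕ} (A B : Fin n → ℂ → ℂ) : Prop :=
  ∀ (P : MvPolynomial (Fin n) ℂ) (i : Fin n), ∫ x in (0:ℝ)..T, ev P A x * deriv (A i) x = ∫ x in (0:ℝ)..T, ev P B x * deriv (B i) x
lemma sep {n : ℕ} {ι : Type} [Fintype ι] (X : ι → Fin n → ℂ) : ∃ P : MvPolynomial (Fin n) ℂ,
    (∀ j, MvPolynomial.eval (X j) P ≠ 0) ∧ ∀ i j, MvPolynomial.eval (X i) P = MvPolynomial.eval (X j) P → X i = X j := by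
  classical
  let p : (Fin n → ℂ) → Polynomial ℂ := fun x => ∑ i : Fin n, Polynomial.C (x i) * Polynomial.X ^ ((i:ℕ) + 1)
  have hp0 : ∀ x, (p x).coeff 0 = 0 := fun x => by simp [p, Polynomial.finsetSum_coeff]
  have hpi : ∀ x (i : Fin n), (p x).coeff (i + 1) = x i := fun x i => by
    simp only [p, Polynomial.finsetSum_coeff, Polynomial.coeff_C_mul_X_pow]
    rw [Finset.sum_eq_single i]
    · simp
    · intro j _ hj; rw [if_neg]; intro h; apply hj; ext; omega
    · simp
  let Q : Polynomial ℂ := (∏ j, (1 + p (X j))) * ∏ ij : ι × ι, if X ij.1 = X ij.2 then 1 else p (X ij.1) - p (X ij.2)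
  have hQ : Q ≠ 0 := by
    refine mul_ne_zero (prod_ne_zero_iff.2 fun j _ h => ?_) (prod_ne_zero_iff.2 fun ij _ => ?_)
    · have := congrArg (fun q => Polynomial.coeff q 0) h
      simp [hp0] at this
    · split_ifs with h
      · exact one_ne_zero
      · intro my
        apply h; ext i
        have := congrArg (fun q => Polynomial.coeff q (i+1)) my
        simp only [Polynomial.coeff_sub, hpi, Polynomial.coeff_zero] at this
        exact sub_eq_zero.1 this
  obtain ⟨l, hl⟩ : ∃ l, Q.eval l ≠ 0 := by
    by_contra! h
    exact hQ (Polynomial.funext fun x => by simp [h x])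
  simp only [Q, eval_mul, Polynomial.eval_prod, mul_ne_zero_iff, prod_ne_zero_iff] at hl
  refine ⟨1 + ∑ i : Fin n, MvPolynomial.X i * MvPolynomial.C (l ^ ((i:ℕ)+1)), ?_⟩
  have he : ∀ x, MvPolynomial.eval x (1 + ∑ i : Fin n, MvPolynomial.X i * MvPolynomial.C (l ^ ((i:ℕ)+1))) = 1 + (p x).eval l := fun x => by
    simp [p, Polynomial.eval_finsetSum]
  refine ⟨fun j => ?_, fun i j h => ?_⟩
  · rw [he]; simpa using hl.1 j (Finset.mem_univ _)
  · rw [he, he] at h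
    by_contra hne
    have := hl.2 (i, j) (Finset.mem_univ _)
    rw [if_neg hne, eval_sub] at this
    exact this (by linear_combination h)
def Match {n : ℕ} (A : Fin n → ℂ → ℂ) (e : ℂ) (B : Fin n → ℂ → ℂ) (ex : ℂ) : Prop :=
  ∃ x y : ℂ → ℂ, AnalyticAt ℂ x 0 ∧ AnalyticAt ℂ y 0 ∧ x 0 = e ∧ y 0 = ex ∧ (¬ ∀ᶠ s in 𝓝 0, x s = e) ∧ (¬ ∀ᶠ s in 𝓝 0, y s = ex) ∧
    ∀ᶠ s in 𝓝 0, ∀ i, A i (x s) = B i (y s)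
lemma Match.symm {n : ℕ} {A B : Fin n → ℂ → ℂ} {e ex : ℂ} (h : Match A e B ex) : Match B ex A e := by
  obtain ⟨x, y, me, we, us, up, ma, h6, h7⟩ := h
  exact ⟨y, x, we, me, up, us, h6, ma, h7.mono fun s h i => (h i).symm⟩
lemma nc_of_pow {q x : ℂ → ℂ} {w e : ℂ} {K : ℕ} (hK : 0 < K) {r : ℝ} (hr : 0 < r) (h : ∀ s ∈ ball (0:ℂ) r, q (x s) = w + s ^ K) : ¬ ∀ᶠ s in 𝓝 0, x s = e := by
  intro my
  have we : ∀ᶠ s in 𝓝[≠] (0:ℂ), False := by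
    have h00 := my.self_of_nhds
    have hev0 := h 0 (mem_ball_self hr)
    filter_upwards [my.filter_mono nhdsWithin_le_nhds, self_mem_nhdsWithin, mem_nhdsWithin_of_mem_nhds (ball_mem_nhds (0:ℂ) hr)] with s me we us
    have := h s us
    rw [me, ← h00, hev0, zero_pow hK.ne'] at this
    exact pow_ne_zero K we (by linear_combination -this)
  exact we.exists.elim fun _ h => h
lemma mulneg {a b : ℤ} (h : a * b < 0) : (0 < b → a < 0) ∧ (b < 0 → 0 < a) := by
  rcases mul_neg_iff.1 h with h | h <;> constructor <;> intros <;> omega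
lemma ET {T : ℝ} (hT : 0 < T) {n : ℕ} {A B : Fin n → ℂ → ℂ} (hA : ∀ i, Differentiable ℂ (A i)) (hB : ∀ i, Differentiable ℂ (B i))
    (hmom : MomEq T A B) (j : Fin n) (hc : ¬ ∃ w, ∀ x, B j x = w) :
    Match B 0 B T ∨ (Match B 0 A 0 ∧ Match B T A T) := by
  classical
  have main : ∀ e : ℂ, (e = 0 ∨ e = T) → (∃ ex : ℂ, (ex = 0 ∨ ex = T) ∧ ex ≠ e ∧ Match B e B ex) ∨ Match B e A e := by
    intro e he
    obtain ⟨K, r, ι, _, ξ, Λ, κ, H, ι', _, ξ', Λ', κ', H', hK, hr, bA, bB⟩ := exists_Br2 hT (hA j) (hB j) (B j e)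
    obtain ⟨b, hb⟩ := bB.ends hc e he rfl
    have hT0 : (T:ℂ) ≠ 0 := by exact_mod_cast hT.ne'
    have hκb : κ' b ≠ 0 := by
      rcases he with rfl | rfl
      · exact ((bB.pos b).2 hb).ne'
      · exact ((bB.neg b).2 hb).ne
    have key : ∀ s : ℂ, s ≠ 0 → ‖s‖ < r → ∃ i : ι ⊕ ι', Sum.elim κ (fun j => - κ' j) i * (- κ' b) < 0 ∧ ∀ k, Sum.elim (fun j => A k (ξ j s)) (fun j => B k (ξ' j s)) i = B k (ξ' b s) := by
      intro s na hs
      obtain ⟨P, hP0, hPs⟩ := sep (fun i : ι ⊕ ι' => Sum.elim (fun j k => A k (ξ j s)) (fun j k => B k (ξ' j s)) i)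
      have hmm : ∀ m k : ℕ, ∫ x in (0:ℝ)..T, ev P A x ^ m * deriv (A j) x * A j x ^ k = ∫ x in (0:ℝ)..T, ev P B x ^ m * deriv (B j) x * B j x ^ k := by
        intro m k
        have := hmom (P ^ m * MvPolynomial.X j ^ k) j
        simp only [ev, map_mul, map_pow, MvPolynomial.eval_X] at this
        simp only [ev]
        convert this using 3 <;> ring
      obtain ⟨i, hi, hi'⟩ := ET4 hT (hA j) (hB j) (ev_diff P hA) (ev_diff P hB) hmm hr hK bA bB na hs (Sum.inr b) (by simpa using hκb) (hP0 (Sum.inr b))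
      refine ⟨i, by simpa using hi', fun k => ?_⟩
      have hX := hPs i (Sum.inr b) (by rcases i with i | i <;> exact hi)
      have := congrFun hX k
      rcases i with i | i <;> exact this
    obtain ⟨i, hi⟩ : ∃ i : ι ⊕ ι', ∃ᶠ s in 𝓝[≠] (0:ℂ), Sum.elim κ (fun j => - κ' j) i * (- κ' b) < 0 ∧ ∀ k, Sum.elim (fun j => A k (ξ j s)) (fun j => B k (ξ' j s)) i = B k (ξ' b s) := by
      by_contra hcon
      rw [not_exists] at hcon
      have : ∀ᶠ s in 𝓝[≠] (0:ℂ), False := by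
        have me := eventually_all.2 fun i => not_frequently.1 (hcon i)
        filter_upwards [me, self_mem_nhdsWithin, mem_nhdsWithin_of_mem_nhds (ball_mem_nhds (0:ℂ) hr)] with s me we us
        obtain ⟨i, hi⟩ := key s we (by simpa using us)
        exact me i hi
      exact this.exists.elim fun _ h => h
    obtain ⟨-, hκ, -⟩ := hi.exists
    have hb0 := mem_ball_self hr (x := (0:ℂ))
    have hanb : ∀ k, AnalyticAt ℂ (fun s => B k (ξ' b s)) 0 := fun k => ((hB k).analyticAt _).fun_comp (bB.an b 0 hb0)
    rcases i with i | i
    · right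
      have hm : ∀ᶠ s in 𝓝 0, ∀ k, B k (ξ' b s) = A k (ξ i s) := eventually_all.2 fun k =>
        ((hanb k).frequently_eq_iff_eventually_eq (((hA k).analyticAt _).fun_comp (bA.an i 0 hb0))).1 (hi.mono fun s h => (h.2 k).symm)
      refine ⟨ξ' b, ξ i, bB.an b 0 hb0, bA.an i 0 hb0, hb, ?_, nc_of_pow hK hr (bB.eq b), nc_of_pow hK hr (bA.eq i), hm⟩
      simp only [Sum.elim_inl] at hκ
      have we := mulneg hκ
      rcases he with rfl | rfl
      · exact (bA.pos i).1 (we.2 (by have := (bB.pos b).2 hb; omega))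
      · exact (bA.neg i).1 (we.1 (by have := (bB.neg b).2 hb; omega))
    · left
      have hm : ∀ᶠ s in 𝓝 0, ∀ k, B k (ξ' b s) = B k (ξ' i s) := eventually_all.2 fun k =>
        ((hanb k).frequently_eq_iff_eventually_eq (((hB k).analyticAt _).fun_comp (bB.an i 0 hb0))).1 (hi.mono fun s h => (h.2 k).symm)
      simp only [Sum.elim_inr] at hκ
      have we := mulneg hκ
      refine ⟨ξ' i 0, ?_, ?_, ξ' b, ξ' i, bB.an b 0 hb0, bB.an i 0 hb0, hb, rfl, nc_of_pow hK hr (bB.eq b), nc_of_pow hK hr (bB.eq i), hm⟩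
      · rcases he with rfl | rfl
        · exact Or.inr ((bB.neg i).1 (by have := we.2 (by have := (bB.pos b).2 hb; omega); omega))
        · exact Or.inl ((bB.pos i).1 (by have := we.1 (by have := (bB.neg b).2 hb; omega); omega))
      · rcases he with rfl | rfl
        · rw [(bB.neg i).1 (by have := we.2 (by have := (bB.pos b).2 hb; omega); omega)]; exact hT0
        · rw [(bB.pos i).1 (by have := we.1 (by have := (bB.neg b).2 hb; omega); omega)]; exact hT0.symm
  rcases main 0 (Or.inl rfl) with ⟨ex, me, we, us⟩ | my
  · rcases me with rfl | rfl
    · exact absurd rfl we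
    · exact Or.inl us
  · rcases main T (Or.inr rfl) with ⟨ex, me, we, us⟩ | up
    · rcases me with rfl | rfl
      · exact Or.inl us.symm
      · exact absurd rfl we
    · exact Or.inr ⟨my, up⟩
end

section
attribute [local instance] Matrix.linftyOpNormedRing Matrix.linftyOpNormedAlgebra
abbrev MK (K : ℕ) := Matrix (Fin K) (Fin K) ℂ
def UT {K : ℕ} (k : ℕ) (M : MK K) : Prop := ∀ a b : Fin K, (b:ℕ) < a + k → M a b = 0
lemma UT.mul {K k l : ℕ} {M N : MK K} (hM : UT k M) (hN : UT l N) : UT (k + l) (M * N) := by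
  intro a b hab
  rw [Matrix.mul_apply]
  refine Finset.sum_eq_zero fun c _ => ?_
  by_cases h : (c:ℕ) < a + k
  · rw [hM a c h, zero_mul]
  · rw [hN c b (by omega), mul_zero]
lemma UT.add {K k : ℕ} {M N : MK K} (hM : UT k M) (hN : UT k N) : UT k (M + N) := fun a b h => by
  rw [Matrix.add_apply, hM a b h, hN a b h, add_zero]
lemma UT.neg {K k : ℕ} {M : MK K} (hM : UT k M) : UT k (-M) := fun a b h => by
  rw [Matrix.neg_apply, hM a b h, neg_zero]
lemma UT.sub {K k : ℕ} {M N : MK K} (hM : UT k M) (hN : UT k N) : UT k (M - N) := by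
  rw [sub_eq_add_neg]; exact hM.add hN.neg
lemma UT.sum {K k : ℕ} {ι} (s : Finset ι) {M : ι → MK K} (hM : ∀ i ∈ s, UT k (M i)) : UT k (∑ i ∈ s, M i) := fun a b h => by
  rw [Matrix.sum_apply]; exact Finset.sum_eq_zero fun i hi => hM i hi a b h
lemma UT.mono {K k l : ℕ} (h : k ≤ l) {M : MK K} (hM : UT l M) : UT k M := fun a b hab => hM a b (by omega)
lemma UT.one {K : ℕ} : UT 0 (1 : MK K) := fun a b h => Matrix.one_apply_ne (by rintro rfl; omega)
lemma UT.eq_zero {K : ℕ} {M : MK K} (hM : UT K M) : M = 0 := by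
  ext a b; exact hM a b (by omega)
lemma UT.pow {K : ℕ} {M : MK K} (hM : UT 1 M) (k : ℕ) : UT k (M ^ k) := by
  induction k with
  | zero => exact UT.one
  | succ k ih => rw [pow_succ]; exact ih.mul hM
lemma UT.sub_one {K : ℕ} {M : MK K} (h : UT 1 (M - 1)) : UT 0 M := by
  have := (h.mono (Nat.zero_le 1)).add UT.one
  simpa using this
lemma UT.isUnit {K : ℕ} {M : MK K} (h : UT 1 (M - 1)) : IsUnit M := by
  have : IsNilpotent (M - 1) := ⟨K, (h.pow K).eq_zero⟩
  simpa using this.isUnit_one_add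
lemma UT_mul1 {K : ℕ} {M N : MK K} (h : UT 1 (M - 1)) (h' : UT 1 (N - 1)) : UT 1 (M * N - 1) := by
  have e : M * N - 1 = (M - 1) * N + (N - 1) := by noncomm_ring
  rw [e]
  exact (h.mul h'.sub_one).add h'
lemma UT_inv {K : ℕ} {M : MK K} (h : UT 1 (M - 1)) : ∃ N, UT 1 (N - 1) ∧ N * M = 1 := by
  rcases K with _ | K
  · exact ⟨1, fun a => a.elim0, Subsingleton.elim _ _⟩
  have me : UT 1 (1 - M) := by rw [← neg_sub]; exact h.neg
  refine ⟨∑ k ∈ Finset.range (K+1), (1 - M) ^ k, ?_, ?_⟩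
  · rw [Finset.sum_range_succ', pow_zero, add_sub_cancel_right]
    exact UT.sum _ fun k _ => (me.pow _).mono (by omega)
  · have := geom_sum_mul (1 - M) (K+1)
    rw [(me.pow (K+1)).eq_zero, zero_sub] at this
    rw [show 1 - M - 1 = - M by abel, mul_neg] at this
    exact neg_injective this
lemma pow_UT {K k : ℕ} {Φ : MK K} (me : UT 1 (Φ - 1)) (h : UT k (Φ - 1)) (a : ℕ) : UT (k + 1) (Φ ^ a - 1 - a • (Φ - 1)) := by
  induction a with
  | zero => intro a b _; simp
  | succ a ih =>
    have e : Φ ^ (a+1) - 1 - (a+1) • (Φ - 1) = (Φ ^ a - 1 - a • (Φ - 1)) * Φ + a • ((Φ - 1) * (Φ - 1)) := by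
      rw [add_smul, one_smul, pow_succ]; simp only [nsmul_eq_mul]; noncomm_ring
    rw [e]
    refine UT.add (by simpa using ih.mul me.sub_one) ?_
    have := h.mul me
    intro i j hij
    rw [Matrix.smul_apply, this i j hij, smul_zero]
lemma unip {K : ℕ} {Φ C : MK K} (hΦ : UT 1 (Φ - 1)) (hC : UT 1 (C - 1)) {a b : ℕ} (hab : 0 < a + b) (h : Φ ^ b * C * Φ ^ a = C) : Φ = 1 := by
  have main : ∀ k, UT (k + 1) (Φ - 1) := by
    intro k
    induction k with
    | zero => simpa using hΦ
    | succ k ih =>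
      set ν := Φ - 1 with hν
      have me := pow_UT hΦ ih a
      have we := pow_UT hΦ ih b
      set ra := Φ ^ a - 1 - a • ν with hra
      set rb := Φ ^ b - 1 - b • ν with hrb
      have ea : Φ ^ a = 1 + a • ν + ra := by rw [hra]; abel
      have eb : Φ ^ b = 1 + b • ν + rb := by rw [hrb]; abel
      set γ := C - 1 with hγ
      have eC : C = 1 + γ := by rw [hγ]; abel
      have hCν : UT (k+1+1) (((a + b : ℕ) : ℂ) • ν) := by
        have e : ((a + b : ℕ) : ℂ) • ν = - (b • (ν * γ) + a • (γ * ν) + rb * C + C * ra + b • (ν * C * (a • ν)) + b • (ν * C * ra) + rb * C * (a • ν + ra)) := by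
          rw [ea, eb] at h
          have us : (1 + b • ν + rb) * C * (1 + a • ν + ra) - C = 0 := by rw [h, sub_self]
          have up : (1 + b • ν + rb) * C * (1 + a • ν + ra) - C = b • (ν * C) + a • (C * ν) + rb * C + C * ra + b • (ν * C * (a • ν)) + b • (ν * C * ra) + rb * C * (a • ν + ra) := by
            simp only [nsmul_eq_mul, add_mul, mul_add, one_mul, mul_one]
            have c1 : ∀ X : MK K, C * ((a : MK K) * X) = a * (C * X) := fun X => by rw [← mul_assoc, ← mul_assoc, (Nat.cast_commute a C).eq]
            simp only [mul_assoc, c1]; abel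
          rw [up] at us
          rw [Nat.cast_smul_eq_nsmul, eq_neg_iff_add_eq_zero, ← us]
          have e5 : ν * C = ν + ν * γ := by rw [eC, mul_add, mul_one]
          have e6 : C * ν = ν + γ * ν := by rw [eC, add_mul, one_mul]
          rw [add_smul, e5, e6, smul_add, smul_add]; abel
        have hs : ∀ (c : ℕ) {M : MK K} {l : ℕ}, UT l M → UT l (c • M) := fun c M l hM i j hij => by rw [Matrix.smul_apply, hM i j hij, smul_zero]
        have hC0 := hC.sub_one
        rw [e]
        refine UT.neg (UT.add (UT.add (UT.add (UT.add (UT.add (UT.add ?_ ?_) ?_) ?_) ?_) ?_) ?_)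
        · exact hs b (ih.mul hC)
        · exact hs a ((hC.mul ih).mono (by omega))
        · exact we.mul hC0
        · exact (hC0.mul me).mono (by omega)
        · exact hs b (((ih.mul hC0).mul (hs a ih)).mono (by omega))
        · exact hs b (((ih.mul hC0).mul me).mono (by omega))
        · exact ((we.mul hC0).mul (UT.add (hs a ih) (me.mono (by omega)))).mono (by omega)
      intro i j hij
      have := hCν i j hij
      rw [Matrix.smul_apply, smul_eq_mul] at this
      exact (mul_eq_zero.1 this).resolve_left (by exact_mod_cast hab.ne')
  exact sub_eq_zero.1 ((main K).mono (by omega)).eq_zero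
lemma unip_pow {K : ℕ} {C : MK K} (hC : UT 1 (C - 1)) {N : ℕ} (hN : 0 < N) (h : C ^ N = 1) : C = 1 :=
  unip (a := 0) (b := N) hC (C := 1) (by intro a b _; simp) (by omega) (by simpa using h)
structure IsW {K : ℕ} (Ω W : ℂ → MK K) : Prop where
  d : ∀ x, HasDerivAt W (Ω x * W x) x
  z : W 0 = 1
  u : ∀ x, UT 1 (W x - 1)
lemma entry_deriv {K : ℕ} {W : ℂ → MK K} {W' : MK K} {x : ℂ} (h : HasDerivAt W W' x) (a b : Fin K) : HasDerivAt (fun x => W x a b) (W' a b) x :=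
  hasDerivAt_pi.1 (hasDerivAt_pi.1 h a) b
lemma UT_of_deriv {K k : ℕ} {W W' : ℂ → MK K} (h : ∀ x, HasDerivAt W (W' x) x) (my : W 0 = 0) (hu : ∀ x, UT k (W' x)) (x : ℂ) : UT k (W x) := by
  intro a b hab
  have me : ∀ x, HasDerivAt (fun x => W x a b) 0 x := fun x => by
    have := entry_deriv (h x) a b
    rwa [hu x a b hab] at this
  have := is_const_of_deriv_eq_zero (fun x => (me x).differentiableAt) (fun x => (me x).deriv) x 0
  simpa [my] using this
lemma exists_prim {E : Type*} [NormedAddCommGroup E] [NormedSpace ℂ E] [CompleteSpace E] {f : ℂ → E} (hf : Differentiable ℂ f) : ∃ F : ℂ → E, F 0 = 0 ∧ ∀ x, HasDerivAt F (f x) x := by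
  obtain ⟨F, hF⟩ := hf.isExactOn_univ
  exact ⟨fun x => F x - F 0, by simp, fun x => (hF x (mem_univ _)).sub_const _⟩
lemma exists_W {K : ℕ} {Ω : ℂ → MK K} (hΩ : Differentiable ℂ Ω) (hu : ∀ x, UT 1 (Ω x)) : ∃ W, IsW Ω W := by
  have hV : ∀ k : ℕ, ∃ V : ℕ → ℂ → MK K, (V 0 = fun _ => 1) ∧ (∀ j < k, V (j+1) 0 = 0 ∧ ∀ x, HasDerivAt (V (j+1)) (Ω x * V j x) x) ∧ Differentiable ℂ (V k) := by
    intro k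
    induction k with
    | zero => exact ⟨fun _ _ => 1, rfl, by simp, by simp⟩
    | succ k ih =>
      obtain ⟨V, my, me, we⟩ := ih
      obtain ⟨F, hF0, hF⟩ := exists_prim (hΩ.mul we)
      refine ⟨fun j => if j = k + 1 then F else V j, by simpa using my, fun j hj => ?_, ?_⟩
      · rcases Nat.lt_succ_iff_lt_or_eq.1 hj with hj | rfl
        · have h1' := me j hj
          simp only [show j + 1 ≠ k + 1 by omega, show j ≠ k + 1 by omega, if_false]
          exact h1'
        · simp only [if_true, show j ≠ j + 1 by omega, if_false]
          exact ⟨hF0, hF⟩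
      · simp only [if_true]; exact fun x => (hF x).differentiableAt
  obtain ⟨V, my, me, -⟩ := hV K
  have hVu : ∀ j ≤ K, ∀ x, UT j (V j x) := by
    intro j
    induction j with
    | zero => intro _ x; rw [my]; exact UT.one
    | succ j ih =>
      intro hj x
      refine UT_of_deriv (me j (by omega)).2 (me j (by omega)).1 (fun x => ?_) x
      have := (hu x).mul (ih (by omega) x)
      rwa [add_comm] at this
  rcases K with _ | K
  · refine ⟨fun _ => 1, fun x => ?_, rfl, fun x a => a.elim0⟩
    rw [Subsingleton.elim (Ω x * 1) 0]; exact hasDerivAt_const x _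
  refine ⟨fun x => ∑ j ∈ Finset.range (K+1), V j x, fun x => ?_, ?_, fun x => ?_⟩
  · have hs : HasDerivAt (fun x => ∑ j ∈ Finset.range K, V (j+1) x + V 0 x) (∑ j ∈ Finset.range K, Ω x * V j x + 0) x := by
      refine HasDerivAt.add (HasDerivAt.fun_sum fun j hj => (me j (by have := Finset.mem_range.1 hj; omega)).2 x) ?_
      rw [my]; exact hasDerivAt_const x _
    simp only [Finset.sum_range_succ']
    refine hs.congr_deriv ?_
    rw [← Finset.sum_range_succ' (fun j => V j x), Finset.sum_range_succ, mul_add, mul_sum]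
    congr 1
    have us := (hu x).mul (hVu K (by omega) x)
    exact (us.mono (by omega) : UT (K+1) _).eq_zero.symm
  · simp only [Finset.sum_range_succ']
    rw [Finset.sum_eq_zero fun j hj => (me j (by have := Finset.mem_range.1 hj; omega)).1, my, zero_add]
  · simp only [Finset.sum_range_succ', my, add_sub_cancel_right]
    exact UT.sum _ fun j hj => (hVu (j+1) (by have := Finset.mem_range.1 hj; omega) x).mono (by omega)
lemma const_of {K : ℕ} {S : Set ℂ} (hS : IsOpen S) (hc : IsPreconnected S) {X Y Θ : ℂ → MK K} (hX : ∀ s ∈ S, HasDerivAt X (Θ s * X s) s)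
    (hY : ∀ s ∈ S, HasDerivAt Y (Θ s * Y s) s) (hu : ∀ s ∈ S, UT 1 (X s - 1)) (hv : ∀ s ∈ S, UT 1 (Y s - 1)) :
    ∃ C, UT 1 (C - 1) ∧ ∀ s ∈ S, Y s = X s * C := by
  rcases S.eq_empty_or_nonempty with rfl | ⟨s0, na⟩
  · exact ⟨1, by intro a b _; simp, by simp⟩
  have hd : ∀ s ∈ S, HasDerivAt (fun s => Ring.inverse (X s) * Y s) 0 s := by
    intro s hs
    obtain ⟨U, hU⟩ := (hu s hs).isUnit
    have me := (hasFDerivAt_ringInverse (𝕜 := ℂ) U)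
    rw [hU] at me
    have we := (me.comp_hasDerivAt s (hX s hs)).fun_mul (hY s hs)
    refine we.congr_deriv ?_
    simp only [Function.comp, ← hU, Ring.inverse_unit]
    simp [mul_assoc]
  obtain ⟨C, hC⟩ := hS.exists_is_const_of_deriv_eq_zero hc (fun s hs => (hd s hs).differentiableAt.differentiableWithinAt) (fun s hs => (hd s hs).deriv)
  have hYC : ∀ s ∈ S, Y s = X s * C := fun s hs => by
    rw [← hC s hs, ← mul_assoc, Ring.mul_inverse_cancel _ (hu s hs).isUnit, one_mul]
  refine ⟨C, ?_, hYC⟩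
  have me := hYC s0 na
  have hx := hu s0 na
  have hy := hv s0 na
  obtain ⟨N, hN, hNX⟩ := UT_inv hx
  have : C = N * Y s0 := by rw [me, ← mul_assoc, hNX, one_mul]
  rw [this]; exact UT_mul1 hN hy
def Om {n K : ℕ} (P : Fin n → Fin K → Fin K → MvPolynomial (Fin n) ℂ) (A : Fin n → ℂ → ℂ) (x : ℂ) : MK K :=
  fun a b => ∑ i, deriv (A i) x * ev (P i a b) A x
def TP {n K : ℕ} (P : Fin n → Fin K → Fin K → MvPolynomial (Fin n) ℂ) : Prop := ∀ (i : Fin n) (a b : Fin K), (b:ℕ) ≤ a → P i a b = 0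
lemma Om_UT {n K : ℕ} {P : Fin n → Fin K → Fin K → MvPolynomial (Fin n) ℂ} (hP : TP P) (A : Fin n → ℂ → ℂ) (x : ℂ) : UT 1 (Om P A x) := by
  intro a b h
  simp only [Om]
  exact Finset.sum_eq_zero fun i _ => by rw [hP i a b (by omega)]; simp [ev]
lemma deriv_ent {f : ℂ → ℂ} (hf : Differentiable ℂ f) : Differentiable ℂ (deriv f) := by
  have := (hf.contDiff (n := 2)).differentiable_deriv_two
  exact this
lemma Om_diff {n K : ℕ} (P : Fin n → Fin K → Fin K → MvPolynomial (Fin n) ℂ) {A : Fin n → ℂ → ℂ} (hA : ∀ i, Differentiable ℂ (A i)) : Differentiable ℂ (Om P A) := by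
  refine differentiable_pi.2 fun a => differentiable_pi.2 fun b => ?_
  simp only [Om]
  exact Differentiable.fun_sum fun i _ => (deriv_ent (hA i)).mul (ev_diff _ hA)
def Th {n K : ℕ} (P : Fin n → Fin K → Fin K → MvPolynomial (Fin n) ℂ) (A : Fin n → ℂ → ℂ) (x : ℂ → ℂ) (s : ℂ) : MK K :=
  fun a b => ∑ i, deriv (fun s => A i (x s)) s * ev (P i a b) A (x s)
lemma pull_W {n K : ℕ} {P : Fin n → Fin K → Fin K → MvPolynomial (Fin n) ℂ} {A : Fin n → ℂ → ℂ} (hA : ∀ i, Differentiable ℂ (A i)) {W : ℂ → MK K} (hW : IsW (Om P A) W)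
    {x : ℂ → ℂ} {s x' : ℂ} (hx : HasDerivAt x x' s) : HasDerivAt (fun s => W (x s)) (Th P A x s * W (x s)) s := by
  have me := HasDerivAt.scomp s (hW.d (x s)) hx
  refine me.congr_deriv ?_
  rw [← smul_mul_assoc]
  congr 1
  ext a b
  simp only [Om, Th, Matrix.smul_apply, smul_eq_mul, mul_sum]
  refine sum_congr rfl fun i _ => ?_
  have := ((hA i (x s)).hasDerivAt.comp s hx).deriv
  simp only [Function.comp_def] at this
  rw [this]; ring
lemma TR {n K : ℕ} {P : Fin n → Fin K → Fin K → MvPolynomial (Fin n) ℂ} {A B : Fin n → ℂ → ℂ} (hA : ∀ i, Differentiable ℂ (A i)) (hB : ∀ i, Differentiable ℂ (B i))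
    {WA WB : ℂ → MK K} (hWA : IsW (Om P A) WA) (hWB : IsW (Om P B) WB) {S : Set ℂ} (hS : IsOpen S) (hc : IsPreconnected S) {x y : ℂ → ℂ}
    (hx : DifferentiableOn ℂ x S) (hy : DifferentiableOn ℂ y S) (h : ∀ s ∈ S, ∀ i, A i (x s) = B i (y s)) :
    ∃ C, UT 1 (C - 1) ∧ ∀ s ∈ S, WA (x s) = WB (y s) * C := by
  refine const_of (Θ := Th P B y) hS hc (fun s hs => ?_) (fun s hs => ?_) (fun s _ => hWB.u _) (fun s _ => hWA.u _)
  · exact pull_W hB hWB ((hy.differentiableAt (hS.mem_nhds hs)).hasDerivAt)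
  · have := pull_W hA hWA ((hx.differentiableAt (hS.mem_nhds hs)).hasDerivAt)
    refine this.congr_deriv ?_
    congr 1
    ext a b
    refine sum_congr rfl fun i _ => ?_
    congr 1
    · apply Filter.EventuallyEq.deriv_eq
      filter_upwards [hS.mem_nhds hs] with t ht using h t ht i
    · simp only [ev]; simp only [h s hs]
lemma pullback {n K : ℕ} {P : Fin n → Fin K → Fin K → MvPolynomial (Fin n) ℂ} {A B : Fin n → ℂ → ℂ} (hA : ∀ i, Differentiable ℂ (A i)) (hB : ∀ i, Differentiable ℂ (B i))
    {WA WB : ℂ → MK K} (hWA : IsW (Om P A) WA) (hWB : IsW (Om P B) WB) {h : ℂ → ℂ} (hh : Differentiable ℂ h) (my : h 0 = 0) (hAB : ∀ x i, A i x = B i (h x)) (x : ℂ) :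
    WA x = WB (h x) := by
  obtain ⟨C, -, hC⟩ := TR hA hB hWA hWB isOpen_univ isPreconnected_univ (x := fun x => x) differentiable_id.differentiableOn hh.differentiableOn (fun s _ i => hAB s i)
  have me := hC 0 (mem_univ _)
  rw [my, hWA.z, hWB.z, one_mul] at me
  rw [hC x (mem_univ _), ← me, mul_one]
end

section
attribute [local instance] Matrix.linftyOpNormedRing Matrix.linftyOpNormedAlgebra
def Pro (q : ℂ → ℂ) : Prop := ∀ M : ℝ, ∃ R : ℝ, ∀ x, R ≤ ‖x‖ → M < ‖q x‖
lemma Pro.nc {q : ℂ → ℂ} (h : Pro q) : ¬ ∃ w, ∀ x, q x = w := by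
  rintro ⟨w, hw⟩
  obtain ⟨R, hR⟩ := h ‖w‖
  have := hR ((|R| : ℝ) : ℂ) (by simpa using le_abs_self R)
  rw [hw] at this
  exact lt_irrefl _ this
lemma root_small {l : ℕ} (hl : 0 < l) (r : ℝ) (hr : 0 < r) : ∀ᶠ u in 𝓝 (0:ℂ), ∃ t : ℂ, ‖t‖ < r ∧ t ^ l = u := by
  filter_upwards [ball_mem_nhds (0:ℂ) (pow_pos hr l)] with u hu
  obtain ⟨t, ht⟩ := IsAlgClosed.exists_pow_nat_eq u hl
  refine ⟨t, ?_, ht⟩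
  by_contra h
  push Not at h
  have : r ^ l ≤ ‖t‖ ^ l := pow_le_pow_left₀ hr.le h l
  rw [← norm_pow, ht] at this
  simp at hu; linarith
lemma GLOB {E : Type*} [NormedAddCommGroup E] [NormedSpace ℂ E] [CompleteSpace E] {q a : ℂ → ℂ} (hq : Differentiable ℂ q) (hp : Pro q) (ha : Differentiable ℂ a) (hac : ¬ ∃ w, ∀ x, a x = w)
    {U V : ℂ → E} (hU : Differentiable ℂ U) (hV : Differentiable ℂ V) (hne : (interior {Y | ∃ X, q X = a Y ∧ U X = V Y}).Nonempty) :
    ∀ Y, ∃ X, q X = a Y ∧ U X = V Y := by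
  set S := {Y | ∃ X, q X = a Y ∧ U X = V Y} with hS
  have hcl : IsClosed (interior S) := by
    refine isClosed_of_closure_subset fun Y0 hY0 => ?_
    obtain ⟨R, hR⟩ := hp (‖a Y0‖ + 1)
    obtain ⟨k, ψ, φ, hk, hψ, hψ0, hφ, hφ0, me, we, us⟩ := LLL (ha.analyticAt Y0) (fun h => hac ⟨a Y0, entire_const ha (h.filter_mono nhdsWithin_le_nhds).frequently⟩)
    obtain ⟨l, hl, hK⟩ := LLb hq hp.nc (a Y0) (R := R) (fun x hx h => by have := hR x hx.ge; rw [h] at this; linarith)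
    obtain ⟨ι, _, ξ, hξ, -, hev⟩ := hK (l * k) (by positivity) (Dvd.intro _ rfl)
    have hpl : Tendsto (fun t : ℂ => t ^ l) (𝓝 0) (𝓝 0) := by
      have : Continuous fun t : ℂ => t ^ l := by fun_prop
      simpa [hl.ne'] using this.tendsto 0
    have hpk : Tendsto (fun t : ℂ => t ^ (l * k)) (𝓝 0) (𝓝 0) := by
      have : Continuous fun t : ℂ => t ^ (l * k) := by fun_prop
      simpa [hl.ne', hk.ne'] using this.tendsto 0
    have hφl : ∀ᶠ t in 𝓝 (0:ℂ), AnalyticAt ℂ φ (t ^ l) := hpl.eventually hφ.eventually_analyticAt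
    have hξa : ∀ᶠ t in 𝓝 (0:ℂ), ∀ j, AnalyticAt ℂ (ξ j) t := eventually_all.2 fun j => (hξ j).eventually_analyticAt
    have haφ : ∀ᶠ t in 𝓝 (0:ℂ), a (φ (t ^ l)) = a Y0 + t ^ (l * k) := by
      have c := hφ.continuousAt.tendsto
      rw [hφ0] at c
      filter_upwards [hpl.eventually (c.eventually me), hpl.eventually us] with t am ok
      rw [am, ok, pow_mul]
    have hsm : ∀ᶠ t in 𝓝 (0:ℂ), ‖t ^ (l * k)‖ < 1 := by
      filter_upwards [hpk.eventually (ball_mem_nhds (0:ℂ) one_pos)] with t ht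
      simpa using ht
    obtain ⟨r, hr, hb⟩ := eventually_nhds_iff_ball.1 (hφl.and (hξa.and (haφ.and (hsm.and hev))))
    have hmem : ∀ t ∈ ball (0:ℂ) r, φ (t ^ l) ∈ S → ∃ j, U (ξ j t) = V (φ (t ^ l)) := by
      rintro t ht ⟨X, hX, hX'⟩
      obtain ⟨-, -, de, e4, -, -, e7⟩ := hb t ht
      rw [de] at hX
      obtain ⟨j, hj⟩ := e7 X (by
        rw [mem_closedBall_zero_iff]
        by_contra hcon
        have := hR X (by linarith)
        rw [hX] at this
        have := norm_add_le (a Y0) (t ^ (l*k))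
        linarith) hX
      exact ⟨j, by rw [hj]; exact hX'⟩
    have hroot : ∀ᶠ Y in 𝓝 Y0, ∃ t ∈ ball (0:ℂ) r, φ (t ^ l) = Y := by
      have c := hψ.continuousAt.tendsto
      rw [hψ0] at c
      filter_upwards [c.eventually (root_small hl r hr), we] with Y ⟨t, ht, ht'⟩ e
      exact ⟨t, by simpa using ht, by rw [ht', e]⟩
    obtain ⟨Y, hY, ⟨t0, la, rfl⟩⟩ := ((mem_closure_iff_frequently.1 hY0).and_eventually hroot).exists
    have hS0 : ∀ᶠ t in 𝓝 t0, φ (t ^ l) ∈ S := by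
      have c : ContinuousAt (fun t => φ (t ^ l)) t0 := ContinuousAt.comp (f := fun t : ℂ => t ^ l) (hb t0 la).1.continuousAt (by fun_prop)
      exact c.eventually (mem_interior_iff_mem_nhds.1 hY)
    obtain ⟨j, hj⟩ : ∃ j, ∃ᶠ t in 𝓝[≠] t0, U (ξ j t) = V (φ (t ^ l)) := by
      by_contra hcon
      rw [not_exists] at hcon
      have : ∀ᶠ s in 𝓝[≠] t0, False := by
        filter_upwards [eventually_all.2 fun i => not_frequently.1 (hcon i), hS0.filter_mono nhdsWithin_le_nhds, mem_nhdsWithin_of_mem_nhds (isOpen_ball.mem_nhds la)] with t am ok de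
        obtain ⟨j, hj⟩ := hmem t de ok
        exact am j hj
      exact this.exists.elim fun _ h => h
    have hall : EqOn (fun t => U (ξ j t)) (fun t => V (φ (t ^ l))) (ball (0:ℂ) r) := by
      refine AnalyticOnNhd.eqOn_of_preconnected_of_frequently_eq (𝕜 := ℂ) (fun t ht => ?_) (fun t ht => ?_) (convex_ball 0 r).isPreconnected la hj
      · exact (hU.analyticAt _).fun_comp ((hb t ht).2.1 j)
      · exact (hV.analyticAt _).fun_comp (AnalyticAt.fun_comp (f := fun t : ℂ => t ^ l) (hb t ht).1 (by fun_prop))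
    rw [mem_interior_iff_mem_nhds]
    filter_upwards [hroot] with Y ⟨t, ht, htY⟩
    obtain ⟨-, -, de, e4, e5, -⟩ := hb t ht
    exact ⟨ξ j t, by rw [(e5 j).1, ← htY, de], by rw [← htY]; exact hall ht⟩
  have := IsClopen.eq_univ ⟨hcl, isOpen_interior⟩ hne
  intro Y
  have hY : Y ∈ interior S := by rw [this]; trivial
  exact (interior_subset hY : Y ∈ S)
lemma FIN {K : ℕ} {q : ℂ → ℂ} (hq : Differentiable ℂ q) (hp : Pro q) {W : ℂ → MK K} {C : MK K} (hC : UT 1 (C - 1)) (my : W 0 = 1)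
    (h : ∀ Y, ∃ X, q X = q Y ∧ W X = W Y * C) : C = 1 := by
  choose f hf hf' using h
  obtain ⟨R, hR⟩ := hp (‖q 0‖)
  obtain ⟨l, hl, hK⟩ := LLb hq hp.nc (q 0) (R := R) (fun x hx h => by have := hR x hx.ge; rw [h] at this; linarith)
  obtain ⟨ι, _, ξ, -, hξ, -⟩ := hK l hl dvd_rfl
  have me : ∀ k, q (f^[k] 0) = q 0 ∧ W (f^[k] 0) = C ^ k := by
    intro k
    induction k with
    | zero => simp [my]
    | succ k ih => rw [Function.iterate_succ_apply', hf, hf', ih.1, ih.2, pow_succ]; exact ⟨rfl, rfl⟩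
  have we : ∀ k, ∃ j, ξ j 0 = f^[k] 0 := fun k => hξ _ (by
    by_contra hcon
    have := hR (f^[k] 0) (by linarith)
    rw [(me k).1] at this
    exact lt_irrefl _ this) (me k).1
  choose g hg using we
  obtain ⟨k, m, hkm, he⟩ := Finite.exists_ne_map_eq_of_infinite g
  have hW : C ^ k = C ^ m := by rw [← (me k).2, ← (me m).2, ← hg, ← hg, he]
  have key : ∀ k m, k < m → C ^ k = C ^ m → C = 1 := by
    intro k m hkm he
    obtain ⟨d, rfl⟩ := Nat.exists_eq_add_of_lt hkm
    refine unip_pow hC (N := d + 1) (by omega) ?_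
    have hu : IsUnit (C ^ k) := hC.isUnit.pow k
    rw [add_assoc, pow_add] at he
    exact (hu.mul_left_cancel (by rw [mul_one]; exact he)).symm
  rcases lt_or_gt_of_ne hkm with h | h
  · exact key k m h hW
  · exact key m k h hW.symm
lemma int_ne {x : ℂ → ℂ} (hx : AnalyticAt ℂ x 0) {e : ℂ} (my : x 0 = e) (hne : ¬ ∀ᶠ s in 𝓝 0, x s = e) {S : Set ℂ} (h : ∀ᶠ s in 𝓝 0, x s ∈ S) : (interior S).Nonempty := by
  rcases hx.eventually_constant_or_nhds_le_map_nhds with me | me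
  · rw [my] at me; exact absurd me hne
  · exact ⟨x 0, mem_interior_iff_mem_nhds.2 (me h)⟩
lemma Match_C {n K : ℕ} {P : Fin n → Fin K → Fin K → MvPolynomial (Fin n) ℂ} {A B : Fin n → ℂ → ℂ} (hA : ∀ i, Differentiable ℂ (A i)) (hB : ∀ i, Differentiable ℂ (B i))
    {WA WB : ℂ → MK K} (hWA : IsW (Om P A) WA) (hWB : IsW (Om P B) WB) {x y : ℂ → ℂ} (hx : AnalyticAt ℂ x 0) (hy : AnalyticAt ℂ y 0)
    (h : ∀ᶠ s in 𝓝 0, ∀ i, A i (x s) = B i (y s)) : ∃ C, UT 1 (C - 1) ∧ ∀ᶠ s in 𝓝 0, WA (x s) = WB (y s) * C := by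
  obtain ⟨r, hr, hb⟩ := eventually_nhds_iff_ball.1 (hx.eventually_analyticAt.and (hy.eventually_analyticAt.and h))
  obtain ⟨C, hC, me⟩ := TR hA hB hWA hWB isOpen_ball (convex_ball (0:ℂ) r).isPreconnected
    (fun s hs => (hb s hs).1.differentiableAt.differentiableWithinAt) (fun s hs => (hb s hs).2.1.differentiableAt.differentiableWithinAt) (fun s hs => (hb s hs).2.2)
  exact ⟨C, hC, by filter_upwards [ball_mem_nhds (0:ℂ) hr] with s hs using me s hs⟩
lemma IsW.diff {K : ℕ} {Ω W : ℂ → MK K} (h : IsW Ω W) : Differentiable ℂ W := fun x => (h.d x).differentiableAt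
lemma CL2 {T : ℝ} {n K : ℕ} {P : Fin n → Fin K → Fin K → MvPolynomial (Fin n) ℂ} {B : Fin n → ℂ → ℂ} (hB : ∀ i, Differentiable ℂ (B i))
    {WB : ℂ → MK K} (hWB : IsW (Om P B) WB) {j : Fin n} (hp : Pro (B j)) (h : Match B 0 B T) : WB T = 1 := by
  obtain ⟨x, y, hx, hy, lo, en, hxn, hyn, hm⟩ := h
  obtain ⟨C, hC, hev⟩ := Match_C hB hB hWB hWB hx hy hm
  have me := hev.self_of_nhds
  rw [lo, en, hWB.z] at me
  have we := GLOB (hB j) hp (hB j) hp.nc hWB.diff (V := fun Y => WB Y * C) (hWB.diff.mul_const C) (int_ne hy en hyn (by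
    filter_upwards [hm, hev] with s am ok using ⟨x s, am j, ok⟩))
  rw [FIN (hB j) hp hC hWB.z we, mul_one] at me
  exact me.symm
lemma CL1 {T : ℝ} {n K : ℕ} {P : Fin n → Fin K → Fin K → MvPolynomial (Fin n) ℂ} {A B : Fin n → ℂ → ℂ} (hA : ∀ i, Differentiable ℂ (A i)) (hB : ∀ i, Differentiable ℂ (B i))
    {WA WB : ℂ → MK K} (hWA : IsW (Om P A) WA) (hWB : IsW (Om P B) WB) {j : Fin n} (hp : Pro (B j)) (h : Match B 0 A 0) (h' : Match B T A T) : WB T = WA T := by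
  obtain ⟨x, y, hx, hy, lo, en, hxn, hyn, hm⟩ := h
  obtain ⟨x', y', hx', hy', hx0', hy0', hxn', hyn', hm'⟩ := h'
  obtain ⟨C, hC, hev⟩ := Match_C hB hA hWB hWA hx hy hm
  obtain ⟨C', hC', hev'⟩ := Match_C hB hA hWB hWA hx' hy' hm'
  have me := hev.self_of_nhds
  rw [lo, en, hWB.z, hWA.z, one_mul] at me
  subst me
  have h1' := hev'.self_of_nhds
  rw [hx0', hy0'] at h1'
  have hac : ¬ ∃ w, ∀ x, A j x = w := by
    rintro ⟨w, hw⟩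
    rcases hx.eventually_constant_or_nhds_le_map_nhds with we | we
    · rw [lo] at we; exact hxn we
    · have us : ∀ᶠ X in 𝓝 (x 0), B j X = w := we (Filter.eventually_map.2 (by
        filter_upwards [hm] with s hs
        rw [hs j, hw]))
      exact hp.nc ⟨w, entire_const (hB j) (us.filter_mono nhdsWithin_le_nhds).frequently⟩
  have we := GLOB (hB j) hp (hA j) hac hWB.diff (V := fun Y => WA Y * C') (hWA.diff.mul_const C') (int_ne hy' hy0' hyn' (by
    filter_upwards [hm', hev'] with s am ok using ⟨x' s, am j, ok⟩))
  have us := GLOB (hB j) hp (hB j) hp.nc hWB.diff (V := fun Y => WB Y * C') (hWB.diff.mul_const C') (int_ne hx lo hxn (by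
    filter_upwards [hm, hev] with s am ok
    obtain ⟨X, hX, hX'⟩ := we (y s)
    rw [mul_one] at ok
    exact ⟨X, by rw [hX, am j], by rw [hX', ok]⟩))
  rw [h1', FIN (hB j) hp hC' hWB.z us, mul_one]
end

section
def lq (N : ℕ) (p : Polynomial ℂ) (z : ℂ) : ℂ := p.eval z / z ^ N
lemma lq_diff (N : ℕ) (p : Polynomial ℂ) : DifferentiableOn ℂ (lq N p) {0}ᶜ := fun z hz =>
  (p.differentiable.differentiableAt.fun_div (by fun_prop : DifferentiableAt ℂ (fun z : ℂ => z ^ N) z) (pow_ne_zero N hz)).differentiableWithinAt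
lemma compl0 {z : ℂ} (hz : z ≠ 0) : ({0}ᶜ : Set ℂ) ∈ 𝓝 z := isOpen_compl_singleton.mem_nhds hz
lemma RESann {N : ℕ} {p : Polynomial ℂ} {φ : ℂ → ℂ} (hφ : DifferentiableOn ℂ φ {0}ᶜ) {w : ℂ} {ε : ℝ} (hε : 0 < ε) (hε1 : ε < 1) (J : Finset ℂ)
    (hJ : ∀ z, z ∈ J ↔ z ≠ 0 ∧ ‖z‖ ≤ 1 ∧ lq N p z = w) (hJ1 : ∀ z ∈ J, ε < ‖z‖ ∧ ‖z‖ < 1 ∧ deriv (lq N p) z ≠ 0) :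
    (∮ z in C(0, 1), φ z * deriv (lq N p) z / (lq N p z - w)) - (∮ z in C(0, ε), φ z * deriv (lq N p) z / (lq N p z - w)) = 2 * Real.pi * I * ∑ z ∈ J, φ z := by
  set q := lq N p with hq
  have hqd : ∀ y, y ≠ 0 → DifferentiableAt ℂ q y := fun y hy => (lq_diff N p).differentiableAt (compl0 hy)
  have hQq : ∀ y, y ≠ 0 → p.eval y - w * y ^ N = y ^ N * (q y - w) := fun y hy => by
    simp only [hq, lq]; field_simp
  obtain ⟨h, hd, hh⟩ := factor J (f := fun y => p.eval y - w * y ^ N) (p.differentiable.sub (by fun_prop)) fun z hz => by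
    obtain ⟨me, -, we⟩ := (hJ z).1 hz
    rw [hQq z me, we]; ring
  have hqf : ∀ y, y ≠ 0 → q y - w = (∏ z ∈ J, (y - z)) * h y / y ^ N := fun y hy => by
    rw [← hh y, hQq y hy]; field_simp
  have hh0 : ∀ y, y ≠ 0 → ‖y‖ ≤ 1 → h y ≠ 0 := by
    intro y en hy my
    have hqy : q y = w := by have := hqf y en; rw [my, mul_zero, zero_div] at this; exact sub_eq_zero.1 this
    have hys := (hJ y).2 ⟨en, hy, hqy⟩
    apply (hJ1 y hys).2.2
    have e : q =ᶠ[𝓝 y] fun y => (∏ z ∈ J, (y - z)) * h y / y ^ N + w := by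
      filter_upwards [compl0 en] with y hy; rw [← hqf y hy]; ring
    have hp : DifferentiableAt ℂ (fun y => ∏ z ∈ J, (y - z)) y := by fun_prop
    have hpw : DifferentiableAt ℂ (fun y : ℂ => y ^ N) y := by fun_prop
    have := ((hp.hasDerivAt.fun_mul (hd y).hasDerivAt).fun_div hpw.hasDerivAt (pow_ne_zero N en)).add_const w
    rw [e.deriv_eq, this.deriv, my, Finset.prod_eq_zero hys (sub_self y)]; ring
  set D : ℂ → ℂ := fun y => φ y * (deriv h y / h y - N / y) + ∑ z ∈ J, dslope φ z y with hD
  have hDd : ∀ y, y ≠ 0 → ‖y‖ ≤ 1 → DifferentiableAt ℂ D y := by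
    intro y en hy
    have me : DifferentiableAt ℂ (fun y => φ y * (deriv h y / h y - N / y)) y :=
      (hφ.differentiableAt (compl0 en)).fun_mul (((hd.analyticAt y).deriv.differentiableAt.fun_div (hd y) (hh0 y en hy)).fun_sub ((by fun_prop : DifferentiableAt ℂ (fun _ : ℂ => (N:ℂ)) y).fun_div (by fun_prop) en))
    exact me.add (DifferentiableAt.fun_sum fun z hz => ((differentiableOn_dslope (compl0 ((hJ z).1 hz).1)).2 hφ).differentiableAt (compl0 en))
  have hG : ∀ y, y ≠ 0 → ‖y‖ ≤ 1 → y ∉ J → φ y * deriv q y / (q y - w) = D y + ∑ z ∈ J, φ z * (y - z)⁻¹ := by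
    intro y en hy hyJ
    have hys : ∀ z ∈ J, y - z ≠ 0 := fun z hz my => hyJ (by rwa [sub_eq_zero.1 my])
    have hp : DifferentiableAt ℂ (fun y => ∏ z ∈ J, (y - z)) y := by fun_prop
    have hprod := prod_ne_zero_iff.2 hys
    have e : logDeriv (fun y => q y - w) y = ∑ z ∈ J, 1 / (y - z) + deriv h y / h y - N / y := by
      have am : (fun y => q y - w) =ᶠ[𝓝 y] fun y => (∏ z ∈ J, (y - z)) * h y / y ^ N := by
        filter_upwards [compl0 en] with y hy using hqf y hy
      rw [logDeriv_apply, am.deriv_eq, hqf y en, ← logDeriv_apply (fun y => (∏ z ∈ J, (y - z)) * h y / y ^ N), logDeriv_div (f := fun y => (∏ z ∈ J, (y - z)) * h y) (g := fun y => y ^ N) y (mul_ne_zero hprod (hh0 y en hy)) (pow_ne_zero N en) (hp.fun_mul (hd y)) (by fun_prop)]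
      rw [logDeriv_mul y hprod (hh0 y en hy) (by fun_prop) (hd y), logDeriv_prod hys (fun z _ => by fun_prop)]
      rw [logDeriv_fun_pow differentiableAt_fun_id]
      simp [logDeriv_apply, div_eq_mul_inv]
    rw [logDeriv_apply, deriv_sub_const] at e
    rw [mul_div_assoc, e, hD]
    have : ∀ z ∈ J, dslope φ z y = (φ y - φ z) / (y - z) := fun z hz => by
      rw [dslope_of_ne _ (sub_ne_zero.1 (hys z hz)), slope_def_field]
    simp only
    rw [sum_congr rfl this, mul_sub, mul_add, mul_sum]
    simp only [sub_div, sum_sub_distrib]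
    simp only [div_eq_mul_inv, one_mul]
    ring
  have hI : ∀ ρ, 0 < ρ → ρ ≤ 1 → (∀ z ∈ J, ‖z‖ ≠ ρ) → (∮ z in C(0, ρ), φ z * deriv q z / (q z - w)) = (∮ z in C(0, ρ), D z) + ∑ z ∈ J, φ z * ∮ y in C(0, ρ), (y - z)⁻¹ := by
    intro ρ hρ hρ1 hne
    have hci : ∀ z ∈ J, CircleIntegrable (fun y => (y - z)⁻¹) 0 ρ := fun z hz =>
      circleIntegrable_sub_inv_iff.2 (Or.inr (by simp [abs_of_pos hρ]; exact hne z hz))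
    have hn : ∀ y ∈ Metric.sphere (0:ℂ) ρ, y ≠ 0 ∧ ‖y‖ ≤ 1 ∧ y ∉ J := fun y hy => by
      have hy' : ‖y‖ = ρ := by simpa using hy
      exact ⟨by rintro rfl; simp at hy'; linarith, by linarith, fun h => hne y h hy'⟩
    have hDc : CircleIntegrable D 0 ρ := ContinuousOn.circleIntegrable hρ.le fun y hy => (hDd y (hn y hy).1 (hn y hy).2.1).continuousAt.continuousWithinAt
    have hsi : ∀ z ∈ J, CircleIntegrable (fun y => φ z * (y - z)⁻¹) 0 ρ := fun z hz => (hci z hz).const_mul _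
    rw [circleIntegral.integral_congr hρ.le (g := fun y => D y + ∑ z ∈ J, φ z * (y - z)⁻¹) fun y hy => hG y (hn y hy).1 (hn y hy).2.1 (hn y hy).2.2,
      circleIntegral.integral_add hDc (CircleIntegrable.fun_sum _ hsi), circleIntegral.integral_fun_sum hsi]
    congr 1
    exact sum_congr rfl fun z _ => circleIntegral.integral_const_mul _ _ _ _
  have hDD : (∮ z in C(0, 1), D z) = ∮ z in C(0, ε), D z := by
    refine circleIntegral_eq_of_differentiable_on_annulus_off_countable hε hε1.le countable_empty (fun y hy => ?_) (fun y hy => ?_)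
    · have me : ‖y‖ ≤ 1 := by simpa using hy.1
      have we : ε ≤ ‖y‖ := by simpa using hy.2
      exact (hDd y (by rintro rfl; simp at we; linarith) me).continuousAt.continuousWithinAt
    · have me : ‖y‖ < 1 := by simpa using hy.1.1
      have we : ε < ‖y‖ := by simpa using hy.1.2
      exact hDd y (by rintro rfl; simp at we; linarith) me.le
  rw [hI 1 one_pos le_rfl fun z hz => (hJ1 z hz).2.1.ne, hI ε hε hε1.le fun z hz => (hJ1 z hz).1.ne', hDD, add_sub_add_left_eq_sub, ← sum_sub_distrib, mul_sum]
  refine sum_congr rfl fun z hz => ?_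
  have me : (∮ y in C(0, 1), (y - z)⁻¹) = 2 * Real.pi * I := circleIntegral.integral_sub_inv_of_mem_ball (by simpa using (hJ1 z hz).2.1)
  have we : (∮ y in C(0, ε), (y - z)⁻¹) = 0 := by
    refine circleIntegral_eq_zero_of_differentiable_on_off_countable hε.le countable_empty (fun y hy => ?_) (fun y hy => ?_)
    · have hy' : ‖y‖ ≤ ε := by simpa using hy
      have : y - z ≠ 0 := sub_ne_zero.2 (by rintro rfl; linarith [(hJ1 y hz).1])
      exact ((by fun_prop : ContinuousAt (fun y => y - z) y).inv₀ this).continuousWithinAt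
    · have hy' : ‖y‖ < ε := by simpa using hy.1
      have : y - z ≠ 0 := sub_ne_zero.2 (by rintro rfl; linarith [(hJ1 y hz).1])
      exact (by fun_prop : DifferentiableAt ℂ (fun y => y - z) y).inv this
  rw [me, we]; ring
end

section
lemma POLE {N : ℕ} {p : Polynomial ℂ} (h : ∃ k < N, p.coeff k ≠ 0) : ∃ (k : ℕ) (ψ φ : ℂ → ℂ), 0 < k ∧ AnalyticAt ℂ ψ 0 ∧ ψ 0 = 0 ∧ AnalyticAt ℂ φ 0 ∧ φ 0 = 0 ∧
    (∀ᶠ z in 𝓝[≠] 0, lq N p z = (ψ z ^ k)⁻¹) ∧ (∀ᶠ z in 𝓝 0, φ (ψ z) = z) ∧ (∀ᶠ s in 𝓝 0, ψ (φ s) = s) := by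
  obtain ⟨k, hk, hpk⟩ := h
  have hp0 : p ≠ 0 := by rintro rfl; simp at hpk
  obtain ⟨go, hp', hnd⟩ := Polynomial.exists_eq_pow_rootMultiplicity_mul_and_not_dvd p hp0 0
  set r := p.rootMultiplicity 0
  rw [Polynomial.C_0, sub_zero] at hp' hnd
  have hr : r < N := by
    by_contra hcon
    apply hpk
    rw [hp', Polynomial.coeff_X_pow_mul', if_neg (by omega)]
  have my : go.eval 0 ≠ 0 := by rw [← Polynomial.coeff_zero_eq_eval_zero]; rwa [Polynomial.X_dvd_iff] at hnd
  have hpa : AnalyticAt ℂ (fun z => go.eval z) 0 := go.differentiable.analyticAt 0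
  have hf : AnalyticAt ℂ (fun z => z ^ (N - r) / go.eval z) 0 := AnalyticAt.fun_div (by fun_prop) hpa my
  have hNr : N - r ≠ 0 := by omega
  have hev : ∀ᶠ z in 𝓝 0, go.eval z ≠ 0 := hpa.continuousAt.eventually_ne my
  obtain ⟨k, ψ, φ, hk, me, we, us, up, ma, h6, h7⟩ := LLL hf (by
    intro hcon
    have : ∀ᶠ z in 𝓝[≠] (0:ℂ), False := by
      filter_upwards [hcon.filter_mono nhdsWithin_le_nhds, hev.filter_mono nhdsWithin_le_nhds, self_mem_nhdsWithin] with z am ok de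
      rw [zero_pow hNr, zero_div] at am
      exact div_ne_zero (pow_ne_zero _ de) ok am
    exact this.exists.elim fun _ h => h)
  refine ⟨k, ψ, φ, hk, me, we, us, up, ?_, h6, h7⟩
  filter_upwards [ma.filter_mono nhdsWithin_le_nhds, self_mem_nhdsWithin] with z am ok
  rw [zero_pow hNr, zero_div, zero_add] at am
  rw [← am, inv_div, lq]
  have de : p.eval z = z ^ r * go.eval z := by rw [hp']; simp
  have e4 : z ^ N = z ^ r * z ^ (N - r) := by rw [← pow_add]; congr 1; omega
  rw [de, e4, mul_div_mul_left _ _ (pow_ne_zero r ok)]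
lemma ROOTS {N : ℕ} {p : Polynomial ℂ} (h : ∃ k < N, p.coeff k ≠ 0) : ∃ (k : ℕ) (φ : ℂ → ℂ), 0 < k ∧ AnalyticAt ℂ φ 0 ∧ φ 0 = 0 ∧ (¬ ∀ᶠ s in 𝓝 0, φ s = 0) ∧
    ∃ r > 0, ∀ t : ℂ, t ≠ 0 → ‖t‖ < r → (∀ z, (z ≠ 0 ∧ ‖z‖ ≤ 1 ∧ lq N p z = (t ^ k)⁻¹) ↔ ∃ ζ, ζ ^ k = 1 ∧ z = φ (ζ * t)) ∧
      (∀ ζ, ζ ^ k = 1 → ‖φ (ζ * t)‖ < 1 ∧ deriv (lq N p) (φ (ζ * t)) ≠ 0) ∧ ∀ ζ ζ', ζ ^ k = 1 → ζ' ^ k = 1 → φ (ζ * t) = φ (ζ' * t) → ζ = ζ' := by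
  obtain ⟨k, ψ, φ, hk, me, we, us, up, ma, h6, h7⟩ := POLE h
  have h5' := eventually_nhdsWithin_iff.1 ma
  obtain ⟨r1, hr1, hb⟩ := eventually_nhds_iff_ball.1 ((h5'.and h6).and (ball_mem_nhds (0:ℂ) one_pos))
  have hcomp : IsCompact (closedBall (0:ℂ) 1 \ ball 0 r1) := (isCompact_closedBall 0 1).diff isOpen_ball
  obtain ⟨M, hM⟩ := hcomp.exists_bound_of_continuousOn (f := lq N p) ((lq_diff N p).continuousOn.mono fun z hz => by
    rintro rfl; exact hz.2 (mem_ball_self hr1))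
  have hM0 : ∀ᶠ t in 𝓝 (0:ℂ), ‖t ^ k‖ * (|M| + 1) < 1 := by
    have : Continuous fun t : ℂ => ‖t ^ k‖ * (|M| + 1) := by fun_prop
    have := this.tendsto 0
    simp only [zero_pow hk.ne', norm_zero, zero_mul] at this
    exact this.eventually (gt_mem_nhds one_pos)
  have hc : Tendsto φ (𝓝 0) (𝓝 0) := by have := us.continuousAt.tendsto; rwa [up] at this
  obtain ⟨r, hr, hbr⟩ := eventually_nhds_iff_ball.1 (h7.and (hM0.and (us.eventually_analyticAt.and (hc.eventually (ball_mem_nhds (0:ℂ) hr1)))))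
  have hne : ∀ t ∈ ball (0:ℂ) r, t ≠ 0 → φ t ≠ 0 := fun t ht my hcon => by
    have := (hbr t ht).1; rw [hcon, we] at this; exact my this.symm
  have hq : ∀ t ∈ ball (0:ℂ) r, t ≠ 0 → lq N p (φ t) = (t ^ k)⁻¹ := fun t ht my => by
    rw [(hb _ (hbr t ht).2.2.2).1.1 (hne t ht my), (hbr t ht).1]
  refine ⟨k, φ, hk, us, up, fun hcon => ?_, r, hr, fun t la ht => ?_⟩
  · have : ∀ᶠ z in 𝓝[≠] (0:ℂ), False := by
      filter_upwards [hcon.filter_mono nhdsWithin_le_nhds, mem_nhdsWithin_of_mem_nhds (ball_mem_nhds (0:ℂ) hr), self_mem_nhdsWithin] with z am ok de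
      exact hne z ok de am
    exact this.exists.elim fun _ h => h
  have hζ : ∀ ζ : ℂ, ζ ^ k = 1 → ζ * t ∈ ball (0:ℂ) r ∧ ζ * t ≠ 0 := fun ζ h => by
    have h8 : ‖ζ‖ = 1 := norm_eq_one_of_pow_eq_one h hk.ne'
    refine ⟨by simpa [h8] using ht, mul_ne_zero (by rintro rfl; simp at h8) la⟩
  have htb : t ∈ ball (0:ℂ) r := by simpa using ht
  refine ⟨fun z => ⟨fun ⟨hz0, hz1, hz⟩ => ?_, ?_⟩, fun ζ h => ⟨?_, ?_⟩, fun ζ ζ' h h' he => ?_⟩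
  · have hzb : z ∈ ball (0:ℂ) r1 := by
      by_contra hcon
      have am := hM z ⟨by simpa using hz1, hcon⟩
      have ok := (hbr t htb).2.1
      rw [hz, norm_inv] at am
      have de : 0 < ‖t ^ k‖ := norm_pos_iff.2 (pow_ne_zero k la)
      rw [inv_le_iff_one_le_mul₀ de] at am
      nlinarith [le_abs_self M]
    have am := (hb z hzb).1.1 hz0
    rw [hz, inv_inj] at am
    refine ⟨ψ z / t, by rw [div_pow, ← am, div_self (pow_ne_zero k la)], ?_⟩
    rw [div_mul_cancel₀ _ la, (hb z hzb).1.2]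
  · rintro ⟨ζ, h, rfl⟩
    obtain ⟨am, ok⟩ := hζ ζ h
    refine ⟨hne _ am ok, ?_, by rw [hq _ am ok, mul_pow, h, one_mul]⟩
    have := (hb _ (hbr _ am).2.2.2).2
    rw [dist_zero_right] at this; exact this.le
  · have := (hb _ (hbr _ (hζ ζ h).1).2.2.2).2
    rwa [dist_zero_right] at this
  · obtain ⟨am, ok⟩ := hζ ζ h
    intro my
    have d1 := ((lq_diff N p).differentiableAt (compl0 (hne _ am ok))).hasDerivAt.comp (ζ * t) (hbr _ am).2.2.1.differentiableAt.hasDerivAt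
    rw [my, zero_mul] at d1
    have d2 : HasDerivAt (fun t : ℂ => (t ^ k)⁻¹) 0 (ζ * t) := d1.congr_of_eventuallyEq (by
      filter_upwards [isOpen_ball.mem_nhds am, compl0 ok] with s de e4 using (hq s de e4).symm)
    have d3 := (hasDerivAt_pow k (ζ * t)).fun_inv (pow_ne_zero k ok)
    have := d2.unique d3
    rw [eq_comm, neg_div, neg_eq_zero, div_eq_zero_iff] at this
    have hk' : (k:ℂ) ≠ 0 := by exact_mod_cast hk.ne'
    rcases this with h | h
    · exact mul_ne_zero hk' (pow_ne_zero _ ok) h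
    · exact pow_ne_zero 2 (pow_ne_zero _ ok) h
  · have am := (hbr _ (hζ ζ h).1).1
    rw [he, (hbr _ (hζ ζ' h').1).1] at am
    exact (mul_right_cancel₀ la am).symm
end

section
structure GJ (N : ℕ) (p : Polynomial ℂ) (R : ℝ) (J : ℂ → Finset ℂ) (k : ℕ) : Prop where
  bd : ∀ z, ‖z‖ = 1 → ‖lq N p z‖ ≤ R
  card : ∀ w, R < ‖w‖ → (J w).card = k
  mem : ∀ w, R < ‖w‖ → ∀ z, z ∈ J w ↔ z ≠ 0 ∧ ‖z‖ ≤ 1 ∧ lq N p z = w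
  one : ∀ w, R < ‖w‖ → ∀ z ∈ J w, ‖z‖ < 1 ∧ deriv (lq N p) z ≠ 0
  pole : Tendsto (fun z => ‖lq N p z‖) (𝓝[≠] 0) atTop
lemma GJ.small {N p R J k} (h : GJ N p R J k) (W : ℝ) : ∃ ε > 0, ∀ z : ℂ, z ≠ 0 → ‖z‖ < ε → W < ‖lq N p z‖ := by
  have := h.pole.eventually (eventually_gt_atTop W)
  rw [eventually_nhdsWithin_iff, Metric.eventually_nhds_iff] at this
  obtain ⟨ε, he, me⟩ := this
  exact ⟨ε, he, fun z my hz => me (by simpa using hz) my⟩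
def HE (N : ℕ) (p : Polynomial ℂ) (g : ℂ → ℂ) (ρ : ℝ) (m : ℕ) (w : ℂ) : ℂ := ∮ z in C(0, ρ), g z ^ m * deriv (lq N p) z / (lq N p z - w)
lemma lq_dd (N : ℕ) (p : Polynomial ℂ) : DifferentiableOn ℂ (deriv (lq N p)) {0}ᶜ := (lq_diff N p).deriv isOpen_compl_singleton
lemma circ_cont {f : ℂ → ℂ} (hf : ContinuousOn f {0}ᶜ) {ρ : ℝ} (hρ : 0 < ρ) : Continuous fun θ => f (circleMap 0 ρ θ) :=
  hf.comp_continuous (continuous_circleMap 0 ρ) fun _ => circleMap_ne_center hρ.ne'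
lemma HE_an {N : ℕ} {p : Polynomial ℂ} {g : ℂ → ℂ} (hg : DifferentiableOn ℂ g {0}ᶜ) {ρ : ℝ} (hρ : 0 < ρ) (m : ℕ) {w : ℂ} (hw : ∀ z, ‖z‖ = ρ → lq N p z ≠ w) :
    AnalyticAt ℂ (HE N p g ρ m) w := by
  have h := CI (f := fun θ => - (deriv (circleMap 0 ρ) θ * (g (circleMap 0 ρ θ) ^ m * deriv (lq N p) (circleMap 0 ρ θ)))) (q := fun θ => lq N p (circleMap 0 ρ θ)) (a := 0) (b := 2 * Real.pi) (w := w) ?_ ?_ ?_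
  · convert h using 1
    ext w
    unfold HE circleIntegral
    refine intervalIntegral.integral_congr fun θ _ => ?_
    simp only [smul_eq_mul]
    rw [show w - lq N p (circleMap 0 ρ θ) = - (lq N p (circleMap 0 ρ θ) - w) by ring, neg_div_neg_eq]
    ring
  · apply Continuous.continuousOn
    have me := circ_cont hg.continuousOn hρ
    have we := circ_cont (lq_dd N p).continuousOn hρ
    have us : Continuous (deriv (circleMap 0 ρ)) := by
      have : deriv (circleMap 0 ρ) = fun θ => circleMap 0 ρ θ * I := funext fun θ => deriv_circleMap 0 ρ θ
      rw [this]; fun_prop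
    exact (us.mul ((me.pow m).mul we)).neg
  · exact (circ_cont (lq_diff N p).continuousOn hρ).continuousOn
  · rintro ⟨θ, -, h⟩
    exact hw _ (by simp [abs_of_pos hρ]) h
lemma circ_eq {N : ℕ} {p go : Polynomial ℂ} {gA gB : ℂ → ℂ} (hgA : DifferentiableOn ℂ gA {0}ᶜ) (hgB : DifferentiableOn ℂ gB {0}ᶜ) {m : ℕ}
    (hmom : ∀ k : ℕ, ∮ z in C(0, 1), gA z ^ m * deriv (lq N p) z * lq N p z ^ k = ∮ z in C(0, 1), gB z ^ m * deriv (lq N go) z * lq N go z ^ k)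
    {R : ℝ} (hA : ∀ z, ‖z‖ = 1 → ‖lq N p z‖ ≤ R) (hB : ∀ z, ‖z‖ = 1 → ‖lq N go z‖ ≤ R) {w : ℂ} (hw : R < ‖w‖) : HE N p gA 1 m w = HE N go gB 1 m w := by
  have key : ∀ (p : Polynomial ℂ) (g : ℂ → ℂ), DifferentiableOn ℂ g {0}ᶜ → (∀ z, ‖z‖ = 1 → ‖lq N p z‖ ≤ R) →
      HasSum (fun k => (w^(k+1))⁻¹ * ∮ z in C(0, 1), g z ^ m * deriv (lq N p) z * lq N p z ^ k) (- HE N p g 1 m w) := by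
    intro p g hg hR
    have me := circ_cont hg.continuousOn one_pos
    have we := circ_cont (lq_dd N p).continuousOn one_pos
    have us : Continuous (deriv (circleMap 0 1)) := by
      have : deriv (circleMap 0 1) = fun θ => circleMap 0 1 θ * I := funext fun θ => deriv_circleMap 0 1 θ
      rw [this]; fun_prop
    have h := cc_hasSum (T := 2 * Real.pi) (R := R) (by positivity) (f := fun θ => deriv (circleMap 0 1) θ * (g (circleMap 0 1 θ) ^ m * deriv (lq N p) (circleMap 0 1 θ))) (q := fun θ => lq N p (circleMap 0 1 θ)) (us.mul ((me.pow m).mul we))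
      (circ_cont (lq_diff N p).continuousOn one_pos) (fun θ _ => hR _ (by simp)) hw
    convert h using 1
    · ext k
      unfold circleIntegral
      simp only [smul_eq_mul, mul_assoc]
    · unfold HE circleIntegral
      rw [← intervalIntegral.integral_neg]
      refine intervalIntegral.integral_congr fun θ _ => ?_
      simp only [smul_eq_mul]
      rw [show w - lq N p (circleMap 0 1 θ) = - (lq N p (circleMap 0 1 θ) - w) by ring, div_neg]
      ring
  have me := key p gA hgA hA
  have we := key go gB hgB hB
  simp only [hmom] at me
  exact neg_inj.1 (me.unique we)
lemma RatD_JJ (J J' : Finset ℂ) (α β : ℂ → ℂ) : RatD J.card J'.card (∑ j ∈ J, pw (α j) - ∑ j ∈ J', pw (β j)) := by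
  classical
  have me : RatD J.card 0 (∑ j ∈ J, pw (α j)) := by
    induction J using Finset.induction_on with
    | empty => simpa using RatD.zero
    | insert a s ha ih => rw [Finset.sum_insert ha, Finset.card_insert_of_notMem ha, add_comm (pw _)]; exact ih.add _
  induction J' using Finset.induction_on with
  | empty => simpa using me
  | insert a s ha ih =>
    rw [Finset.sum_insert ha, Finset.card_insert_of_notMem ha]
    convert ih.sub (β a) using 1
    abel
lemma T0a {N : ℕ} {p go : Polynomial ℂ} {gA gB : ℂ → ℂ} (hgA : DifferentiableOn ℂ gA {0}ᶜ) (hgB : DifferentiableOn ℂ gB {0}ᶜ)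
    (hmom : ∀ m k : ℕ, ∮ z in C(0, 1), gA z ^ m * deriv (lq N p) z * lq N p z ^ k = ∮ z in C(0, 1), gB z ^ m * deriv (lq N go) z * lq N go z ^ k)
    {R : ℝ} {JA JB : ℂ → Finset ℂ} {kA kB : ℕ} (hA : GJ N p R JA kA) (hB : GJ N go R JB kB) (hkB : 0 < kB) {ad : ℂ} (hz1 : 1 < ‖ad‖)
    (hw : R < ‖lq N go ad‖) (my : ∀ z ∈ JB (lq N go ad), gB z ≠ 0) :
    (∃ z ∈ JB (lq N go ad), gB z = gB ad) ∨ ∃ z ∈ JB (lq N go ad), ∃ z' ∈ JA (lq N go ad), gB z = gA z' := by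
  obtain ⟨δ, hδ, hδR⟩ := hB.small R
  set δ' := min δ 1
  have hδ' : 0 < δ' := by positivity
  set G : Set ℂ := {z | δ' / 2 ≤ ‖z‖ ∧ ‖z‖ ≤ ‖ad‖ + 1}
  have hG : IsCompact G := by
    refine Metric.isCompact_of_isClosed_isBounded ?_ ?_
    · exact (isClosed_le continuous_const continuous_norm).inter (isClosed_le continuous_norm continuous_const)
    · exact (Metric.isBounded_closedBall (x := (0:ℂ)) (r := ‖ad‖ + 1)).subset fun z hz => by simpa using hz.2
  have hG0 : G ⊆ {0}ᶜ := fun z hz h => by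
    have h := mem_singleton_iff.1 h
    have := hz.1
    rw [h, norm_zero] at this; linarith
  obtain ⟨W, hW⟩ := hG.exists_bound_of_continuousOn ((lq_diff N go).continuousOn.mono hG0)
  obtain ⟨εA, hεA, hA1⟩ := hA.small (W + 1)
  obtain ⟨εB, hεB, hB1⟩ := hB.small (W + 1)
  set ε := min (min εA εB) 1 / 2
  have hε : 0 < ε := by positivity
  have hε1 : ε < 1 := by have : min (min εA εB) 1 ≤ 1 := min_le_right _ _; show _ / 2 < _; linarith
  have hεεA : ε < εA := by
    have : min (min εA εB) 1 ≤ εA := (min_le_left _ _).trans (min_le_left _ _)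
    have : 0 < min (min εA εB) 1 := by positivity
    show _ / 2 < _; linarith
  have hεεB : ε < εB := by
    have : min (min εA εB) 1 ≤ εB := (min_le_left _ _).trans (min_le_right _ _)
    have : 0 < min (min εA εB) 1 := by positivity
    show _ / 2 < _; linarith
  have res : ∀ {p J k g}, GJ N p R J k → DifferentiableOn ℂ g {0}ᶜ → (∀ z : ℂ, z ≠ 0 → ‖z‖ ≤ ε → W + 1 < ‖lq N p z‖) → ∀ w, R < ‖w‖ → ‖w‖ ≤ W → ∀ m,
      HE N p g 1 m w - HE N p g ε m w = 2 * Real.pi * I * ∑ z ∈ J w, g z ^ m := by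
    intro p J k g hJ hg hs w me we m
    refine RESann (φ := fun z => g z ^ m) (hg.pow m) hε hε1 (J w) (hJ.mem w me) fun z hz => ⟨?_, hJ.one w me z hz⟩
    by_contra hcon
    have us := (hJ.mem w me z).1 hz
    have := hs z us.1 (not_lt.1 hcon)
    rw [us.2.2] at this; linarith
  have hsA : ∀ z : ℂ, z ≠ 0 → ‖z‖ ≤ ε → W + 1 < ‖lq N p z‖ := fun z me we => hA1 z me (by linarith)
  have hsB : ∀ z : ℂ, z ≠ 0 → ‖z‖ ≤ ε → W + 1 < ‖lq N go z‖ := fun z me we => hB1 z me (by linarith)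
  let H : ℕ → ℂ → ℂ := fun m w => (2 * Real.pi * I)⁻¹ * (HE N p gA ε m w - HE N go gB ε m w)
  have hH : ∀ w, R < ‖w‖ → ‖w‖ ≤ W → ∀ m, H m w = ∑ z ∈ JB w, gB z ^ m - ∑ z ∈ JA w, gA z ^ m := by
    intro w me we m
    have am := res hA hgA hsA w me we m
    have ok := res hB hgB hsB w me we m
    have de := circ_eq hgA hgB (hmom m) hA.bd hB.bd me
    show _ * _ = _
    rw [inv_mul_eq_iff_eq_mul₀ pi2_ne]
    linear_combination ok - am + de
  have hHan : ∀ w, ‖w‖ ≤ W → ∀ m, AnalyticAt ℂ (H m) w := by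
    intro w h m
    have : ∀ {p g}, DifferentiableOn ℂ g {0}ᶜ → (∀ z : ℂ, z ≠ 0 → ‖z‖ ≤ ε → W + 1 < ‖lq N p z‖) → AnalyticAt ℂ (HE N p g ε m) w := by
      intro p g hg hs
      refine HE_an hg hε m fun z hz e => ?_
      have := hs z (by rw [← norm_pos_iff, hz]; exact hε) hz.le
      rw [e] at this; linarith
    exact analyticAt_const.mul ((this hgA hsA).sub (this hgB hsB))
  let U : Set ℂ := {x | Real.log (δ' / 2) < x.re ∧ x.re < Real.log (‖ad‖ + 1)}
  have hUG : ∀ x ∈ U, exp x ∈ G := by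
    intro x hx
    show _ ≤ ‖_‖ ∧ ‖_‖ ≤ _
    rw [norm_exp]
    exact ⟨((Real.log_lt_iff_lt_exp (by positivity)).1 hx.1).le, ((lt_log_iff_exp_lt (by positivity)).1 hx.2).le⟩
  let V : Set ℂ := {x | Real.log (δ' / 2) < x.re ∧ x.re < Real.log δ'}
  have hid := RatD_ident (c := fun m x => H m (lq N go (exp x)) - gB (exp x) ^ m) (U := U) (V := V) ?_ ?_ ?_ ?_ ?_ (n := kB - 1) (d := kA) ?_
  · have hz10 : ad ≠ 0 := by rw [← norm_pos_iff]; linarith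
    have hx : log ad ∈ U := by
      show _ < _ ∧ _ < _
      rw [log_re]
      have me : δ' ≤ 1 := min_le_right _ _
      exact ⟨Real.log_lt_log (by positivity) (by linarith), Real.log_lt_log (by positivity) (by linarith)⟩
    have me := hid _ hx
    have hzG := hUG _ hx
    rw [exp_log hz10] at me hzG
    have hJne : (JB (lq N go ad)).Nonempty := by rw [← Finset.card_pos, hB.card _ hw]; exact hkB
    have we := coprime_roots (JB (lq N go ad)) (JA (lq N go ad)) gB gA (gB ad) my ?_ hJne
    · exact we
    · rw [hB.card _ hw, hA.card _ hw]
      convert me using 1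
      ext m
      rw [hH _ hw (hW _ hzG)]
      simp [pw]
  · intro m x hx
    have hzG := hUG x hx
    have am : AnalyticAt ℂ (fun x => lq N go (exp x)) x :=
      AnalyticAt.fun_comp (f := exp) ((lq_diff N go).analyticAt (compl0 (exp_ne_zero x))) (by fun_prop)
    have ok : AnalyticAt ℂ (fun x => gB (exp x)) x :=
      AnalyticAt.fun_comp (f := exp) (hgB.analyticAt (compl0 (exp_ne_zero x))) (by fun_prop)
    exact (AnalyticAt.fun_comp (f := fun x => lq N go (exp x)) (hHan _ (hW _ hzG) m) am).fun_sub (ok.fun_pow m)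
  · apply Convex.isPreconnected
    exact (convex_halfSpace_re_gt _).inter (convex_halfSpace_re_lt _)
  · exact (isOpen_lt continuous_const continuous_re).inter (isOpen_lt continuous_re continuous_const)
  · refine ⟨((Real.log (δ' / 2) + Real.log δ') / 2 : ℝ), ?_⟩
    have := Real.log_lt_log (x := δ' / 2) (y := δ') (by positivity) (by linarith)
    show _ < _ ∧ _ < _
    rw [ofReal_re]
    constructor <;> linarith
  · intro x hx
    refine ⟨hx.1, hx.2.trans (Real.log_lt_log hδ' ?_)⟩
    have me : δ' ≤ 1 := min_le_right _ _
    linarith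
  · classical
    intro x hx
    have hxe : ‖exp x‖ < δ' := by
      rw [norm_exp]; exact (lt_log_iff_exp_lt hδ').1 hx.2
    have hz0 := exp_ne_zero x
    set z := exp x
    have me : R < ‖lq N go z‖ := hδR z hz0 (hxe.trans_le (min_le_left _ _))
    have we : ‖lq N go z‖ ≤ W := hW _ ⟨by
      have := (Real.log_lt_iff_lt_exp (by positivity)).1 hx.1
      rw [← norm_exp] at this; exact this.le, by
      have me : δ' ≤ 1 := min_le_right _ _
      linarith⟩
    have us : z ∈ JB (lq N go z) := (hB.mem _ me z).2 ⟨hz0, (hxe.trans_le (min_le_right _ _)).le, rfl⟩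
    have up := RatD_JJ ((JB (lq N go z)).erase z) (JA (lq N go z)) gB gA
    rw [Finset.card_erase_of_mem us, hB.card _ me, hA.card _ me] at up
    convert up using 1
    ext m
    rw [hH _ me we]
    have := Finset.sum_erase_eq_sub (f := fun z => gB z ^ m) us
    simp [pw, this]
    ring
end

section
lemma pole_tendsto {N : ℕ} {p : Polynomial ℂ} (h : ∃ k < N, p.coeff k ≠ 0) : Tendsto (fun z => ‖lq N p z‖) (𝓝[≠] 0) atTop := by
  obtain ⟨k, ψ, φ, hk, hψ, my, hφ, hφ0, me, we, -⟩ := POLE h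
  have e : (fun z => ‖lq N p z‖) =ᶠ[𝓝[≠] 0] fun z => (‖ψ z‖ ^ k)⁻¹ := me.mono fun z hz => by
    show ‖lq N p z‖ = _
    rw [hz, norm_inv, norm_pow]
  rw [tendsto_congr' e]
  refine tendsto_inv_nhdsGT_zero.comp (tendsto_nhdsWithin_iff.2 ⟨?_, ?_⟩)
  · have : Tendsto (fun z => ‖ψ z‖ ^ k) (𝓝 0) (𝓝 (‖ψ 0‖ ^ k)) := (hψ.continuousAt.norm.pow k)
    rw [my, norm_zero, zero_pow hk.ne'] at this
    exact this.mono_left nhdsWithin_le_nhds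
  · filter_upwards [we.filter_mono nhdsWithin_le_nhds, self_mem_nhdsWithin] with z us up
    refine mem_Ioi.2 (pow_pos (norm_pos_iff.2 fun ma => up ?_) k)
    rw [ma, hφ0] at us; exact us.symm
def JJ (k : ℕ) (φ : ℂ → ℂ) (w : ℂ) : Finset ℂ := (Polynomial.nthRootsFinset k (1:ℂ)).image fun ζ => φ (ζ * (w⁻¹) ^ ((k:ℂ)⁻¹))
def Roo (N : ℕ) (p : Polynomial ℂ) (k : ℕ) (φ : ℂ → ℂ) (r : ℝ) : Prop := ∀ t : ℂ, t ≠ 0 → ‖t‖ < r → (∀ z, (z ≠ 0 ∧ ‖z‖ ≤ 1 ∧ lq N p z = (t ^ k)⁻¹) ↔ ∃ ζ, ζ ^ k = 1 ∧ z = φ (ζ * t)) ∧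
      (∀ ζ, ζ ^ k = 1 → ‖φ (ζ * t)‖ < 1 ∧ deriv (lq N p) (φ (ζ * t)) ≠ 0) ∧ ∀ ζ ζ', ζ ^ k = 1 → ζ' ^ k = 1 → φ (ζ * t) = φ (ζ' * t) → ζ = ζ'
lemma GJ_of {N : ℕ} {p : Polynomial ℂ} (h : ∃ k < N, p.coeff k ≠ 0) {k : ℕ} {φ : ℂ → ℂ} {r : ℝ} (hk : 0 < k) (hr : 0 < r) (H : Roo N p k φ r) :
    ∃ R₀ > 0, ∀ R ≥ R₀, GJ N p R (JJ k φ) k := by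
  classical
  obtain ⟨M, hM⟩ := (isCompact_sphere (0:ℂ) 1).exists_bound_of_continuousOn ((lq_diff N p).continuousOn.mono fun z hz h => by
    rw [mem_singleton_iff.1 h] at hz; simp at hz)
  refine ⟨max M (r ^ k)⁻¹, lt_max_of_lt_right (by positivity), fun R hR => ?_⟩
  have key : ∀ w : ℂ, R < ‖w‖ → ∃ t : ℂ, (w⁻¹) ^ ((k:ℂ)⁻¹) = t ∧ t ≠ 0 ∧ ‖t‖ < r ∧ (t ^ k)⁻¹ = w := by
    intro w hw
    have me : (r ^ k)⁻¹ < ‖w‖ := ((le_max_right _ _).trans hR).trans_lt hw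
    have hw0 : 0 < ‖w‖ := lt_trans (by positivity) me
    have e : ((w⁻¹) ^ ((k:ℂ)⁻¹)) ^ k = w⁻¹ := cpow_nat_inv_pow _ hk.ne'
    refine ⟨_, rfl, ?_, ?_, by rw [e, inv_inv]⟩
    · intro h; rw [h, zero_pow hk.ne'] at e
      exact norm_pos_iff.1 hw0 (inv_eq_zero.1 e.symm)
    · refine lt_of_pow_lt_pow_left₀ k hr.le ?_
      rw [← norm_pow, e, norm_inv]
      exact inv_lt_of_inv_lt₀ (by positivity) me
  have hmem : ∀ w, R < ‖w‖ → ∀ z, z ∈ JJ k φ w ↔ ∃ ζ, ζ ^ k = 1 ∧ z = φ (ζ * (w⁻¹) ^ ((k:ℂ)⁻¹)) := by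
    intro w hw z
    simp only [JJ, Finset.mem_image, Polynomial.mem_nthRootsFinset hk]
    simp only [eq_comm]
  refine ⟨fun z hz => (hM z (by simpa using hz)).trans ((le_max_left _ _).trans hR), fun w hw => ?_, fun w hw z => ?_, fun w hw z hz => ?_, pole_tendsto h⟩
  · obtain ⟨t, e, my, me, we⟩ := key w hw
    rw [JJ, Finset.card_image_of_injOn, (isPrimitiveRoot_exp k hk.ne').card_nthRootsFinset]
    intro ζ hζ ζ' hζ' h
    rw [e] at h
    exact (H t my me).2.2 _ _ ((Polynomial.mem_nthRootsFinset hk _).1 hζ) ((Polynomial.mem_nthRootsFinset hk _).1 hζ') h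
  · obtain ⟨t, e, my, me, we⟩ := key w hw
    rw [hmem w hw, e, ← (H t my me).1 z, we]
  · obtain ⟨t, e, my, me, we⟩ := key w hw
    rw [hmem w hw, e] at hz
    obtain ⟨ζ, hζ, rfl⟩ := hz
    exact (H t my me).2.1 ζ hζ
def ZZ (φ : ℂ → ℂ) : Prop := AnalyticAt ℂ φ 0 ∧ φ 0 = 0 ∧ ¬ ∀ᶠ s in 𝓝 0, φ s = 0
lemma ZZ.ne {φ : ℂ → ℂ} (h : ZZ φ) : ∀ᶠ s in 𝓝[≠] 0, φ s ≠ 0 := h.1.eventually_eq_zero_or_eventually_ne_zero.resolve_left h.2.2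
lemma pow_tend {ζ : ℂ} (hζ : ζ ≠ 0) {α : ℕ} (hα : 0 < α) : Tendsto (fun u : ℂ => ζ * u ^ α) (𝓝[≠] 0) (𝓝[≠] 0) := by
  refine tendsto_nhdsWithin_iff.2 ⟨?_, ?_⟩
  · have : ContinuousAt (fun u : ℂ => ζ * u ^ α) 0 := by fun_prop
    have := this.tendsto
    simp only [zero_pow hα.ne', mul_zero] at this
    exact this.mono_left nhdsWithin_le_nhds
  · filter_upwards [self_mem_nhdsWithin] with u hu using mul_ne_zero hζ (pow_ne_zero _ hu)
lemma ZZ.comp {φ : ℂ → ℂ} (h : ZZ φ) {ζ : ℂ} (hζ : ζ ≠ 0) {α : ℕ} (hα : 0 < α) : ZZ fun u => φ (ζ * u ^ α) := by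
  have my : ζ * (0:ℂ) ^ α = 0 := by simp [hα.ne']
  refine ⟨AnalyticAt.fun_comp (f := fun u => ζ * u ^ α) (by rw [my]; exact h.1) (by fun_prop), by simp only [my, h.2.1], fun hc => ?_⟩
  have : ∀ᶠ s in 𝓝[≠] (0:ℂ), False := by
    filter_upwards [(pow_tend hζ hα).eventually h.ne, hc.filter_mono nhdsWithin_le_nhds] with s me we using me we
  exact this.exists.elim fun _ h => h
lemma ZZ.mero {φ : ℂ → ℂ} (h : ZZ φ) (N : ℕ) (p : Polynomial ℂ) : MeromorphicAt (fun u => lq N p (φ u)) 0 := by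
  have me : AnalyticAt ℂ (fun u => p.eval (φ u)) 0 := AnalyticAt.fun_comp (f := φ) (p.differentiable.analyticAt _) h.1
  exact me.meromorphicAt.fun_div (h.1.fun_pow N).meromorphicAt
lemma lq_refl {N : ℕ} {p : Polynomial ℂ} (hp : p.natDegree ≤ 2 * N) {y : ℂ} (hy : y ≠ 0) : lq N p y⁻¹ = lq N (p.reflect (2 * N)) y := by
  let _ := invertibleOfNonzero hy
  let _ := invertibleOfNonzero (inv_ne_zero hy)
  have h := Polynomial.eval₂_reflect_mul_pow (RingHom.id ℂ) y⁻¹ (2 * N) p hp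
  rw [invOf_eq_inv, inv_inv, ← Polynomial.eval, ← Polynomial.eval] at h
  rw [lq, lq, ← h, inv_pow, inv_pow, two_mul, pow_add]
  field_simp
lemma comb {n : ℕ} (s : Finset (Fin n → ℂ)) (hs : ∀ c ∈ s, c ≠ 0) : ∃ μ : Fin n → ℂ, ∀ c ∈ s, ∑ i, μ i * c i ≠ 0 := by
  let p : (Fin n → ℂ) → Polynomial ℂ := fun c => ∑ i : Fin n, Polynomial.C (c i) * Polynomial.X ^ (i:ℕ)
  have hp : ∀ c ∈ s, p c ≠ 0 := by
    intro c hc h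
    apply hs c hc
    ext i
    have := congrArg (fun q => Polynomial.coeff q i) h
    simp only [p, Polynomial.finsetSum_coeff, Polynomial.coeff_C_mul_X_pow, Polynomial.coeff_zero] at this
    rw [Finset.sum_eq_single i] at this
    · simpa using this
    · intro j _ hj; rw [if_neg]; intro h; apply hj; ext; omega
    · simp
  obtain ⟨l, hl⟩ : ∃ l, (∏ c ∈ s, p c).eval l ≠ 0 := by
    by_contra! h
    exact prod_ne_zero_iff.2 hp (Polynomial.funext fun x => by simp [h x])
  rw [Polynomial.eval_prod, prod_ne_zero_iff] at hl
  refine ⟨fun i => l ^ (i:ℕ), fun c hc => ?_⟩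
  have := hl c hc
  simp only [p, Polynomial.eval_finsetSum, eval_mul, eval_C, eval_pow, eval_X] at this
  simpa only [mul_comm] using this
end

section
def evl {n : ℕ} (N : ℕ) (pA : Fin n → Polynomial ℂ) (P : MvPolynomial (Fin n) ℂ) (z : ℂ) : ℂ := MvPolynomial.eval (fun i => lq N (pA i) z) P
lemma evl_diff {n : ℕ} (N : ℕ) (pA : Fin n → Polynomial ℂ) (P : MvPolynomial (Fin n) ℂ) : DifferentiableOn ℂ (evl N pA P) {0}ᶜ := by
  unfold evl
  simp only [MvPolynomial.eval_eq]
  have h := fun i => lq_diff N (pA i)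
  fun_prop
def CMom {n : ℕ} (N : ℕ) (pA pB : Fin n → Polynomial ℂ) : Prop := ∀ P : Fin n → MvPolynomial (Fin n) ℂ,
  ∮ z in C(0, 1), ∑ i, evl N pA (P i) z * deriv (lq N (pA i)) z = ∮ z in C(0, 1), ∑ i, evl N pB (P i) z * deriv (lq N (pB i)) z
def cmb {n : ℕ} (μ : Fin n → ℂ) (p : Fin n → Polynomial ℂ) : Polynomial ℂ := ∑ i, Polynomial.C (μ i) * p i
lemma cmb_coeff {n : ℕ} (μ : Fin n → ℂ) (p : Fin n → Polynomial ℂ) (k : ℕ) : (cmb μ p).coeff k = ∑ i, μ i * (p i).coeff k := by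
  simp [cmb, Polynomial.finsetSum_coeff]
lemma lq_cmb {n : ℕ} (N : ℕ) (μ : Fin n → ℂ) (p : Fin n → Polynomial ℂ) (z : ℂ) : lq N (cmb μ p) z = ∑ i, μ i * lq N (p i) z := by
  simp only [lq, cmb, Polynomial.eval_finsetSum, Finset.sum_div, eval_mul, eval_C, mul_div_assoc]
lemma lq_cmb_deriv {n : ℕ} (N : ℕ) (μ : Fin n → ℂ) (p : Fin n → Polynomial ℂ) {z : ℂ} (hz : z ≠ 0) : deriv (lq N (cmb μ p)) z = ∑ i, μ i * deriv (lq N (p i)) z := by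
  have : lq N (cmb μ p) = fun z => ∑ i, μ i * lq N (p i) z := funext (lq_cmb N μ p)
  rw [this]
  exact (HasDerivAt.fun_sum fun i _ => (((lq_diff N (p i)).differentiableAt (compl0 hz)).hasDerivAt.const_mul (μ i))).deriv
lemma mom_cmb {n : ℕ} {N : ℕ} {pA pB : Fin n → Polynomial ℂ} (h : CMom N pA pB) (μ : Fin n → ℂ) (P : MvPolynomial (Fin n) ℂ) (m k : ℕ) :
    ∮ z in C(0, 1), evl N pA P z ^ m * deriv (lq N (cmb μ pA)) z * lq N (cmb μ pA) z ^ k = ∮ z in C(0, 1), evl N pB P z ^ m * deriv (lq N (cmb μ pB)) z * lq N (cmb μ pB) z ^ k := by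
  have key : ∀ p : Fin n → Polynomial ℂ, ∮ z in C(0, 1), evl N p P z ^ m * deriv (lq N (cmb μ p)) z * lq N (cmb μ p) z ^ k =
      ∮ z in C(0, 1), ∑ i, evl N p (MvPolynomial.C (μ i) * (P ^ m * (∑ j, MvPolynomial.C (μ j) * MvPolynomial.X j) ^ k)) z * deriv (lq N (p i)) z := by
    intro p
    refine circleIntegral.integral_congr zero_le_one fun z hz => ?_
    have hz0 : z ≠ 0 := by rintro rfl; simp at hz
    simp only [lq_cmb_deriv N μ p hz0, lq_cmb, evl, map_mul, map_pow, map_sum, MvPolynomial.eval_C, MvPolynomial.eval_X, mul_sum, sum_mul]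
    refine sum_congr rfl fun i _ => by ring
  rw [key, key]
  exact h _
lemma T0b {n : ℕ} {N : ℕ} {pA pB : Fin n → Polynomial ℂ} (hd : ∀ i, (pB i).natDegree ≤ 2 * N) (hmom : CMom N pA pB)
    (hA : ∃ i, ∃ k < N, (pA i).coeff k ≠ 0) (hB : ∃ i, ∃ k < N, (pB i).coeff k ≠ 0) (hB' : ∃ i, ∃ k < N, ((pB i).reflect (2 * N)).coeff k ≠ 0) :
    ∃ φ ψ, ZZ φ ∧ ZZ ψ ∧ ((∀ᶠ u in 𝓝[≠] 0, ∀ i, lq N (pB i) (φ u) = lq N (pB i) (ψ u)⁻¹) ∨ (∀ᶠ u in 𝓝[≠] 0, ∀ i, lq N (pB i) (φ u) = lq N (pA i) (ψ u))) := by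
  classical
  let pR : Fin n → Polynomial ℂ := fun i => (pB i).reflect (2 * N)
  obtain ⟨iA, kA, hkA, hcA⟩ := hA
  obtain ⟨iB, kB, hkB, hcB⟩ := hB
  obtain ⟨iR, kR, hkR, hcR⟩ := hB'
  obtain ⟨μ, hμ⟩ := comb ({fun i => (pA i).coeff kA, fun i => (pB i).coeff kB, fun i => (pR i).coeff kR} : Finset (Fin n → ℂ)) (by
    intro c hc h
    simp only [Finset.mem_insert, Finset.mem_singleton] at hc
    rcases hc with rfl | rfl | rfl
    · exact hcA (congrFun h iA)
    · exact hcB (congrFun h iB)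
    · exact hcR (congrFun h iR))
  simp only [Finset.mem_insert, Finset.mem_singleton, forall_eq_or_imp, forall_eq, ← cmb_coeff] at hμ
  obtain ⟨hμA, hμB, hμR⟩ := hμ
  replace hμA : ∃ k < N, (cmb μ pA).coeff k ≠ 0 := ⟨kA, hkA, hμA⟩
  replace hμB : ∃ k < N, (cmb μ pB).coeff k ≠ 0 := ⟨kB, hkB, hμB⟩
  replace hμR : ∃ k < N, (cmb μ pR).coeff k ≠ 0 := ⟨kR, hkR, hμR⟩
  clear hkA hcA hkB hcB hkR hcR kA kB kR iA iB iR
  obtain ⟨a, φA, ha, ad, du, z3, rA, hrA, hRA⟩ := ROOTS hμA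
  obtain ⟨b, φB, hb, y1, y2, y3, rB, hrB, hRB⟩ := ROOTS hμB
  obtain ⟨c, φC, hc, mi, mo, x3, rC, hrC, hRC⟩ := ROOTS hμR
  have ZA : ZZ φA := ⟨ad, du, z3⟩
  have ZB : ZZ φB := ⟨y1, y2, y3⟩
  have ZC : ZZ φC := ⟨mi, mo, x3⟩
  obtain ⟨RA, hRA0, GA⟩ := GJ_of hμA ha hrA hRA
  obtain ⟨RB, hRB0, GB⟩ := GJ_of hμB hb hrB hRB
  set R := max RA RB
  replace GA := GA R (le_max_left _ _)
  replace GB := GB R (le_max_right _ _)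
  let S : ℕ → Type := fun k => {ζ : ℂ // ζ ∈ Polynomial.nthRootsFinset k (1:ℂ)}
  have hbc : 0 < a * c := by positivity
  have hac : 0 < b * c := by positivity
  have hab : 0 < a * b := by positivity
  let fB : S b → ℂ → ℂ := fun ζ u => φB (ζ.1 * u ^ (a * c))
  let fC : ℂ → ℂ := fun u => φC (1 * u ^ (a * b))
  let fA : S a → ℂ → ℂ := fun ζ u => φA (ζ.1 * u ^ (b * c))
  have hS : ∀ {k : ℕ}, 0 < k → ∀ ζ : S k, ζ.1 ^ k = 1 := fun hk ζ => (Polynomial.mem_nthRootsFinset hk _).1 ζ.2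
  have hS0 : ∀ {k : ℕ}, 0 < k → ∀ ζ : S k, ζ.1 ≠ 0 := fun hk ζ h => by
    have := hS hk ζ; rw [h, zero_pow hk.ne'] at this; exact zero_ne_one this
  have zB : ∀ ζ, ZZ (fB ζ) := fun ζ => ZB.comp (hS0 hb ζ) hbc
  have zA : ∀ ζ, ZZ (fA ζ) := fun ζ => ZA.comp (hS0 ha ζ) hac
  have zC : ZZ fC := ZC.comp one_ne_zero hab
  have small : ∀ {α : ℕ}, 0 < α → ∀ {r : ℝ}, 0 < r → ∀ᶠ u : ℂ in 𝓝[≠] 0, u ^ α ≠ 0 ∧ ‖u ^ α‖ < r := by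
    intro α hα r hr
    have h := pow_tend one_ne_zero hα
    simp only [one_mul] at h
    have me : ∀ᶠ s : ℂ in 𝓝[≠] 0, s ≠ 0 ∧ ‖s‖ < r := by
      filter_upwards [self_mem_nhdsWithin, mem_nhdsWithin_of_mem_nhds (ball_mem_nhds (0:ℂ) hr)] with s me we using ⟨me, by simpa using we⟩
    exact h.eventually me
  have hbig : ∀ᶠ u : ℂ in 𝓝[≠] 0, R < ‖(u ^ (a * b * c))⁻¹‖ := by
    have hR0 : 0 < R := lt_max_of_lt_left hRA0
    filter_upwards [small (α := a * b * c) (by positivity) (inv_pos.2 hR0)] with u hu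
    rw [norm_inv]
    exact lt_inv_of_lt_inv₀ (norm_pos_iff.2 hu.1) hu.2
  let F : Option (S a) → ℂ → Fin n → ℂ := fun o u i => o.elim (lq N (pR i) (fC u)) fun ζ => lq N (pA i) (fA ζ u)
  have point : ∀ᶠ u : ℂ in 𝓝[≠] 0, ∃ ι : S b × Option (S a), ∀ i, lq N (pB i) (fB ι.1 u) = F ι.2 u i := by
    filter_upwards [hbig, small hbc hrB, small hac hrA, small hab hrC] with u hu uB uA uC
    have hR1 := hRB _ uB.1 uB.2
    have hR2 := hRA _ uA.1 uA.2
    have hR3 := hRC _ uC.1 uC.2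
    set w := (u ^ (a * b * c))⁻¹ with hw
    have no : ((u ^ (a * c)) ^ b)⁻¹ = w := by rw [← pow_mul, hw]; ring_nf
    have es : ((u ^ (b * c)) ^ a)⁻¹ = w := by rw [← pow_mul, hw]; ring_nf
    have w3 : ((u ^ (a * b)) ^ c)⁻¹ = w := by rw [← pow_mul, hw]
    rw [no] at hR1
    rw [es] at hR2
    rw [w3] at hR3
    obtain ⟨c1, c2, c3⟩ := (hR3.1 (fC u)).2 ⟨1, one_pow _, rfl⟩
    have c4 := (hR3.2.1 1 (one_pow _)).1
    have hrefl : ∀ i, lq N (pB i) (fC u)⁻¹ = lq N (pR i) (fC u) := fun i => lq_refl (hd i) c1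
    have hz1 : 1 < ‖(fC u)⁻¹‖ := by rw [norm_inv]; exact (one_lt_inv₀ (norm_pos_iff.2 c1)).2 c4
    have hw1 : lq N (cmb μ pB) (fC u)⁻¹ = w := by
      rw [lq_cmb, ← c3, lq_cmb]
      simp only [hrefl]
    obtain ⟨P, hP0, hPs⟩ := sep (ι := Option ({z // z ∈ JJ b φB w} ⊕ {z // z ∈ JJ a φA w}))
      fun o i => o.elim (lq N (pR i) (fC u)) (Sum.elim (fun z => lq N (pB i) z) fun z => lq N (pA i) z)
    have T := T0a (evl_diff N pA P) (evl_diff N pB P) (mom_cmb hmom μ P) GA GB hb hz1 (by rw [hw1]; exact hu) (by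
      rw [hw1]; intro z hz
      exact hP0 (some (Sum.inl ⟨z, hz⟩)))
    rw [hw1] at T
    have getB : ∀ z ∈ JJ b φB w, ∃ ζ : S b, z = fB ζ u := by
      intro z hz
      obtain ⟨ζ, me, we⟩ := (hR1.1 z).1 ((GB.mem w hu z).1 hz)
      exact ⟨⟨ζ, (Polynomial.mem_nthRootsFinset hb _).2 me⟩, we⟩
    have getA : ∀ z ∈ JJ a φA w, ∃ ζ : S a, z = fA ζ u := by
      intro z hz
      obtain ⟨ζ, me, we⟩ := (hR2.1 z).1 ((GA.mem w hu z).1 hz)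
      exact ⟨⟨ζ, (Polynomial.mem_nthRootsFinset ha _).2 me⟩, we⟩
    rcases T with ⟨z, hz, h⟩ | ⟨z, hz, z', hz', h⟩
    · obtain ⟨ζ, rfl⟩ := getB z hz
      refine ⟨(ζ, none), fun i => ?_⟩
      have := hPs (some (Sum.inl ⟨_, hz⟩)) none (by
        simp only [evl, hrefl] at h
        exact h)
      exact congrFun this i
    · obtain ⟨ζ, rfl⟩ := getB z hz
      obtain ⟨ζ', rfl⟩ := getA z' hz'
      refine ⟨(ζ, some ζ'), fun i => ?_⟩
      have := hPs (some (Sum.inl ⟨_, hz⟩)) (some (Sum.inr ⟨_, hz'⟩)) h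
      exact congrFun this i
  obtain ⟨⟨ζ, o⟩, hι⟩ : ∃ ι : S b × Option (S a), ∃ᶠ u in 𝓝[≠] (0:ℂ), ∀ i, lq N (pB i) (fB ι.1 u) = F ι.2 u i := by
    by_contra hcon
    rw [not_exists] at hcon
    have : ∀ᶠ s in 𝓝[≠] (0:ℂ), False := by
      have me := eventually_all.2 fun i => not_frequently.1 (hcon i)
      filter_upwards [me, point] with s me ⟨i, hi⟩
      exact me i hi
    exact this.exists.elim fun _ h => h
  have hfin : ∀ᶠ u in 𝓝[≠] (0:ℂ), ∀ i, lq N (pB i) (fB ζ u) = F o u i := by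
    refine eventually_all.2 fun i => ?_
    have hm : MeromorphicAt (fun u => F o u i) 0 := by
      rcases o with _ | ζ'
      · exact zC.mero N (pR i)
      · exact (zA ζ').mero N (pA i)
    exact ((zB ζ).mero N (pB i)).frequently_eq_iff_eventuallyEq hm |>.1 (hι.mono fun u h => h i)
  rcases o with _ | ζ'
  · refine ⟨fB ζ, fC, zB ζ, zC, Or.inl ?_⟩
    filter_upwards [hfin, zC.ne] with u me we i
    rw [lq_refl (hd i) we]; exact me i
  · exact ⟨fB ζ, fA ζ', zB ζ, zA ζ', Or.inr hfin⟩
end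

section
attribute [local instance] Matrix.linftyOpNormedRing Matrix.linftyOpNormedAlgebra
def kap (T : ℝ) : ℂ := 2 * Real.pi * I / T
lemma kap_ne {T : ℝ} (hT : 0 < T) : kap T ≠ 0 := div_ne_zero pi2_ne (by exact_mod_cast hT.ne')
lemma kap_T {T : ℝ} (hT : 0 < T) : kap T * T = 2 * Real.pi * I := div_mul_cancel₀ _ (by exact_mod_cast hT.ne')
lemma kap_per {T : ℝ} (hT : 0 < T) (x : ℂ) : exp (kap T * (x + T)) = exp (kap T * x) := by
  rw [mul_add, kap_T hT, exp_periodic]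
lemma LIFT {T : ℝ} (hT : 0 < T) {φ : ℂ → ℂ} (h : ZZ φ) : ∃ l : ℕ, 0 < l ∧ ∃ r > 0, ∃ x : ℂ → ℂ, DifferentiableOn ℂ x {v | v.re < Real.log r} ∧
    ∀ v : ℂ, v.re < Real.log r → exp (kap T * x v) = φ (exp v) ∧ x (v + 2 * Real.pi * I) = x v + l * T := by
  obtain ⟨l, L, hL, he, my⟩ := LOG h.1 h.2.2
  obtain ⟨r, hr, hb⟩ := eventually_nhds_iff_ball.1 (hL.eventually_analyticAt.and he)
  have hex : ∀ v : ℂ, v.re < Real.log r → exp v ∈ ball (0:ℂ) r := fun v hv => by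
    rw [mem_ball_zero_iff, norm_exp]; exact (lt_log_iff_exp_lt hr).1 hv
  have hT0 : (T:ℂ) ≠ 0 := by exact_mod_cast hT.ne'
  refine ⟨l, Nat.pos_of_ne_zero fun hl => my.1 hl h.2.1, r, hr, fun v => (kap T)⁻¹ * (l * v + L (exp v)), ?_, fun v hv => ⟨?_, ?_⟩⟩
  · intro v hv
    have me : DifferentiableAt ℂ (fun v => L (exp v)) v := DifferentiableAt.fun_comp' v (hb _ (hex v hv)).1.differentiableAt differentiable_exp.differentiableAt
    exact (((differentiableAt_id.const_mul (l:ℂ)).add me).const_mul _).differentiableWithinAt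
  · rw [mul_inv_cancel_left₀ (kap_ne hT), exp_add, (hb _ (hex v hv)).2, sub_zero, exp_nat_mul]
  · have e : exp (v + 2 * Real.pi * I) = exp v := exp_periodic v
    simp only [e]
    have ok : (T:ℂ) = (kap T)⁻¹ * (2 * Real.pi * I) := by rw [← kap_T hT, inv_mul_cancel_left₀ (kap_ne hT)]
    rw [ok]; ring
section
variable {n K : ℕ} {P : Fin n → Fin K → Fin K → MvPolynomial (Fin n) ℂ} {A B : Fin n → ℂ → ℂ} {WA WB : ℂ → MK K}
lemma mono1 (hA : ∀ i, Differentiable ℂ (A i)) (hWA : IsW (Om P A) WA) {T : ℝ} (hp : ∀ x i, A i (x + T) = A i x) (x : ℂ) (l : ℕ) : WA (x + l * T) = WA x * WA T ^ l := by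
  obtain ⟨C, -, hC⟩ := TR hA hA hWA hWA isOpen_univ isPreconnected_univ (x := fun x => x + T) (y := fun x => x) (differentiable_id.add_const _).differentiableOn differentiable_id.differentiableOn (fun s _ i => hp s i)
  have me := hC 0 (mem_univ _)
  rw [hWA.z, one_mul, zero_add] at me
  induction l with
  | zero => simp
  | succ l ih =>
    rw [show x + ((l+1 : ℕ):ℂ) * T = (x + l * T) + T by push_cast; ring, hC _ (mem_univ _), ih, ← me, pow_succ, mul_assoc]
lemma T0 {T : ℝ} (hT : 0 < T) (hA : ∀ i, Differentiable ℂ (A i)) (hB : ∀ i, Differentiable ℂ (B i)) (hWA : IsW (Om P A) WA) (hWB : IsW (Om P B) WB)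
    {N : ℕ} {pA pB : Fin n → Polynomial ℂ} (eA : ∀ i x, A i x = lq N (pA i) (exp (kap T * x))) (eB : ∀ i x, B i x = lq N (pB i) (exp (kap T * x)))
    (hd : ∀ i, (pB i).natDegree ≤ 2 * N) (hmom : CMom N pA pB)
    (me : ∃ i, ∃ k < N, (pA i).coeff k ≠ 0) (we : ∃ i, ∃ k < N, (pB i).coeff k ≠ 0) (us : ∃ i, ∃ k < N, ((pB i).reflect (2 * N)).coeff k ≠ 0) (hW : WA T = 1) : WB T = 1 := by
  obtain ⟨φ, ψ, hφ, hψ, hor⟩ := T0b hd hmom me we us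
  obtain ⟨l, hl, r1, hr1, x, hx, hx1⟩ := LIFT hT hφ
  obtain ⟨m, hm, r2, hr2, y, hy, hy1⟩ := LIFT hT hψ
  have perA : ∀ x i, A i (x + T) = A i x := fun x i => by rw [eA, eA, kap_per hT]
  have perB : ∀ x i, B i (x + T) = B i x := fun x i => by rw [eB, eB, kap_per hT]
  have hS : ∀ {r : ℝ}, 0 < r → r ≤ r1 → r ≤ r2 → ∃ S : Set ℂ, IsOpen S ∧ IsPreconnected S ∧ (∀ v ∈ S, exp v ≠ 0 ∧ ‖exp v‖ < r ∧ v + 2 * Real.pi * I ∈ S) ∧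
      (∀ v ∈ S, v.re < Real.log r1 ∧ v.re < Real.log r2) ∧ S.Nonempty := by
    intro r hr me we
    refine ⟨{v | v.re < Real.log r}, isOpen_lt continuous_re continuous_const, (convex_halfSpace_re_lt _).isPreconnected, fun v hv => ⟨exp_ne_zero v, ?_, ?_⟩, fun v hv => ⟨?_, ?_⟩, ⟨((Real.log r - 1 : ℝ) : ℂ), ?_⟩⟩
    · rw [norm_exp]; exact (lt_log_iff_exp_lt hr).1 hv
    · have : v.re < Real.log r := hv
      simpa using this
    · exact lt_of_lt_of_le hv (Real.log_le_log hr me)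
    · exact lt_of_lt_of_le hv (Real.log_le_log hr we)
    · show ((Real.log r - 1 : ℝ) : ℂ).re < Real.log r
      rw [ofReal_re]; linarith
  rcases hor with h | h
  · rw [eventually_nhdsWithin_iff, eventually_nhds_iff_ball] at h
    obtain ⟨r, hr, hb⟩ := h
    obtain ⟨S, So, Sc, S1, S2, ⟨v, hv⟩⟩ := hS (r := min r (min r1 r2)) (by positivity) ((min_le_right _ _).trans (min_le_left _ _)) ((min_le_right _ _).trans (min_le_right _ _))
    obtain ⟨C, hC, hCC⟩ := TR hB hB hWB hWB So Sc (x := x) (y := fun v => - y v) (hx.mono fun v hv => (S2 v hv).1) (hy.mono fun v hv => (S2 v hv).2).neg fun s hs i => by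
      rw [eB, eB, mul_neg, exp_neg, (hx1 s (S2 s hs).1).1, (hy1 s (S2 s hs).2).1]
      exact hb _ (by rw [mem_ball_zero_iff]; exact (S1 s hs).2.1.trans_le (min_le_left _ _)) (S1 s hs).1 i
    have am := hCC _ hv
    have ok := hCC _ (S1 v hv).2.2
    rw [(hx1 v (S2 v hv).1).2, (hy1 v (S2 v hv).2).2, mono1 hB hWB perB, am] at ok
    have de := mono1 hB hWB perB (-(y v + m * T)) m
    rw [show -(y v + m * T) + m * T = - y v by ring] at de
    rw [de] at ok
    refine unip (a := l) (b := m) (hWB.u _) hC (by omega) ((UT.isUnit (hWB.u (-(y v + m * T)))).mul_left_cancel ?_)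
    rw [← ok]; simp only [mul_assoc]
  · rw [eventually_nhdsWithin_iff, eventually_nhds_iff_ball] at h
    obtain ⟨r, hr, hb⟩ := h
    obtain ⟨S, So, Sc, S1, S2, ⟨v, hv⟩⟩ := hS (r := min r (min r1 r2)) (by positivity) ((min_le_right _ _).trans (min_le_left _ _)) ((min_le_right _ _).trans (min_le_right _ _))
    obtain ⟨C, hC, hCC⟩ := TR hB hA hWB hWA So Sc (x := x) (y := y) (hx.mono fun v hv => (S2 v hv).1) (hy.mono fun v hv => (S2 v hv).2) fun s hs i => by
      rw [eB, eA, (hx1 s (S2 s hs).1).1, (hy1 s (S2 s hs).2).1]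
      exact hb _ (by rw [mem_ball_zero_iff]; exact (S1 s hs).2.1.trans_le (min_le_left _ _)) (S1 s hs).1 i
    have am := hCC _ hv
    have ok := hCC _ (S1 v hv).2.2
    rw [(hx1 v (S2 v hv).1).2, (hy1 v (S2 v hv).2).2, mono1 hB hWB perB, mono1 hA hWA perA, hW, one_pow, mul_one, ← am] at ok
    exact unip_pow (hWB.u _) hl ((UT.isUnit (hWB.u (x v))).mul_left_cancel (by rw [ok, mul_one]))
end
end

section
attribute [local instance] Matrix.linftyOpNormedRing Matrix.linftyOpNormedAlgebra
section
variable {n K : ℕ} {P : Fin n → Fin K → Fin K → MvPolynomial (Fin n) ℂ} {A B : Fin n → ℂ → ℂ} {WA WB : ℂ → MK K}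
def Triv (T : ℝ) (A : Fin n → ℂ → ℂ) : Prop := ∀ (K : ℕ) (P : Fin n → Fin K → Fin K → MvPolynomial (Fin n) ℂ), TP P → ∀ W, IsW (Om P A) W → W T = 1
lemma triv_pull {T : ℝ} (hA : ∀ i, Differentiable ℂ (A i)) (hB : ∀ i, Differentiable ℂ (B i)) {h : ℂ → ℂ} (hh : Differentiable ℂ h) (my : h 0 = 0) (me : h T = 0)
    (hAB : ∀ x i, A i x = B i (h x)) : Triv T A := by
  intro K P hP W hW
  obtain ⟨WB, hWB⟩ := exists_W (Om_diff P hB) (Om_UT hP B)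
  rw [pullback hA hB hW hWB hh my hAB T, me, hWB.z]
lemma triv_mom {T : ℝ} (hA : ∀ i, Differentiable ℂ (A i)) (h : Triv T A) (Q : MvPolynomial (Fin n) ℂ) (i : Fin n) : ∫ x in (0:ℝ)..T, ev Q A x * deriv (A i) x = 0 := by
  let P : Fin n → Fin 2 → Fin 2 → MvPolynomial (Fin n) ℂ := fun j a b => if j = i ∧ a = 0 ∧ b = 1 then Q else 0
  have hP : TP P := by
    intro j a b hab
    simp only [P]
    rw [if_neg]
    rintro ⟨-, rfl, rfl⟩
    simp at hab
  obtain ⟨W, hW⟩ := exists_W (Om_diff P hA) (Om_UT hP A)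
  have me := h 2 P hP W hW
  have hW11 : ∀ x, W x 1 1 = 1 := fun x => by
    have := hW.u x 1 1 (by simp)
    simpa [sub_eq_zero] using this
  have hd : ∀ x, HasDerivAt (fun x => W x 0 1) (ev Q A x * deriv (A i) x) x := by
    intro x
    refine (entry_deriv (hW.d x) 0 1).congr_deriv ?_
    simp only [Matrix.mul_apply, Fin.sum_univ_two, hW11, Om, P]
    simp [ev, apply_ite, mul_comm]
  have hc : Continuous fun x : ℝ => ev Q A x * deriv (A i) x :=
    ((ev_diff Q hA).continuous.mul (deriv_ent (hA i)).continuous).comp continuous_ofReal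
  rw [intervalIntegral.integral_eq_sub_of_hasDerivAt (fun x _ => (hd x).comp_ofReal) (hc.intervalIntegrable _ _), ofReal_zero, hW.z, me, sub_self]
lemma exists_unlq {N : ℕ} {p : Polynomial ℂ} (h : ¬ ∃ k < N, p.coeff k ≠ 0) : ∃ go : Polynomial ℂ, ∀ z, z ≠ 0 → lq N p z = go.eval z := by
  push Not at h
  obtain ⟨go, rfl⟩ := Polynomial.X_pow_dvd_iff.2 h
  refine ⟨go, fun z hz => ?_⟩
  simp only [lq, eval_mul, eval_pow, eval_X]
  field_simp
lemma triv_nopole {T : ℝ} (hT : 0 < T) (hA : ∀ i, Differentiable ℂ (A i)) {N : ℕ} {pA : Fin n → Polynomial ℂ} (σ : ℂ) (hσ : σ = 1 ∨ σ = -1) (eA : ∀ i x, A i x = lq N (pA i) (exp (σ * kap T * x)))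
    (h : ¬ ∃ i, ∃ k < N, (pA i).coeff k ≠ 0) : Triv T A := by
  rw [not_exists] at h
  choose go hp' using fun i => exists_unlq (h i)
  refine triv_pull (B := fun i y => (go i).eval (y + 1)) hA (fun i => (go i).differentiable.comp (differentiable_id.add_const 1)) (h := fun x => exp (σ * kap T * x) - 1) (by fun_prop) (by simp) ?_ fun x i => ?_
  · rw [mul_assoc, kap_T hT]
    rcases hσ with rfl | rfl
    · simp
    · simp [exp_neg]
  · rw [eA, hp' _ _ (exp_ne_zero _), sub_add_cancel]
lemma circ_mom {T : ℝ} (hT : 0 < T) (hA : ∀ i, Differentiable ℂ (A i)) {N : ℕ} {pA : Fin n → Polynomial ℂ} (eA : ∀ i x, A i x = lq N (pA i) (exp (kap T * x)))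
    (P : Fin n → MvPolynomial (Fin n) ℂ) : ∮ z in C(0, 1), ∑ i, evl N pA (P i) z * deriv (lq N (pA i)) z = ∑ i, ∫ x in (0:ℝ)..T, ev (P i) A x * deriv (A i) x := by
  rw [← intervalIntegral.integral_finsetSum]
  · have hT0 : T ≠ 0 := hT.ne'
    have hT0' : (T:ℂ) ≠ 0 := by exact_mod_cast hT.ne'
    unfold circleIntegral
    have h := intervalIntegral.integral_comp_mul_left (a := 0) (b := T) (fun θ => deriv (circleMap 0 1) θ • ∑ i, evl N pA (P i) (circleMap 0 1 θ) * deriv (lq N (pA i)) (circleMap 0 1 θ)) (c := 2 * Real.pi / T) (by positivity)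
    rw [mul_zero, div_mul_cancel₀ _ hT0] at h
    have we := congrArg (fun y => ((2 * Real.pi / T : ℝ)) • y) h
    rw [smul_inv_smul₀ (by positivity)] at we
    rw [← we, ← intervalIntegral.integral_smul]
    refine intervalIntegral.integral_congr fun x _ => ?_
    have hz : circleMap 0 1 (2 * Real.pi / T * x) = exp (kap T * x) := by
      simp only [circleMap, kap]; push_cast; rw [zero_add, one_mul]; congr 1; ring
    simp only [deriv_circleMap, hz]
    have hd : ∀ i, deriv (A i) x = deriv (lq N (pA i)) (exp (kap T * x)) * (exp (kap T * x) * kap T) := by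
      intro i
      have e : A i = fun x => lq N (pA i) (exp (kap T * x)) := funext (eA i)
      rw [e]
      have d1 := ((lq_diff N (pA i)).differentiableAt (compl0 (exp_ne_zero (kap T * x)))).hasDerivAt
      have d2 : HasDerivAt (fun x : ℂ => exp (kap T * x)) (exp (kap T * x) * kap T) x := by
        simpa using ((hasDerivAt_id (x:ℂ)).const_mul (kap T)).cexp
      exact (d1.comp (x:ℂ) d2).deriv
    have hev : ∀ i, ev (P i) A x = evl N pA (P i) (exp (kap T * x)) := fun i => by simp only [ev, evl, eA]
    simp only [hd, hev, smul_eq_mul, real_smul, mul_sum]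
    refine sum_congr rfl fun i _ => ?_
    simp only [kap]; push_cast; ring
  · intro i _
    exact (((ev_diff (P i) hA).continuous.mul (deriv_ent (hA i)).continuous).comp continuous_ofReal).intervalIntegrable _ _
lemma TRIG {T : ℝ} (hT : 0 < T) (hA : ∀ i, Differentiable ℂ (A i)) (hB : ∀ i, Differentiable ℂ (B i)) (hP : TP P) (hWA : IsW (Om P A) WA) (hWB : IsW (Om P B) WB)
    {N : ℕ} {pA pB : Fin n → Polynomial ℂ} (eA : ∀ i x, A i x = lq N (pA i) (exp (kap T * x))) (eB : ∀ i x, B i x = lq N (pB i) (exp (kap T * x)))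
    (hd : ∀ i, (pB i).natDegree ≤ 2 * N) (hmom : MomEq T A B) (hW : WA T = 1) : WB T = 1 := by
  by_cases we : ∃ i, ∃ k < N, (pB i).coeff k ≠ 0
  swap
  · exact triv_nopole hT hB 1 (Or.inl rfl) (by simpa using eB) we K P hP WB hWB
  by_cases us : ∃ i, ∃ k < N, ((pB i).reflect (2 * N)).coeff k ≠ 0
  swap
  · refine triv_nopole hT hB (-1) (Or.inr rfl) (fun i x => ?_) us K P hP WB hWB
    rw [eB, ← lq_refl (hd i) (exp_ne_zero _), ← exp_neg]
    congr 2; ring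
  by_cases me : ∃ i, ∃ k < N, (pA i).coeff k ≠ 0
  · refine T0 hT hA hB hWA hWB eA eB hd (fun Q => ?_) me we us hW
    rw [circ_mom hT hA eA, circ_mom hT hB eB]
    exact sum_congr rfl fun i _ => hmom _ i
  · have tA : Triv T A := triv_nopole hT hA 1 (Or.inl rfl) (by simpa using eA) me
    obtain ⟨i, k, hk, hk2⟩ := we
    let A' : Fin n → ℂ → ℂ := fun _ x => exp (- kap T * x) - 1
    have hA' : ∀ i, Differentiable ℂ (A' i) := fun i => by simp only [A']; fun_prop
    have tA' : Triv T A' := triv_pull (B := fun _ y => y) hA' (fun _ => differentiable_id) (h := fun x => exp (- kap T * x) - 1) (by fun_prop) (by simp)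
      (by rw [neg_mul, kap_T hT]; simp [exp_neg]) fun x i => rfl
    obtain ⟨W', hW'⟩ := exists_W (Om_diff P hA') (Om_UT hP A')
    have eA' : ∀ i x, A' i x = lq N (Polynomial.X ^ (N - 1) - Polynomial.X ^ N) (exp (kap T * x)) := by
      intro i x
      have my := exp_ne_zero (kap T * x)
      simp only [A', lq, eval_sub, eval_pow, eval_X, neg_mul, exp_neg]
      obtain ⟨M, rfl⟩ : ∃ M, N = M + 1 := ⟨N - 1, by omega⟩
      simp only [Nat.add_sub_cancel]
      field_simp
      ring
    refine T0 hT hA' hB hW' hWB (pA := fun _ => Polynomial.X ^ (N - 1) - Polynomial.X ^ N) eA' eB hd (fun Q => ?_) ⟨i, N - 1, by omega, ?_⟩ ⟨i, k, hk, hk2⟩ us (tA' K P hP _ hW')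
    · rw [circ_mom hT hA' eA', circ_mom hT hB eB]
      refine sum_congr rfl fun i _ => ?_
      rw [triv_mom hA' tA' (Q i) i, ← hmom, triv_mom hA tA]
    · rw [Polynomial.coeff_sub, Polynomial.coeff_X_pow, Polynomial.coeff_X_pow, if_pos rfl, if_neg (by omega)]; simp
end
end

section
lemma dep_two {R : Type} [CommRing R] [IsDomain R] [Algebra ℂ R] {z h f : R} (hh : IsAlgebraic (Algebra.adjoin ℂ {z}) h) (hf : IsAlgebraic (Algebra.adjoin ℂ {z}) f) :
    ¬ AlgebraicIndependent ℂ ![h, f] := by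
  intro hI
  have me := (AlgebraicIndependent.matroid_indep_iff (R := ℂ) (A := R)).2 hI.coe_range
  have we : Set.range ![h, f] ⊆ (AlgebraicIndependent.matroid ℂ R).closure {z} := by
    rw [AlgebraicIndependent.matroid_closure_eq]
    rintro _ ⟨i, rfl⟩
    fin_cases i
    · exact hh
    · exact hf
  have us := me.encard_le_eRk_of_subset we
  rw [Matroid.eRk_closure_eq] at us
  have up := us.trans (Matroid.eRk_le_encard _ _)
  rw [Set.encard_singleton, ← Set.image_univ, hI.injective.encard_image] at up
  simp at up
lemma dep_alg {R : Type} [CommRing R] [IsDomain R] [Algebra ℂ R] {ad no du es h : R} (am : ad * no = 1) (ok : du * es = 1)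
    {p go q q' : Polynomial ℂ} {N k : ℕ} (hk : k ≠ N) (hpk : p.coeff k ≠ 0)
    (hr : Polynomial.aeval ad p * du ^ N = Polynomial.aeval du go * ad ^ N) {c : ℂ} (hc : c ≠ 0)
    (hh : c • h = Polynomial.aeval du q' * es ^ N - Polynomial.aeval ad q * no ^ N) :
    ∃ Q : MvPolynomial (Fin 2) ℂ, Q ≠ 0 ∧ MvPolynomial.aeval ![h, ad * es] Q = 0 := by
  set S := Algebra.adjoin ℂ {du} with hS
  have m2 : du ∈ S := Algebra.subset_adjoin rfl
  let ζ : S := ⟨du, m2⟩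
  have ζv : algebraMap S R ζ = du := rfl
  have hz0 : du ≠ 0 := left_ne_zero_of_mul_eq_one ok
  have hζ0 : ζ ≠ 0 := fun h => hz0 (by rw [← ζv, h, map_zero])
  have hS0 : ∀ y ∈ S, IsAlgebraic S y := fun y hy => isAlgebraic_algebraMap (⟨y, hy⟩ : S)
  have il : IsAlgebraic S du := hS0 _ m2
  have er : IsAlgebraic S ad := by
    refine ⟨p.map (algebraMap ℂ S) * Polynomial.C (ζ ^ N) - Polynomial.C (Polynomial.aeval ζ go) * Polynomial.X ^ N, ?_, ?_⟩
    · intro my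
      have := congrArg (fun P => Polynomial.coeff P k) my
      simp only [Polynomial.coeff_sub, Polynomial.coeff_mul_C, Polynomial.coeff_map, Polynomial.coeff_C_mul, Polynomial.coeff_X_pow, if_neg hk, mul_zero, sub_zero, Polynomial.coeff_zero] at this
      rcases mul_eq_zero.1 this with h | h
      · exact hpk ((map_eq_zero_iff _ (algebraMap ℂ S).injective).1 h)
      · exact pow_ne_zero N hζ0 h
    · simp only [map_sub, map_mul, Polynomial.aeval_C, map_pow, Polynomial.aeval_X, Polynomial.aeval_map_algebraMap, ζv]
      rw [show algebraMap S R (Polynomial.aeval ζ go) = Polynomial.aeval du go by rw [← Polynomial.aeval_algebraMap_apply, ζv], hr, sub_self]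
  let i1 : Invertible ad := ⟨no, by rw [mul_comm, am], am⟩
  let i2 : Invertible du := ⟨es, by rw [mul_comm, ok], ok⟩
  have b1 : IsAlgebraic S no := er.invOf
  have b2 : IsAlgebraic S es := il.invOf
  have key : ∀ (y : R) (q : Polynomial ℂ), IsAlgebraic S y → IsAlgebraic S (Polynomial.aeval y q) := by
    intro y q hy
    induction q using Polynomial.induction_on' with
    | add a b ha hb => rw [map_add]; exact ha.add hb
    | monomial k a => rw [Polynomial.aeval_monomial]; exact (hS0 _ (Subalgebra.algebraMap_mem _ _)).mul (hy.pow _)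
  have ah : IsAlgebraic S h := by
    have : h = algebraMap ℂ R c⁻¹ * (Polynomial.aeval du q' * es ^ N - Polynomial.aeval ad q * no ^ N) := by
      rw [← hh, ← Algebra.smul_def, smul_smul, inv_mul_cancel₀ hc, one_smul]
    rw [this]
    exact (hS0 _ (Subalgebra.algebraMap_mem _ _)).mul (((key _ _ il).mul (b2.pow _)).sub ((key _ _ er).mul (b1.pow _)))
  have := dep_two ah (er.mul b2)
  rw [algebraicIndependent_iff] at this
  push Not at this
  obtain ⟨Q, me, we⟩ := this
  exact ⟨Q, we, me⟩
def AnR (U : Set ℂ) : Subalgebra ℂ (U → ℂ) where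
  carrier := {f | ∃ g : ℂ → ℂ, AnalyticOnNhd ℂ g U ∧ ∀ u : U, f u = g u}
  mul_mem' := by
    rintro a b ⟨f, hf, me⟩ ⟨g, hg, we⟩
    exact ⟨fun u => f u * g u, hf.mul hg, fun u => by simp [me, we]⟩
  add_mem' := by
    rintro a b ⟨f, hf, me⟩ ⟨g, hg, we⟩
    exact ⟨fun u => f u + g u, hf.add hg, fun u => by simp [me, we]⟩
  algebraMap_mem' := fun c => ⟨fun _ => c, analyticOnNhd_const, fun u => rfl⟩
lemma AnR_dom {U : Set ℂ} (hU : IsPreconnected U) (hne : U.Nonempty) : IsDomain (AnR U) := by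
  obtain ⟨u0, hu0⟩ := hne
  have : Nontrivial (AnR U) := ⟨0, 1, fun h => by
    have := congrArg (fun f : AnR U => (f : U → ℂ) ⟨u0, hu0⟩) h
    simp at this⟩
  have : NoZeroDivisors (AnR U) := ⟨by
    rintro ⟨a, f, hf, me⟩ ⟨b, g, hg, we⟩ hab
    have us : ∀ u ∈ U, f u * g u = 0 := fun u hu => by
      have := congrArg (fun f : AnR U => (f : U → ℂ) ⟨u, hu⟩) hab
      simpa [me, we] using this
    rcases hf.eq_zero_or_eq_zero_of_mul_eq_zero hg us hU with h | h
    · left; ext u; simp [me, h u u.2]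
    · right; ext u; simp [we, h u u.2]⟩
  exact (isDomain_iff_noZeroDivisors_and_nontrivial _).mpr ⟨inferInstance, inferInstance⟩
lemma dep_fun {U : Set ℂ} (hU : IsPreconnected U) (hne : U.Nonempty) {ad du h : ℂ → ℂ} (hz1 : AnalyticOnNhd ℂ ad U) (hz2 : AnalyticOnNhd ℂ du U) (hh : AnalyticOnNhd ℂ h U)
    (n1 : ∀ u ∈ U, ad u ≠ 0) (n2 : ∀ u ∈ U, du u ≠ 0)
    {p go q q' : Polynomial ℂ} {N k : ℕ} (hk : k ≠ N) (hpk : p.coeff k ≠ 0)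
    (hr : ∀ u ∈ U, lq N p (ad u) = lq N go (du u)) {c : ℂ} (hc : c ≠ 0)
    (hch : ∀ u ∈ U, c * h u = lq N q' (du u) - lq N q (ad u)) :
    ∃ Q : MvPolynomial (Fin 2) ℂ, Q ≠ 0 ∧ ∀ u ∈ U, MvPolynomial.eval ![h u, ad u / du u] Q = 0 := by
  have := AnR_dom hU hne
  let Z1 : AnR U := ⟨fun u => ad u, ad, hz1, fun _ => rfl⟩
  let Z2 : AnR U := ⟨fun u => du u, du, hz2, fun _ => rfl⟩
  let W1 : AnR U := ⟨fun u => (ad u)⁻¹, fun u => (ad u)⁻¹, hz1.fun_inv n1, fun _ => rfl⟩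
  let W2 : AnR U := ⟨fun u => (du u)⁻¹, fun u => (du u)⁻¹, hz2.fun_inv n2, fun _ => rfl⟩
  let H : AnR U := ⟨fun u => h u, h, hh, fun _ => rfl⟩
  let E : U → AnR U →ₐ[ℂ] ℂ := fun u => (Pi.evalAlgHom ℂ (fun _ : U => ℂ) u).comp (AnR U).val
  have ext : ∀ f g : AnR U, (∀ u, E u f = E u g) → f = g := fun f g hfg => Subtype.ext (funext hfg)
  have E1 : ∀ u, E u Z1 = ad u := fun _ => rfl
  have E2 : ∀ u, E u Z2 = du u := fun _ => rfl
  have F1 : ∀ u, E u W1 = (ad u)⁻¹ := fun _ => rfl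
  have F2 : ∀ u, E u W2 = (du u)⁻¹ := fun _ => rfl
  have EH : ∀ u, E u H = h u := fun _ => rfl
  have ea : ∀ u (Z : AnR U) (P : Polynomial ℂ), E u (Polynomial.aeval Z P) = P.eval (E u Z) := by
    intro u Z P
    rw [← Polynomial.aeval_algHom_apply, Polynomial.coe_aeval_eq_eval]
  obtain ⟨Q, hQ, hQ0⟩ := dep_alg (R := AnR U) (ad := Z1) (no := W1) (du := Z2) (es := W2) (h := H) (p := p) (go := go) (q := q) (q' := q') (N := N) (c := c)
    (ext _ _ fun u => by rw [map_mul, E1, F1, map_one, mul_inv_cancel₀ (n1 u u.2)])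
    (ext _ _ fun u => by rw [map_mul, E2, F2, map_one, mul_inv_cancel₀ (n2 u u.2)]) hk hpk
    (ext _ _ fun u => by
      simp only [map_mul, map_pow, ea, E1, E2]
      have := hr u u.2
      have m1 := n1 u u.2
      have m2 := n2 u u.2
      unfold lq at this
      field_simp at this
      rw [this]; try ring) hc
    (ext _ _ fun u => by
      simp only [map_mul, map_pow, map_sub, map_smul, ea, E1, E2, F1, F2, EH]
      rw [smul_eq_mul, hch u u.2]
      unfold lq
      simp only [div_eq_mul_inv, inv_pow])
  refine ⟨Q, hQ, fun u hu => ?_⟩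
  have me := congrArg (E ⟨u, hu⟩) hQ0
  rw [map_zero, ← AlgHom.comp_apply, MvPolynomial.comp_aeval] at me
  have hv : (fun i => E ⟨u, hu⟩ (![H, Z1 * W2] i)) = ![h u, ad u / du u] := by
    funext i
    fin_cases i
    · rfl
    · show E _ (Z1 * W2) = _
      rw [map_mul, E1, F2]; rfl
  rw [hv] at me
  exact me
lemma exp_indep {T : ℝ} (hT : 0 < T) {Q : MvPolynomial (Fin 2) ℂ} (h : ∀ t : ℂ, MvPolynomial.eval ![t, exp (kap T * t)] Q = 0) : Q = 0 := by
  have hTc : (T : ℂ) ≠ 0 := by exact_mod_cast hT.ne'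
  have key : ∀ s w : ℂ, w ≠ 0 → MvPolynomial.eval ![s, w] Q = 0 := by
    intro s w hw
    let q : Polynomial ℂ := MvPolynomial.aeval ![Polynomial.X, Polynomial.C w] Q
    have hq : ∀ s, q.eval s = MvPolynomial.eval ![s, w] Q := by
      intro s
      have : q.eval s = (Polynomial.aeval s) q := by rw [Polynomial.coe_aeval_eq_eval]
      rw [this, ← AlgHom.comp_apply, MvPolynomial.comp_aeval]
      have hv : (fun i => Polynomial.aeval s ((![Polynomial.X, Polynomial.C w] : Fin 2 → Polynomial ℂ) i)) = ![s, w] := by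
        funext i
        fin_cases i <;> simp
      rw [hv]
      rfl
    have hper : ∀ k : ℕ, exp (kap T * (log w / kap T + k * T)) = w := by
      intro k
      rw [mul_add, mul_div_cancel₀ _ (kap_ne hT), show kap T * (k * T) = k * (kap T * T) by ring, kap_T hT, exp_add, exp_log hw, exp_nat_mul_two_pi_mul_I, mul_one]
    have hq0 : q = 0 := by
      apply Polynomial.eq_zero_of_infinite_isRoot
      refine Set.infinite_of_injective_forall_mem (f := fun k : ℕ => log w / kap T + k * T) ?_ ?_
      · intro a b hab
        simpa [hTc] using hab
      · intro k
        have := h (log w / kap T + k * T)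
        rw [hper] at this
        show q.eval _ = 0
        rw [hq, this]
    rw [← hq, hq0, Polynomial.eval_zero]
  have we : Q * MvPolynomial.X 1 = 0 := by
    apply MvPolynomial.funext
    intro x
    rw [map_mul, map_zero, MvPolynomial.eval_X]
    by_cases me : x 1 = 0
    · rw [me, mul_zero]
    · have := key (x 0) (x 1) me
      rw [show ![x 0, x 1] = x by ext i; fin_cases i <;> rfl] at this
      rw [this, zero_mul]
  exact (mul_eq_zero.1 we).resolve_right (MvPolynomial.X_ne_zero _)
lemma RIG {T : ℝ} (hT : 0 < T) {mi mo : ℂ → ℂ} (me : AnalyticAt ℂ mi 0) (we : AnalyticAt ℂ mo 0)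
    {p go q q' : Polynomial ℂ} {N k : ℕ} (hk : k ≠ N) (hpk : p.coeff k ≠ 0) {c : ℂ} (hc : c ≠ 0)
    (hr : ∀ᶠ u in 𝓝 0, lq N p (exp (kap T * mi u)) = lq N go (exp (kap T * mo u)))
    (hch : ∀ᶠ u in 𝓝 0, c * mi u + lq N q (exp (kap T * mi u)) = c * mo u + lq N q' (exp (kap T * mo u))) :
    ∀ᶠ u in 𝓝 0, mi u - mo u = mi 0 - mo 0 := by
  obtain ⟨r, hr0, H⟩ := eventually_nhds_iff_ball.1 ((me.eventually_analyticAt.and we.eventually_analyticAt).and (hr.and hch))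
  have er : AnalyticOnNhd ℂ mi (ball 0 r) := fun u hu => (H u hu).1.1
  have il : AnalyticOnNhd ℂ mo (ball 0 r) := fun u hu => (H u hu).1.2
  obtain ⟨Q, hQ, hQ0⟩ := dep_fun (U := ball (0:ℂ) r) (ad := fun u => exp (kap T * mi u)) (du := fun u => exp (kap T * mo u)) (h := fun u => mi u - mo u)
    (p := p) (go := go) (q := q) (q' := q') (convex_ball _ _).isPreconnected ⟨0, mem_ball_self hr0⟩
    (fun u hu => (analyticAt_const.mul (er u hu)).cexp) (fun u hu => (analyticAt_const.mul (il u hu)).cexp) (fun u hu => (er u hu).sub (il u hu))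
    (fun _ _ => exp_ne_zero _) (fun _ _ => exp_ne_zero _) hk hpk (fun u hu => (H u hu).2.1) hc
    (fun u hu => by linear_combination (H u hu).2.2)
  rcases (me.fun_sub we).eventually_constant_or_nhds_le_map_nhds with h | h
  · exact h
  · exfalso
    apply hQ
    apply exp_indep hT
    have hF : ∀ᶠ t in 𝓝 (mi 0 - mo 0), MvPolynomial.eval ![t, exp (kap T * t)] Q = 0 := by
      apply h
      rw [Filter.mem_map]
      filter_upwards [ball_mem_nhds (0:ℂ) hr0] with u hu
      have := hQ0 u hu
      rw [← exp_sub, ← mul_sub] at this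
      exact this
    have hd : Differentiable ℂ (fun t => MvPolynomial.eval ![t, exp (kap T * t)] Q) := by
      have := ev_diff Q (A := fun i t => (![t, exp (kap T * t)] : Fin 2 → ℂ) i) (by
        intro i; fin_cases i
        · exact differentiable_id
        · exact ((differentiable_const _).mul differentiable_id).cexp)
      exact this
    have := hd.differentiableOn.analyticOnNhd isOpen_univ |>.eqOn_of_preconnected_of_eventuallyEq (analyticOnNhd_const (v := (0:ℂ))) isPreconnected_univ (mem_univ _) hF
    exact fun t => this (mem_univ t)
end

section
attribute [local instance] Matrix.linftyOpNormedRing Matrix.linftyOpNormedAlgebra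
section
variable {n K : ℕ} {P : Fin n → Fin K → Fin K → MvPolynomial (Fin n) ℂ} {A B : Fin n → ℂ → ℂ} {WA WB : ℂ → MK K}
def dpol (c : Fin n → ℂ) (p : Fin n → Polynomial ℂ) (ca i : Fin n) : Polynomial ℂ := Polynomial.C (c ca) * p i - Polynomial.C (c i) * p ca
lemma dpol_eq {T : ℝ} {c : Fin n → ℂ} {p : Fin n → Polynomial ℂ} {N : ℕ} (ca i : Fin n) {x : ℂ} (eA : ∀ i x, A i x = c i * x + lq N (p i) (exp (kap T * x))) :
    lq N (dpol c p ca i) (exp (kap T * x)) = c ca * A i x - c i * A ca x := by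
  rw [eA, eA]
  unfold lq dpol
  simp only [eval_sub, eval_mul, eval_C]
  ring
lemma lq_const {N : ℕ} {p : Polynomial ℂ} (h : ∀ k, k ≠ N → p.coeff k = 0) {z : ℂ} (hz : z ≠ 0) : lq N p z = p.coeff N := by
  have : p = Polynomial.C (p.coeff N) * Polynomial.X ^ N := by
    ext k
    rw [Polynomial.coeff_C_mul, Polynomial.coeff_X_pow]
    split_ifs with hk
    · rw [hk, mul_one]
    · rw [h k hk, mul_zero]
  unfold lq
  conv_lhs => rw [this]
  rw [eval_mul, eval_C, eval_pow, eval_X]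
  field_simp
lemma rig_eq {T : ℝ} (hT : 0 < T) (hA : ∀ i, Differentiable ℂ (A i)) (hB : ∀ i, Differentiable ℂ (B i)) {c : Fin n → ℂ} {pA pB : Fin n → Polynomial ℂ} {N : ℕ}
    (eA : ∀ i x, A i x = c i * x + lq N (pA i) (exp (kap T * x))) (eB : ∀ i x, B i x = c i * x + lq N (pB i) (exp (kap T * x)))
    (hmom : MomEq T A B) {ca : Fin n} (hc : c ca ≠ 0) {i : Fin n} {k : ℕ} (hk : k ≠ N) (hpk : (dpol c pB ca i).coeff k ≠ 0) : ∀ i x, A i x = B i x := by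
  have hTc : (T : ℂ) ≠ 0 := by exact_mod_cast hT.ne'
  have hper : ∀ x, B ca (x + T) = B ca x + c ca * T := by
    intro x
    rw [eB, eB, kap_per hT]; ring
  have hnc : ¬ ∃ w, ∀ x, B ca x = w := by
    rintro ⟨w, hw⟩
    have := hper 0
    rw [hw, hw] at this
    exact mul_ne_zero hc hTc (by linear_combination - this)
  rcases ET hT hA hB hmom ca hnc with h | ⟨h, -⟩
  · exfalso
    obtain ⟨x, y, -, -, lo, en, -, -, h⟩ := h
    have my := h.self_of_nhds ca
    have := hper 0
    rw [lo, en] at my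
    rw [zero_add, my] at this
    exact mul_ne_zero hc hTc (by linear_combination - this)
  · obtain ⟨x, y, hx, hy, lo, en, hxc, -, h⟩ := h
    have hR := RIG hT hx hy (p := dpol c pB ca i) (go := dpol c pA ca i) (q := pB ca) (q' := pA ca) hk hpk hc
      (h.mono fun u hu => by rw [dpol_eq ca i eA, dpol_eq ca i eB, hu, hu]) (h.mono fun u hu => by rw [← eA, ← eB, hu])
    rw [lo, en] at hR
    intro j
    have hev : ∀ᶠ u in 𝓝 (0:ℂ), A j (x u) - B j (x u) = 0 := by
      filter_upwards [h, hR] with u me we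
      rw [me, show x u = y u by linear_combination we, sub_self]
    have hev2 : ∀ᶠ t in 𝓝 (0:ℂ), A j t = B j t := by
      rcases hx.eventually_constant_or_nhds_le_map_nhds with us | us
      · rw [lo] at us
        exact absurd us hxc
      · rw [lo] at us
        apply us
        rw [Filter.mem_map]
        filter_upwards [hev] with u hu
        exact sub_eq_zero.1 hu
    have := (hA j).differentiableOn.analyticOnNhd isOpen_univ |>.eqOn_of_preconnected_of_eventuallyEq ((hB j).differentiableOn.analyticOnNhd isOpen_univ) isPreconnected_univ (mem_univ _) hev2
    exact fun t => this (mem_univ t)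
lemma line_W {T : ℝ} (hT : 0 < T) (hP : TP P) (hA : ∀ i, Differentiable ℂ (A i)) {c : Fin n → ℂ} {pA : Fin n → Polynomial ℂ} {N : ℕ}
    (eA : ∀ i x, A i x = c i * x + lq N (pA i) (exp (kap T * x))) (my : ∀ i, A i 0 = 0) {ca : Fin n} (hc : c ca ≠ 0)
    (hD : ∀ i k, k ≠ N → (dpol c pA ca i).coeff k = 0) {WL : ℂ → MK K} (hWL : IsW (Om P (fun i y => c i / c ca * y)) WL) (hWA : IsW (Om P A) WA) : WA T = WL (c ca * T) := by
  have me : ∀ i x, A i x = c i / c ca * A ca x := by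
    intro i x
    have am := dpol_eq (x := x) ca i eA
    have ok := dpol_eq (x := 0) ca i eA
    rw [lq_const (hD i) (exp_ne_zero _)] at am ok
    rw [my, my] at ok
    field_simp
    linear_combination ok - am
  have we : A ca T = c ca * T := by
    have am := eA ca T
    have ok := eA ca 0
    rw [my] at ok
    have := kap_per hT 0
    rw [zero_add] at this
    rw [this] at am
    linear_combination am - ok
  rw [pullback hA (fun i => (differentiable_const _).mul differentiable_id) hWA hWL (hA ca) (my ca) (fun x i => me i x) T, we]
lemma CASE3b {T : ℝ} (hT : 0 < T) (hP : TP P) (hA : ∀ i, Differentiable ℂ (A i)) (hB : ∀ i, Differentiable ℂ (B i)) {c : Fin n → ℂ} {pA pB : Fin n → Polynomial ℂ} {N : ℕ}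
    (eA : ∀ i x, A i x = c i * x + lq N (pA i) (exp (kap T * x))) (eB : ∀ i x, B i x = c i * x + lq N (pB i) (exp (kap T * x)))
    (fi : ∀ i, A i 0 = 0) (li : ∀ i, B i 0 = 0) (hWA : IsW (Om P A) WA) (hWB : IsW (Om P B) WB)
    (hmom : MomEq T A B) {ca : Fin n} (hc : c ca ≠ 0) : WB T = WA T := by
  by_cases me : ∀ i k, k ≠ N → (dpol c pB ca i).coeff k = 0
  · by_cases we : ∀ i k, k ≠ N → (dpol c pA ca i).coeff k = 0
    · obtain ⟨WL, hWL⟩ := exists_W (Om_diff P (A := fun i y => c i / c ca * y) (fun i => (differentiable_const _).mul differentiable_id)) (Om_UT hP _)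
      rw [line_W hT hP hA eA fi hc we hWL hWA, line_W hT hP hB eB li hc me hWL hWB]
    · push Not at we
      obtain ⟨i, k, hk, hpk⟩ := we
      have := rig_eq hT hB hA eB eA (fun Q j => (hmom Q j).symm) hc hk hpk
      exact pullback hB hA hWB hWA (h := fun x => x) differentiable_id rfl (fun x i => this i x) T
  · push Not at me
    obtain ⟨i, k, hk, hpk⟩ := me
    have := rig_eq hT hA hB eA eB hmom hc hk hpk
    exact pullback hB hA hWB hWA (h := fun x => x) differentiable_id rfl (fun x i => (this i x).symm) T
end
end

section
attribute [local instance] Matrix.linftyOpNormedRing Matrix.linftyOpNormedAlgebra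
section
variable {n K : ℕ} {P : Fin n → Fin K → Fin K → MvPolynomial (Fin n) ℂ} {A B : Fin n → ℂ → ℂ} {WA WB : ℂ → MK K}
def PolyC (f : ℂ → ℂ) : Prop := ∃ p : Polynomial ℂ, ∀ x, f x = p.eval x
def TrigC (T : ℝ) (f : ℂ → ℂ) : Prop := ∃ (c : ℂ) (N : ℕ) (p : Polynomial ℂ), p.natDegree ≤ 2 * N ∧ ∀ x, f x = c * x + lq N p (exp (kap T * x))
lemma trig_zero (T : ℝ) : TrigC T (fun _ => 0) := ⟨0, 0, 0, by simp, fun x => by simp [lq]⟩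
lemma trig_unify {T : ℝ} (h : ∀ i, TrigC T (A i)) : ∃ N0, ∀ N, N0 ≤ N → ∃ (c : Fin n → ℂ) (p : Fin n → Polynomial ℂ), (∀ i, (p i).natDegree ≤ 2 * N) ∧
    ∀ i x, A i x = c i * x + lq N (p i) (exp (kap T * x)) := by
  choose c N p hd h using h
  refine ⟨∑ i, N i, fun M hM => ⟨c, fun i => p i * Polynomial.X ^ (M - N i), fun i => ?_, fun i x => ?_⟩⟩
  · have me : N i ≤ M := (Finset.single_le_sum (f := N) (fun _ _ => Nat.zero_le _) (Finset.mem_univ i)).trans hM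
    have we := Polynomial.natDegree_mul_le (p := p i) (q := Polynomial.X ^ (M - N i))
    rw [natDegree_X_pow] at we
    have := hd i
    show (p i * Polynomial.X ^ (M - N i)).natDegree ≤ 2 * M
    omega
  · have me : N i ≤ M := (Finset.single_le_sum (f := N) (fun _ _ => Nat.zero_le _) (Finset.mem_univ i)).trans hM
    rw [h]
    have hz := exp_ne_zero (kap T * x)
    unfold lq
    rw [eval_mul, eval_pow, eval_X]
    conv_rhs => rw [show M = N i + (M - N i) by omega]
    rw [pow_add, Nat.add_sub_cancel_left]
    field_simp
lemma mom_one {T : ℝ} (hA : ∀ i, Differentiable ℂ (A i)) (i : Fin n) : ∫ x in (0:ℝ)..T, ev 1 A x * deriv (A i) x = A i T - A i 0 := by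
  have me : ∀ x ∈ uIcc (0:ℝ) T, HasDerivAt (fun x : ℝ => A i x) (deriv (A i) x) x := fun x _ => ((hA i) x).hasDerivAt.comp_ofReal
  have we : Continuous (fun x : ℝ => deriv (A i) x) := (hA i).contDiff.continuous_deriv (n := 1) le_rfl |>.comp continuous_ofReal
  have := intervalIntegral.integral_eq_sub_of_hasDerivAt me (we.intervalIntegrable _ _)
  simpa [ev] using this
lemma CASE3 {T : ℝ} (hT : 0 < T) (hP : TP P) (hA : ∀ i, Differentiable ℂ (A i)) (hB : ∀ i, Differentiable ℂ (B i))
    (tA : ∀ i, TrigC T (A i)) (tB : ∀ i, TrigC T (B i))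
    (fi : ∀ i, A i 0 = 0) (li : ∀ i, B i 0 = 0) (hWA : IsW (Om P A) WA) (hWB : IsW (Om P B) WB)
    (hmom : MomEq T A B) (hW : WA T = 1) : WB T = 1 := by
  have hTc : (T : ℂ) ≠ 0 := by exact_mod_cast hT.ne'
  obtain ⟨N1, me⟩ := trig_unify tA
  obtain ⟨N2, we⟩ := trig_unify tB
  obtain ⟨c, pA, dA, eA⟩ := me (N1 + N2) (by omega)
  obtain ⟨c', pB, dB, eB⟩ := we (N1 + N2) (by omega)
  have hval : ∀ (A : Fin n → ℂ → ℂ) (c : Fin n → ℂ) (p : Fin n → Polynomial ℂ), (∀ i x, A i x = c i * x + lq (N1 + N2) (p i) (exp (kap T * x))) → (∀ i, A i 0 = 0) → ∀ i, A i T = c i * T := by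
    intro A c p eA fi i
    have am := eA i T
    have ok := eA i 0
    rw [fi] at ok
    have := kap_per hT 0
    rw [zero_add] at this
    rw [this] at am
    linear_combination am - ok
  have hcc : c' = c := by
    funext i
    have := hmom 1 i
    rw [mom_one hA, mom_one hB, fi, li, hval A c pA eA fi, hval B c' pB eB li] at this
    apply mul_right_cancel₀ hTc
    linear_combination - this
  subst hcc
  by_cases hc : ∀ i, c' i = 0
  · simp only [hc, zero_mul, zero_add] at eA eB
    exact TRIG hT hA hB hP hWA hWB eA eB dB hmom hW
  · push Not at hc
    obtain ⟨ca, hc⟩ := hc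
    rw [CASE3b hT hP hA hB eA eB fi li hWA hWB hmom hc, hW]
lemma poly_Pro {f : ℂ → ℂ} (hf : PolyC f) (my : f 0 = 0) : Pro f ∨ f = fun _ => 0 := by
  obtain ⟨p, hp⟩ := hf
  by_cases hd : 0 < p.degree
  · left
    intro M
    have me := Polynomial.tendsto_norm_atTop p hd (z := fun x : ℂ => x) (l := Filter.comap norm atTop) tendsto_comap
    have we := me.eventually (eventually_gt_atTop M)
    rw [Filter.eventually_comap] at we
    obtain ⟨R, hR⟩ := Filter.eventually_atTop.1 we
    exact ⟨R, fun x hx => by rw [hp]; exact hR _ hx x rfl⟩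
  · right
    rw [not_lt] at hd
    have := Polynomial.eq_C_of_degree_le_zero hd
    funext x
    rw [hp, this] at my ⊢
    simpa using my
theorem MAINW {T : ℝ} (hT : 0 < T) (hP : TP P) (hA : ∀ i, Differentiable ℂ (A i)) (hB : ∀ i, Differentiable ℂ (B i))
    (tA : ∀ i, PolyC (A i) ∨ TrigC T (A i)) (tB : ∀ i, PolyC (B i) ∨ TrigC T (B i))
    (fi : ∀ i, A i 0 = 0) (li : ∀ i, B i 0 = 0) (hWA : IsW (Om P A) WA) (hWB : IsW (Om P B) WB)
    (hmom : MomEq T A B) (hW : WA T = 1) : WB T = 1 := by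
  by_cases me : ∃ j, Pro (B j)
  · obtain ⟨j, hj⟩ := me
    rcases ET hT hA hB hmom j hj.nc with h | ⟨h, h'⟩
    · exact CL2 hB hWB hj h
    · rw [CL1 hA hB hWA hWB hj h h', hW]
  have htr : ∀ (A : Fin n → ℂ → ℂ), (∀ i, PolyC (A i) ∨ TrigC T (A i)) → (∀ i, A i 0 = 0) → (¬ ∃ j, Pro (A j)) → ∀ i, TrigC T (A i) := by
    intro A tA fi h i
    rcases tA i with we | we
    · rcases poly_Pro we (fi i) with us | us
      · exact absurd ⟨i, us⟩ h
      · rw [us]; exact trig_zero T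
    · exact we
  have tB2 := htr B tB li me
  by_cases we : ∃ j, Pro (A j)
  · obtain ⟨j, hj⟩ := we
    rcases ET hT hB hA (fun Q j => (hmom Q j).symm) j hj.nc with h | ⟨h, h'⟩
    · have htA : Triv T A := fun K P hP W hW => CL2 hA hW hj h
      have my : ∀ i : Fin n, Differentiable ℂ ((fun (_ : Fin n) (_ : ℂ) => (0:ℂ)) i) := fun i => differentiable_const 0
      have la : Triv T (fun (_ : Fin n) (_ : ℂ) => (0:ℂ)) := triv_pull my my (h := fun _ => 0) (differentiable_const _) rfl rfl (fun _ _ => rfl)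
      obtain ⟨W0, hW0⟩ := exists_W (Om_diff P my) (Om_UT hP _)
      refine CASE3 hT hP my hB (fun _ => trig_zero T) tB2 (fun _ => rfl) li hW0 hWB (fun Q j => ?_) (la K P hP W0 hW0)
      rw [triv_mom my la Q j, ← hmom Q j, triv_mom hA htA]
    · rw [← CL1 hB hA hWB hWA hj h h', hW]
  · exact CASE3 hT hP hA hB (htr A tA fi we) tB2 fi li hWA hWB hmom hW
end
end

section
section
variable {T : ℝ}
def volt (hT : 0 ≤ T) : C(Icc (0:ℝ) T, ℂ) →L[ℂ] C(Icc (0:ℝ) T, ℂ) :=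
  LinearMap.mkContinuous
    { toFun := fun f => ⟨fun x => ∫ s in (0:ℝ)..x, IccExtend hT f s, by
        have me : Continuous (fun x : ℝ => ∫ s in (0:ℝ)..x, IccExtend hT f s) := intervalIntegral.continuous_primitive (fun a b => (f.continuous.Icc_extend' (h := hT)).intervalIntegrable a b) 0
        exact me.comp continuous_subtype_val⟩
      map_add' := fun f g => by
        ext x
        show (∫ s in (0:ℝ)..x, (IccExtend hT f s + IccExtend hT g s)) = _
        exact intervalIntegral.integral_add ((f.continuous.Icc_extend' (h := hT)).intervalIntegrable _ _) ((g.continuous.Icc_extend' (h := hT)).intervalIntegrable _ _)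
      map_smul' := fun c f => by
        ext x
        show (∫ s in (0:ℝ)..x, c * (IccExtend hT f s)) = _
        exact intervalIntegral.integral_const_mul _ _ } T (by
    intro f
    rw [ContinuousMap.norm_le _ (by positivity)]
    intro x
    show ‖∫ s in (0:ℝ)..x, IccExtend hT f s‖ ≤ _
    have me := intervalIntegral.norm_integral_le_of_norm_le_const (a := (0:ℝ)) (b := x) (f := IccExtend hT f) (C := ‖f‖) (fun s _ => f.norm_coe_le_norm _)
    refine me.trans ?_
    rw [sub_zero, abs_of_nonneg x.2.1, mul_comm]
    exact mul_le_mul_of_nonneg_right x.2.2 (norm_nonneg _))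
lemma volt_apply (hT : 0 ≤ T) (f : C(Icc (0:ℝ) T, ℂ)) (x : Icc (0:ℝ) T) : volt hT f x = ∫ s in (0:ℝ)..x, IccExtend hT f s := rfl
lemma FLOW (hT : 0 < T) {n : ℕ} (a : Fin n → ℝ → ℂ) (ha : ∀ i, Continuous (a i)) :
    ∃ (sol : ℂ → ℝ → ℂ) (C r : ℝ), 0 < r ∧ 0 < C ∧ AnalyticAt ℂ (fun t => sol t T) 0 ∧ ∀ t, ‖t‖ < r → Continuous (sol t) ∧ sol t 0 = t ∧
      (∀ x ∈ Icc (0:ℝ) T, sol t x = t + ∫ s in (0:ℝ)..x, ∑ i, a i s * sol t s ^ ((i : ℕ) + 2)) ∧ ∀ x ∈ Icc (0:ℝ) T, ‖sol t x‖ ≤ C * ‖t‖ := by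
  let X := C(Icc (0:ℝ) T, ℂ)
  let α : Fin n → X := fun i => ⟨fun s => a i s, (ha i).comp continuous_subtype_val⟩
  let g : X → X := fun v => ∑ i, α i * v ^ ((i:ℕ) + 2)
  have hg : ContDiff ℂ ⊤ g := by
    apply ContDiff.sum
    intro i _
    exact contDiff_const.mul (contDiff_id.pow _)
  let F : X → X := fun v => v - volt hT.le (g v)
  have hF : ContDiff ℂ ⊤ F := contDiff_id.sub ((volt hT.le).contDiff.comp hg)
  have hg0 : HasFDerivAt g (0 : X →L[ℂ] X) 0 := by
    have : HasFDerivAt g (∑ i : Fin n, (0 : X →L[ℂ] X)) 0 := by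
      apply HasFDerivAt.fun_sum
      intro i _
      have me := ((hasFDerivAt_id (𝕜 := ℂ) (0 : X)).pow' ((i:ℕ)+2)).const_mul (α i)
      refine me.congr_fderiv ?_
      ext v x
      have we : ∑ j ∈ Finset.range ((i:ℕ) + 2), (0:X) ^ ((i:ℕ) + 1 - j) * v * 0 ^ j = 0 := by
        apply Finset.sum_eq_zero
        intro j _
        rcases Nat.eq_zero_or_pos j with hj | hj
        · subst hj; simp
        · rw [zero_pow hj.ne', mul_zero]
      simp [we]
    simpa using this
  have hF0 : HasFDerivAt F ((ContinuousLinearEquiv.refl ℂ X : X ≃L[ℂ] X) : X →L[ℂ] X) 0 := by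
    have := (hasFDerivAt_id (𝕜 := ℂ) (0 : X)).sub ((volt hT.le).hasFDerivAt.comp (0 : X) hg0)
    refine this.congr_fderiv ?_
    ext v x
    simp
  have hFz : F 0 = 0 := by
    simp [F, g]
  have hFa : ContDiffAt ℂ ⊤ F 0 := hF.contDiffAt
  have hn : (⊤ : WithTop ℕ∞) ≠ 0 := by simp
  let G := hFa.localInverse hF0 hn
  have hG : ContDiffAt ℂ ⊤ G 0 := by
    have := hFa.to_localInverse hF0 hn
    rwa [hFz] at this
  have hG0 : G 0 = 0 := by
    have := hFa.localInverse_apply_image hF0 hn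
    rwa [hFz] at this
  have hFG : ∀ᶠ y in 𝓝 (0:X), F (G y) = y := by
    have := (hFa.hasStrictFDerivAt' hF0 hn).eventually_right_inverse
    rwa [hFz] at this
  let cst : ℂ →L[ℂ] X := (ContinuousLinearMap.id ℂ ℂ).smulRight (1:X)
  have hcst : ∀ t x, cst t x = t := fun t x => mul_one t
  have hcst0 : cst 0 = 0 := map_zero _
  have hGc : ContDiffAt ℂ ⊤ (fun t => G (cst t)) 0 := ContDiffAt.comp (g := G) (0:ℂ) (by rwa [hcst0]) cst.contDiff.contDiffAt
  have hbd : ∃ C : ℝ, 0 < C ∧ ∀ᶠ t in 𝓝 (0:ℂ), ‖G (cst t)‖ ≤ C * ‖t‖ := by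
    have me := (hGc.differentiableAt hn).isBigO_sub
    obtain ⟨C, hC, we⟩ := me.exists_pos
    refine ⟨C, hC, we.bound.mono fun t ht => ?_⟩
    simpa [hcst0, hG0] using ht
  obtain ⟨C, hC, hbd⟩ := hbd
  have hcon : Tendsto (fun t => cst t) (𝓝 (0:ℂ)) (𝓝 0) := by
    have := cst.continuous.tendsto 0
    rwa [hcst0] at this
  obtain ⟨r, hr, H⟩ := eventually_nhds_iff_ball.1 (hbd.and (hcon.eventually hFG))
  refine ⟨fun t => IccExtend hT.le (G (cst t)), C, r, hr, hC, ?_, fun t ht => ?_⟩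
  · let eT : X →L[ℂ] ℂ := ContinuousMap.evalCLM ℂ (⟨T, hT.le, le_rfl⟩ : Icc (0:ℝ) T)
    have my : ContDiff ℂ ⊤ eT := eT.contDiff
    have me : ContDiffAt ℂ ⊤ (fun t => eT (G (cst t))) 0 := my.contDiffAt.comp (0:ℂ) hGc
    have we : (fun t => IccExtend hT.le (G (cst t)) T) = (fun t => eT (G (cst t))) := by
      funext t
      exact IccExtend_of_mem hT.le _ ⟨hT.le, le_rfl⟩
    rw [we]
    exact me.analyticAt
  · obtain ⟨me, we⟩ := H t (by simpa using ht)
    have us : ∀ x (hx : x ∈ Icc (0:ℝ) T), IccExtend hT.le (G (cst t)) x = t + ∫ s in (0:ℝ)..x, ∑ i, a i s * IccExtend hT.le (G (cst t)) s ^ ((i : ℕ) + 2) := by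
      intro x hx
      have up : G (cst t) = cst t + volt hT.le (g (G (cst t))) := by
        rw [← sub_eq_iff_eq_add]; exact we
      rw [IccExtend_of_mem hT.le _ hx]
      have ma : G (cst t) ⟨x, hx⟩ = cst t ⟨x, hx⟩ + volt hT.le (g (G (cst t))) ⟨x, hx⟩ := congrArg (fun f : X => f ⟨x, hx⟩) up
      rw [ma, hcst, volt_apply]
      congr 1
      apply intervalIntegral.integral_congr
      intro s hs
      rw [uIcc_of_le hx.1] at hs
      have hs' : s ∈ Icc (0:ℝ) T := ⟨hs.1, hs.2.trans hx.2⟩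
      show IccExtend hT.le (g (G (cst t))) s = ∑ i, a i s * IccExtend hT.le (G (cst t)) s ^ ((i : ℕ) + 2)
      rw [IccExtend_of_mem hT.le _ hs', IccExtend_of_mem hT.le _ hs']
      show (∑ i, α i * (G (cst t)) ^ ((i:ℕ) + 2)) ⟨s, hs'⟩ = _
      rw [ContinuousMap.sum_apply]
      rfl
    refine ⟨(G (cst t)).continuous.Icc_extend', ?_, us, fun x hx => ?_⟩
    · have := us 0 ⟨le_rfl, hT.le⟩
      simpa using this
    · exact ((G (cst t)).norm_coe_le_norm _).trans me
end
end

section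
attribute [local instance] Matrix.linftyOpNormedRing Matrix.linftyOpNormedAlgebra
section
variable {T : ℝ} {n : ℕ}
lemma sol_deriv {a : Fin n → ℝ → ℂ} (ha : ∀ i, Continuous (a i)) {v : ℝ → ℂ} (hv : Continuous v) {v0 : ℂ}
    (h : ∀ x ∈ Icc (0:ℝ) T, v x = v0 + ∫ s in (0:ℝ)..x, ∑ i, a i s * v s ^ ((i : ℕ) + 2)) :
    ∀ x ∈ Ico (0:ℝ) T, HasDerivWithinAt v (∑ i, a i x * v x ^ ((i : ℕ) + 2)) (Ici x) x := by
  intro x hx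
  have hc : Continuous (fun s => ∑ i, a i s * v s ^ ((i : ℕ) + 2)) := by fun_prop
  have me : HasDerivAt (fun x => v0 + ∫ s in (0:ℝ)..x, ∑ i, a i s * v s ^ ((i : ℕ) + 2)) (∑ i, a i x * v x ^ ((i : ℕ) + 2)) x := by
    have := (intervalIntegral.integral_hasDerivAt_right (hc.intervalIntegrable 0 x) (hc.stronglyMeasurableAtFilter _ _) hc.continuousAt).const_add v0
    exact this
  have we : HasDerivWithinAt v (∑ i, a i x * v x ^ ((i : ℕ) + 2)) (Icc 0 T) x :=
    me.hasDerivWithinAt.congr (fun y hy => h y hy) (h x ⟨hx.1, hx.2.le⟩)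
  exact we.mono_of_mem_nhdsWithin (Filter.mem_of_superset (Icc_mem_nhdsGE hx.2) (Icc_subset_Icc_left hx.1))
lemma sol_unique {a : Fin n → ℝ → ℂ} (ha : ∀ i, Continuous (a i)) {v w : ℝ → ℂ} (hv : Continuous v) (hw : Continuous w) {v0 : ℂ}
    (h : ∀ x ∈ Icc (0:ℝ) T, v x = v0 + ∫ s in (0:ℝ)..x, ∑ i, a i s * v s ^ ((i : ℕ) + 2))
    (h' : ∀ x ∈ Icc (0:ℝ) T, w x = v0 + ∫ s in (0:ℝ)..x, ∑ i, a i s * w s ^ ((i : ℕ) + 2)) :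
    ∀ x ∈ Icc (0:ℝ) T, v x = w x := by
  intro x hx
  have my : (0:ℝ) ∈ Icc (0:ℝ) T := ⟨le_rfl, hx.1.trans hx.2⟩
  let S : ℝ → ℂ := fun x => ∑ i, a i x * ∑ k ∈ Finset.range ((i:ℕ) + 2), v x ^ k * w x ^ ((i:ℕ) + 2 - 1 - k)
  have hS : Continuous S := by
    refine continuous_finsetSum _ fun i _ => (ha i).mul (continuous_finsetSum _ fun k _ => (hv.pow _).mul (hw.pow _))
  obtain ⟨M, hM⟩ := isCompact_Icc.exists_bound_of_continuousOn (s := Icc (0:ℝ) T) hS.continuousOn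
  have := eq_zero_of_abs_deriv_le_mul_abs_self_of_eq_zero_right (f := fun x => v x - w x) (K := M) (a := 0) (b := T) (hv.sub hw).continuousOn
    (fun x hx => (sol_deriv ha hv h x hx).sub (sol_deriv ha hw h' x hx)) (by rw [h 0 my, h' 0 my]; simp) (by
      intro x hx
      have : ∑ i, a i x * v x ^ ((i : ℕ) + 2) - ∑ i, a i x * w x ^ ((i : ℕ) + 2) = S x * (v x - w x) := by
        rw [← sum_sub_distrib, sum_mul]
        refine sum_congr rfl fun i _ => ?_
        rw [mul_assoc, (Commute.all (v x) (w x)).geom_sum₂_mul]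
        ring
      rw [this, norm_mul]
      exact mul_le_mul_of_nonneg_right (hM x ⟨hx.1, hx.2.le⟩) (norm_nonneg _)) x hx
  exact sub_eq_zero.1 this
def NP (n K : ℕ) : Fin n → Fin K → Fin K → MvPolynomial (Fin n) ℂ := fun i j k => if (k:ℕ) = j + i + 1 then MvPolynomial.C ((j:ℂ) + 1) else 0
lemma NP_TP (n K : ℕ) : TP (NP n K) := by
  intro i a b h
  unfold NP
  rw [if_neg (by omega)]
lemma sum_fin_ite {K m : ℕ} (f : ℕ → ℂ) : ∑ l : Fin K, (if (l:ℕ) = m then f l else 0) = if m < K then f m else 0 := by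
  rw [Fin.sum_univ_eq_sum_range (fun l => if l = m then f l else 0) K, Finset.sum_ite_eq']
  simp
lemma ASY (hT : 0 < T) {A : Fin n → ℂ → ℂ} (hA : ∀ i, Differentiable ℂ (A i)) {K : ℕ} {W : ℂ → MK K} (hW : IsW (Om (NP n K) A) W) :
    ∃ M : ℝ, ∀ (v : ℝ → ℂ) (v0 : ℂ) (δ : ℝ), Continuous v → v 0 = v0 → δ ≤ 1 → (∀ x ∈ Icc (0:ℝ) T, ‖v x‖ ≤ δ) →
      (∀ x ∈ Icc (0:ℝ) T, v x = v0 + ∫ s in (0:ℝ)..x, ∑ i, deriv (A i) s * v s ^ ((i : ℕ) + 2)) →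
      ∀ j : Fin K, ‖v T ^ ((j:ℕ) + 1) - ∑ k : Fin K, W T j k * v0 ^ ((k:ℕ) + 1)‖ ≤ M * δ ^ (K + 1) := by
  have hac : ∀ i, Continuous (fun s : ℝ => deriv (A i) s) := fun i => (hA i).contDiff.continuous_deriv (n := 1) le_rfl |>.comp continuous_ofReal
  have hOc : ∀ j l, Continuous (fun s : ℝ => Om (NP n K) A s j l) := fun j l =>
    continuous_finsetSum _ fun i _ => (hac i).mul ((ev_diff (NP n K i j l) hA).continuous.comp continuous_ofReal)
  have hLc : Continuous (fun s : ℝ => ∑ j, ∑ l, ‖Om (NP n K) A s j l‖) := continuous_finsetSum _ fun j _ => continuous_finsetSum _ fun l _ => (hOc j l).norm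
  obtain ⟨L0, hL0⟩ := isCompact_Icc.exists_bound_of_continuousOn (s := Icc (0:ℝ) T) hLc.continuousOn
  let L := |L0| + 1
  have hLp : 0 < L := by positivity
  have hL : ∀ s ∈ Icc (0:ℝ) T, ∀ j, ∑ l, ‖Om (NP n K) A s j l‖ ≤ L := by
    intro s hs j
    have me : ∑ l, ‖Om (NP n K) A s j l‖ ≤ ∑ j, ∑ l, ‖Om (NP n K) A s j l‖ := Finset.single_le_sum (f := fun j => ∑ l, ‖Om (NP n K) A s j l‖) (fun j _ => by positivity) (Finset.mem_univ j)
    have we := hL0 s hs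
    have us := le_abs_self (∑ j, ∑ l, ‖Om (NP n K) A s j l‖)
    rw [← Real.norm_eq_abs] at us
    have up := le_abs_self L0
    show _ ≤ |L0| + 1
    linarith
  have hRc : Continuous (fun s : ℝ => ∑ i, ((K:ℝ) * ‖deriv (A i) s‖)) := continuous_finsetSum _ fun j _ => continuous_const.mul (hac j).norm
  obtain ⟨R, hR⟩ := isCompact_Icc.exists_bound_of_continuousOn (s := Icc (0:ℝ) T) hRc.continuousOn
  refine ⟨R / L * (Real.exp (L * T) - 1), fun v v0 δ hv hv0 hδ hvb hs j => ?_⟩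
  have hδ0 : 0 ≤ δ := (norm_nonneg _).trans (hvb 0 ⟨le_rfl, hT.le⟩)
  let e : ℝ → Fin K → ℂ := fun x j => v x ^ ((j:ℕ) + 1) - ∑ k : Fin K, W x j k * v0 ^ ((k:ℕ) + 1)
  let ex : ℝ → Fin K → ℂ := fun x j => (((j:ℕ) + 1 : ℕ) : ℂ) * v x ^ (j:ℕ) * (∑ i, deriv (A i) x * v x ^ ((i : ℕ) + 2)) - ∑ k : Fin K, (Om (NP n K) A x * W x) j k * v0 ^ ((k:ℕ) + 1)
  have hWd : ∀ (x : ℝ) j k, HasDerivAt (fun x : ℝ => W x j k) ((Om (NP n K) A x * W x) j k) x := fun x j k => (entry_deriv (hW.d x) j k).comp_ofReal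
  have hed : ∀ x ∈ Ico (0:ℝ) T, HasDerivWithinAt e (ex x) (Ici x) x := by
    intro x hx
    rw [hasDerivWithinAt_pi]
    intro j
    refine HasDerivWithinAt.sub ?_ ?_
    · have := (sol_deriv hac hv hs x hx).fun_pow ((j:ℕ) + 1)
      exact this
    · refine HasDerivWithinAt.fun_sum fun k _ => ?_
      exact ((hWd x j k).mul_const _).hasDerivWithinAt
  have hec : Continuous e := by
    refine continuous_pi fun j => (hv.pow _).sub (continuous_finsetSum _ fun k _ => ?_)
    exact (continuous_iff_continuousAt.2 fun x => (hWd x j k).continuousAt).mul continuous_const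
  have he0 : e 0 = 0 := by
    funext j
    simp only [e, hv0, ofReal_zero, hW.z, Matrix.one_apply, ite_mul, one_mul, zero_mul, Finset.sum_ite_eq, Finset.mem_univ, if_true, sub_self, Pi.zero_apply]
  have hbound : ∀ x ∈ Ico (0:ℝ) T, ‖ex x‖ ≤ L * ‖e x‖ + R * δ ^ (K + 1) := by
    intro x hx
    have hxI : x ∈ Icc (0:ℝ) T := ⟨hx.1, hx.2.le⟩
    have hR0 : 0 ≤ R := (norm_nonneg _).trans (hR x hxI)
    rw [pi_norm_le_iff_of_nonneg (by positivity)]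
    intro j
    have am : ∑ k : Fin K, (Om (NP n K) A x * W x) j k * v0 ^ ((k:ℕ) + 1) = ∑ l, Om (NP n K) A x j l * ∑ k : Fin K, W x l k * v0 ^ ((k:ℕ) + 1) := by
      simp only [Matrix.mul_apply, sum_mul, mul_sum]
      rw [Finset.sum_comm]
      simp only [mul_assoc]
    have ok : ∑ l, Om (NP n K) A x j l * v x ^ ((l:ℕ) + 1) = ∑ i : Fin n, if (j:ℕ) + i + 1 < K then ((j:ℂ) + 1) * deriv (A i) x * v x ^ ((j:ℕ) + i + 2) else 0 := by
      simp only [Om, sum_mul]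
      rw [Finset.sum_comm]
      refine sum_congr rfl fun i _ => ?_
      rw [← sum_fin_ite (fun l => ((j:ℂ) + 1) * deriv (A i) x * v x ^ (l + 1))]
      refine sum_congr rfl fun l _ => ?_
      unfold NP
      split_ifs
      · simp only [ev, MvPolynomial.eval_C]; ring
      · simp [ev]
    have de : ex x j = ∑ l, Om (NP n K) A x j l * e x l + ∑ i : Fin n, if (j:ℕ) + i + 1 < K then 0 else ((j:ℂ) + 1) * deriv (A i) x * v x ^ ((j:ℕ) + i + 2) := by
      have e4 : (((j:ℕ) + 1 : ℕ) : ℂ) * v x ^ (j:ℕ) * (∑ i, deriv (A i) x * v x ^ ((i : ℕ) + 2)) = (∑ i : Fin n, if (j:ℕ) + i + 1 < K then ((j:ℂ) + 1) * deriv (A i) x * v x ^ ((j:ℕ) + i + 2) else 0)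
          + ∑ i : Fin n, if (j:ℕ) + i + 1 < K then 0 else ((j:ℂ) + 1) * deriv (A i) x * v x ^ ((j:ℕ) + i + 2) := by
        rw [← sum_add_distrib, mul_sum]
        refine sum_congr rfl fun i _ => ?_
        split_ifs <;> push_cast <;> ring
      simp only [ex, e, am, mul_sub, sum_sub_distrib]
      rw [ok, e4]
      ring
    rw [de]
    refine (norm_add_le _ _).trans (add_le_add ?_ ?_)
    · refine (norm_sum_le _ _).trans ?_
      calc ∑ l, ‖Om (NP n K) A x j l * e x l‖ ≤ ∑ l, ‖Om (NP n K) A x j l‖ * ‖e x‖ := Finset.sum_le_sum fun l _ => by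
            rw [norm_mul]; exact mul_le_mul_of_nonneg_left (norm_le_pi_norm _ _) (norm_nonneg _)
        _ = (∑ l, ‖Om (NP n K) A x j l‖) * ‖e x‖ := by rw [sum_mul]
        _ ≤ _ := mul_le_mul_of_nonneg_right (hL x hxI j) (norm_nonneg _)
    · refine (norm_sum_le _ _).trans ?_
      calc _ ≤ ∑ i : Fin n, ((K:ℝ) * ‖deriv (A i) x‖) * δ ^ (K + 1) := Finset.sum_le_sum fun i _ => by
            split_ifs with hlt
            · rw [norm_zero]; positivity
            · rw [norm_mul, norm_mul, norm_pow]
              have hj1 : ‖((j:ℂ) + 1)‖ ≤ K := by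
                rw [show ((j:ℂ) + 1) = (((j:ℕ) + 1 : ℕ) : ℂ) by push_cast; rfl, norm_natCast]
                exact_mod_cast j.2
              have hv1 : ‖v x‖ ^ ((j:ℕ) + i + 2) ≤ δ ^ (K + 1) := (pow_le_pow_left₀ (norm_nonneg _) (hvb x hxI) _).trans (pow_le_pow_of_le_one hδ0 hδ (by omega))
              gcongr
        _ = (∑ i : Fin n, ((K:ℝ) * ‖deriv (A i) x‖)) * δ ^ (K + 1) := by rw [sum_mul]
        _ ≤ _ := mul_le_mul_of_nonneg_right ((le_abs_self _).trans (hR x hxI)) (by positivity)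
  have := norm_le_gronwallBound_of_norm_deriv_right_le hec.continuousOn hed (δ := 0) (by rw [he0, norm_zero]) hbound T ⟨hT.le, le_rfl⟩
  rw [gronwallBound_of_K_ne_0 hLp.ne'] at this
  refine (norm_le_pi_norm (e T) j).trans (this.trans (le_of_eq ?_))
  rw [sub_zero]
  ring
end
end

section
attribute [local instance] Matrix.linftyOpNormedRing Matrix.linftyOpNormedAlgebra
section
variable {T : ℝ} {n : ℕ}
lemma lim0 {g : ℂ → ℂ} (hg : ContinuousAt g 0) {m K : ℕ} (hm : m ≤ K) {C : ℝ} (h : ∀ᶠ t in 𝓝 (0:ℂ), ‖t ^ m * g t‖ ≤ C * ‖t‖ ^ (K + 1)) : g 0 = 0 := by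
  have me : Tendsto (fun t => ‖g t‖) (𝓝[≠] (0:ℂ)) (𝓝 ‖g 0‖) := (hg.tendsto.mono_left nhdsWithin_le_nhds).norm
  have we : Tendsto (fun t : ℂ => C * ‖t‖ ^ (K + 1 - m)) (𝓝[≠] (0:ℂ)) (𝓝 0) := by
    have : Continuous (fun t : ℂ => C * ‖t‖ ^ (K + 1 - m)) := by fun_prop
    have := this.tendsto 0
    rw [norm_zero, zero_pow (by omega), mul_zero] at this
    exact this.mono_left nhdsWithin_le_nhds
  have us : ∀ᶠ t in 𝓝[≠] (0:ℂ), ‖g t‖ ≤ C * ‖t‖ ^ (K + 1 - m) := by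
    filter_upwards [h.filter_mono nhdsWithin_le_nhds, self_mem_nhdsWithin] with t ht la
    have hp : 0 < ‖t‖ ^ m := pow_pos (norm_pos_iff.2 la) m
    rw [norm_mul, norm_pow, show K + 1 = m + (K + 1 - m) by omega, pow_add] at ht
    exact le_of_mul_le_mul_left (by linarith) hp
  have := le_of_tendsto_of_tendsto me we us
  exact norm_le_zero_iff.1 this
lemma poly_small {q : Polynomial ℂ} {K : ℕ} (hd : q.natDegree ≤ K) {C : ℝ} (h : ∀ᶠ t in 𝓝 (0:ℂ), ‖q.eval t‖ ≤ C * ‖t‖ ^ (K + 1)) : q = 0 := by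
  by_contra hq
  obtain ⟨p, hp, hnd⟩ := Polynomial.exists_eq_pow_rootMultiplicity_mul_and_not_dvd q hq 0
  have hp0 : p ≠ 0 := fun h => hnd (by rw [h]; exact dvd_zero _)
  set m := q.rootMultiplicity 0
  rw [Polynomial.C_0, sub_zero] at hp hnd
  have hmd : m ≤ K := by
    have := congrArg Polynomial.natDegree hp
    rw [Polynomial.natDegree_mul (pow_ne_zero _ Polynomial.X_ne_zero) hp0, natDegree_X_pow] at this
    omega
  have := lim0 (g := fun t => p.eval t) p.continuous.continuousAt hmd (h.mono fun t ht => by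
    rw [hp, eval_mul, eval_pow, eval_X] at ht
    exact ht)
  rw [Polynomial.X_dvd_iff, Polynomial.coeff_zero_eq_eval_zero] at hnd
  exact hnd this
lemma an_small {f : ℂ → ℂ} (hf : AnalyticAt ℂ f 0) (h : ∀ K : ℕ, ∃ C : ℝ, ∀ᶠ t in 𝓝 (0:ℂ), ‖f t‖ ≤ C * ‖t‖ ^ (K + 1 + 1)) : ∀ᶠ t in 𝓝 (0:ℂ), f t = 0 := by
  by_contra hne
  obtain ⟨m, g, hg, hg0, hfg⟩ := hf.exists_eventuallyEq_pow_smul_nonzero_iff.2 hne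
  obtain ⟨C, hC⟩ := h m
  apply hg0
  refine lim0 hg.continuousAt (Nat.le_succ m) (C := C) ?_
  filter_upwards [hC, hfg] with t me we
  rw [we] at me
  simpa using me
lemma cont_a {A : Fin n → ℂ → ℂ} (hA : ∀ i, Differentiable ℂ (A i)) (i : Fin n) : Continuous (fun s : ℝ => deriv (A i) s) :=
  (hA i).contDiff.continuous_deriv (n := 1) le_rfl |>.comp continuous_ofReal
lemma sol_asy (hT : 0 < T) {A : Fin n → ℂ → ℂ} (hA : ∀ i, Differentiable ℂ (A i)) {sol : ℂ → ℝ → ℂ} {C r : ℝ} (hr : 0 < r) (hC : 0 < C)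
    (hs : ∀ t, ‖t‖ < r → Continuous (sol t) ∧ sol t 0 = t ∧
      (∀ x ∈ Icc (0:ℝ) T, sol t x = t + ∫ s in (0:ℝ)..x, ∑ i, deriv (A i) s * sol t s ^ ((i : ℕ) + 2)) ∧ ∀ x ∈ Icc (0:ℝ) T, ‖sol t x‖ ≤ C * ‖t‖)
    {K : ℕ} {W : ℂ → MK K} (hW : IsW (Om (NP n K) A) W) : ∃ M : ℝ, ∀ᶠ t in 𝓝 (0:ℂ), ∀ j : Fin K, ‖sol t T ^ ((j:ℕ) + 1) - ∑ k : Fin K, W T j k * t ^ ((k:ℕ) + 1)‖ ≤ M * ‖t‖ ^ (K + 1) := by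
  obtain ⟨M, hM⟩ := ASY hT hA hW
  refine ⟨M * C ^ (K + 1), ?_⟩
  filter_upwards [ball_mem_nhds (0:ℂ) hr, ball_mem_nhds (0:ℂ) (inv_pos.2 hC)] with t me we j
  rw [mem_ball_zero_iff] at me we
  obtain ⟨s1, s2, s3, s4⟩ := hs t me
  have := hM (sol t) t (C * ‖t‖) s1 s2 (by
    have := mul_lt_mul_of_pos_left we hC
    rw [mul_inv_cancel₀ hC.ne'] at this
    exact this.le) s4 s3 j
  rw [mul_pow, ← mul_assoc] at this
  exact this
lemma center_W (hT : 0 < T) {A : Fin n → ℂ → ℂ} (hA : ∀ i, Differentiable ℂ (A i)) (hc : DeterminesCenter T (fun i s => deriv (A i) s))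
    {K : ℕ} {W : ℂ → MK K} (hW : IsW (Om (NP n K) A) W) : W T = 1 := by
  obtain ⟨sol, C, r, hr, hC, -, hs⟩ := FLOW hT (fun i (s:ℝ) => deriv (A i) s) (cont_a hA)
  obtain ⟨ε, hε, hc⟩ := hc
  obtain ⟨M, hM⟩ := sol_asy hT hA hr hC hs hW
  ext j k
  let q : Polynomial ℂ := Polynomial.X ^ ((j:ℕ) + 1) - ∑ k : Fin K, Polynomial.C (W T j k) * Polynomial.X ^ ((k:ℕ) + 1)
  have hq : q = 0 := by
    refine poly_small (K := K) (C := M) ?_ ?_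
    · refine (Polynomial.natDegree_sub_le _ _).trans (max_le ?_ ?_)
      · rw [natDegree_X_pow]; exact j.2
      · refine Polynomial.natDegree_sum_le_of_forall_le _ _ fun k _ => ?_
        exact (Polynomial.natDegree_C_mul_X_pow_le _ _).trans k.2
    · filter_upwards [hM, ball_mem_nhds (0:ℂ) hr, ball_mem_nhds (0:ℂ) hε] with t me we us
      rw [mem_ball_zero_iff] at we us
      obtain ⟨s1, s2, s3, s4⟩ := hs t we
      have up := hc (sol t) (by rw [s2]; exact s3) (by rwa [s2])
      have ma := me j
      rw [up, s2] at ma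
      simpa [q, Polynomial.eval_finsetSum] using ma
  have me := congrArg (fun p => Polynomial.coeff p ((k:ℕ) + 1)) hq
  simp only [q, Polynomial.coeff_sub, Polynomial.coeff_X_pow, Polynomial.finsetSum_coeff, Polynomial.coeff_C_mul, Polynomial.coeff_zero, add_left_inj, mul_ite, mul_one, mul_zero] at me
  have we : ∑ x : Fin K, (if (k:ℕ) = x then W T j x else 0) = W T j k := by
    rw [Finset.sum_eq_single k]
    · simp
    · intro b _ hb
      rw [if_neg fun h => hb (Fin.ext h.symm)]
    · simp
  rw [we] at me
  rw [Matrix.one_apply, ← sub_eq_zero.1 me]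
  simp only [Fin.ext_iff, eq_comm]
lemma W_center (hT : 0 < T) {A : Fin n → ℂ → ℂ} (hA : ∀ i, Differentiable ℂ (A i))
    (h : ∀ K (W : ℂ → MK K), IsW (Om (NP n K) A) W → W T = 1) : DeterminesCenter T (fun i s => deriv (A i) s) := by
  obtain ⟨sol, C, r, hr, hC, han, hs⟩ := FLOW hT (fun i (s:ℝ) => deriv (A i) s) (cont_a hA)
  have my : ∀ᶠ t in 𝓝 (0:ℂ), sol t T - t = 0 := by
    refine an_small (han.fun_sub analyticAt_id) fun K => ?_
    obtain ⟨W, hW⟩ := exists_W (Om_diff (NP n (K + 1)) hA) (Om_UT (NP_TP n (K + 1)) A)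
    obtain ⟨M, hM⟩ := sol_asy hT hA hr hC hs hW
    refine ⟨M, ?_⟩
    filter_upwards [hM] with t me
    have us := me 0
    rw [h _ _ hW] at us
    have up : ∑ k : Fin (K + 1), (1 : MK (K + 1)) 0 k * t ^ ((k:ℕ) + 1) = t := by
      simp [Matrix.one_apply]
    rw [up, Fin.val_zero, zero_add, pow_one] at us
    exact us
  obtain ⟨ε, hε, H⟩ := eventually_nhds_iff_ball.1 my
  refine ⟨min ε r, lt_min hε hr, fun v hv hv0 => ?_⟩
  by_cases hi : IntervalIntegrable (fun s : ℝ => ∑ i, deriv (A i) s * v s ^ ((i : ℕ) + 2)) volume 0 T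
  · have hvc : ContinuousOn v (Icc 0 T) := by
      have me : ContinuousOn (fun x => v 0 + ∫ s in (0:ℝ)..x, ∑ i, deriv (A i) s * v s ^ ((i : ℕ) + 2)) (Icc 0 T) := by
        have := intervalIntegral.continuousOn_primitive_interval (a := (0:ℝ)) (b := T) (f := fun s : ℝ => ∑ i, deriv (A i) s * v s ^ ((i : ℕ) + 2)) (μ := volume) (by
          rw [uIcc_of_le hT.le, integrableOn_Icc_iff_integrableOn_Ioc, ← intervalIntegrable_iff_integrableOn_Ioc_of_le hT.le]
          exact hi)
        rw [uIcc_of_le hT.le] at this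
        exact continuousOn_const.add this
      exact me.congr fun x hx => hv x hx
    let w : ℝ → ℂ := IccExtend hT.le (fun x : Icc (0:ℝ) T => v x)
    have hwv : ∀ x ∈ Icc (0:ℝ) T, w x = v x := fun x hx => IccExtend_of_mem hT.le _ hx
    have hwc : Continuous w := (continuousOn_iff_continuous_domRestrict.1 hvc).Icc_extend'
    have hw : ∀ x ∈ Icc (0:ℝ) T, w x = v 0 + ∫ s in (0:ℝ)..x, ∑ i, deriv (A i) s * w s ^ ((i : ℕ) + 2) := by
      intro x hx
      rw [hwv x hx, hv x hx]
      congr 1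
      apply intervalIntegral.integral_congr
      intro s hs
      rw [uIcc_of_le hx.1] at hs
      simp only [hwv s ⟨hs.1, hs.2.trans hx.2⟩]
    obtain ⟨s1, s2, s3, s4⟩ := hs (v 0) (hv0.trans_le (min_le_right _ _))
    have := sol_unique (cont_a hA) hwc s1 hw s3 T ⟨hT.le, le_rfl⟩
    rw [hwv T ⟨hT.le, le_rfl⟩] at this
    rw [this]
    exact sub_eq_zero.1 (H (v 0) (by rw [mem_ball_zero_iff]; exact hv0.trans_le (min_le_left _ _)))
  · rw [hv T ⟨hT.le, le_rfl⟩, intervalIntegral.integral_undef hi, add_zero]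
end
end

section
attribute [local instance] Matrix.linftyOpNormedRing Matrix.linftyOpNormedAlgebra
section
variable {T : ℝ} {n : ℕ}
lemma TrigC.add {f g : ℂ → ℂ} (hf : TrigC T f) (hg : TrigC T g) : TrigC T (fun x => f x + g x) := by
  obtain ⟨c, N, p, hd, h⟩ := hf
  obtain ⟨c', N', go, hd', h'⟩ := hg
  refine ⟨c + c', N + N', p * Polynomial.X ^ N' + go * Polynomial.X ^ N, ?_, fun x => ?_⟩
  · refine (Polynomial.natDegree_add_le _ _).trans (max_le ?_ ?_)
    · have := Polynomial.natDegree_mul_le (p := p) (q := Polynomial.X ^ N')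
      rw [natDegree_X_pow] at this
      omega
    · have := Polynomial.natDegree_mul_le (p := go) (q := Polynomial.X ^ N)
      rw [natDegree_X_pow] at this
      omega
  · simp only [h, h']
    have hz := exp_ne_zero (kap T * x)
    unfold lq
    simp only [eval_add, eval_mul, eval_pow, eval_X, pow_add]
    field_simp
    ring
def Good (T : ℝ) (g : ℂ → ℂ) : Prop := ∃ F : ℂ → ℂ, F 0 = 0 ∧ TrigC T F ∧ ∀ x, HasDerivAt F (g x) x
lemma Good.add {f g : ℂ → ℂ} (hf : Good T f) (hg : Good T g) : Good T (fun x => f x + g x) := by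
  obtain ⟨F, me, we, us⟩ := hf
  obtain ⟨G, h1', h2', h3'⟩ := hg
  exact ⟨fun x => F x + G x, by simp [me, h1'], we.add h2', fun x => (us x).add (h3' x)⟩
lemma good_exp (hT : 0 < T) (c : ℂ) (j : ℤ) : Good T (fun x => c * exp (j * (kap T * x))) := by
  by_cases hj : j = 0
  · subst hj
    refine ⟨fun x => c * x, by simp, ⟨c, 0, 0, by simp, fun x => by simp [lq]⟩, fun x => ?_⟩
    have := (hasDerivAt_id x).const_mul c
    simpa using this
  · have hjc : (j:ℂ) ≠ 0 := by exact_mod_cast hj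
    have hk := kap_ne hT
    refine ⟨fun x => c / (j * kap T) * (exp (j * (kap T * x)) - 1), by simp, ?_, fun x => ?_⟩
    · have hm : ∀ (b : ℂ) (m : ℕ), TrigC T (fun x => b * (exp (m * (kap T * x)) - 1)) ∧ TrigC T (fun x => b * (exp (- m * (kap T * x)) - 1)) := by
        intro b m
        constructor
        · refine ⟨0, m, Polynomial.C b * (Polynomial.X ^ (2 * m) - Polynomial.X ^ m), ?_, fun x => ?_⟩
          · refine (Polynomial.natDegree_C_mul_le _ _).trans ((Polynomial.natDegree_sub_le _ _).trans (max_le ?_ ?_))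
            · rw [natDegree_X_pow]
            · rw [natDegree_X_pow]; omega
          · have hz := exp_ne_zero (kap T * x)
            simp only [lq, eval_mul, eval_C, eval_sub, eval_pow, eval_X, exp_nat_mul]
            rw [two_mul, pow_add]
            field_simp
            ring
        · refine ⟨0, m, Polynomial.C b * (1 - Polynomial.X ^ m), ?_, fun x => ?_⟩
          · refine (Polynomial.natDegree_C_mul_le _ _).trans ((Polynomial.natDegree_sub_le _ _).trans (max_le ?_ ?_))
            · simp
            · rw [natDegree_X_pow]; omega
          · have hz := exp_ne_zero (kap T * x)
            simp only [lq, eval_mul, eval_C, eval_sub, eval_pow, eval_X, Polynomial.eval_one, neg_mul, exp_neg, exp_nat_mul]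
            field_simp
            ring
      obtain ⟨m, rfl | rfl⟩ := j.eq_nat_or_neg
      · have := (hm (c / ((m:ℂ) * kap T)) m).1
        simpa using this
      · have := (hm (c / ((((-(m:ℤ)) : ℤ) : ℂ) * kap T)) m).2
        simpa using this
    · have me : HasDerivAt (fun x : ℂ => (j:ℂ) * (kap T * x)) ((j:ℂ) * kap T) x := by
        have := ((hasDerivAt_id x).const_mul (kap T)).const_mul (j:ℂ)
        simpa using this
      refine ((me.cexp.sub_const 1).const_mul (c / (j * kap T))).congr_deriv ?_
      field_simp
lemma poly_prim (p : Polynomial ℂ) : ∃ q : Polynomial ℂ, Polynomial.derivative q = p := by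
  induction p using Polynomial.induction_on' with
  | add a b ha hb =>
    obtain ⟨q, hq⟩ := ha
    obtain ⟨r, hr⟩ := hb
    exact ⟨q + r, by rw [Polynomial.derivative_add, hq, hr]⟩
  | monomial k a =>
    refine ⟨Polynomial.monomial (k + 1) (a / (k + 1)), ?_⟩
    rw [Polynomial.derivative_monomial]
    have : (k:ℂ) + 1 ≠ 0 := by exact_mod_cast Nat.succ_ne_zero k
    simp only [Nat.add_sub_cancel, Nat.cast_add, Nat.cast_one]
    congr 1
    field_simp
lemma EXT (hT : 0 < T) {f : ℝ → ℂ} (hf : Admissible T f) : ∃ F : ℂ → ℂ, Differentiable ℂ F ∧ F 0 = 0 ∧ (PolyC F ∨ TrigC T F) ∧ ∀ x ∈ Icc (0:ℝ) T, f x = deriv F x := by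
  rcases hf with ⟨p, hp⟩ | ⟨s, c, hs⟩
  · obtain ⟨q, hq⟩ := poly_prim p
    have hd : ∀ x, HasDerivAt (fun x => (q - Polynomial.C (q.eval 0)).eval x) (p.eval x) x := by
      intro x
      have := (q - Polynomial.C (q.eval 0)).hasDerivAt x
      rwa [Polynomial.derivative_sub, Polynomial.derivative_C, sub_zero, hq] at this
    refine ⟨fun x => (q - Polynomial.C (q.eval 0)).eval x, fun x => (hd x).differentiableAt, by simp, Or.inl ⟨_, fun x => rfl⟩, fun x hx => ?_⟩
    rw [hp x hx, (hd x).deriv]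
  · have hG : Good T (fun x => ∑ j ∈ s, c j * exp (j * (kap T * x))) := by
      clear hs
      induction s using Finset.induction_on with
      | empty => exact ⟨fun _ => 0, rfl, trig_zero T, fun x => by simpa using hasDerivAt_const x (0:ℂ)⟩
      | insert j s hj ih =>
        simp only [Finset.sum_insert hj]
        exact (good_exp hT (c j) j).add ih
    obtain ⟨F, my, me, we⟩ := hG
    refine ⟨F, fun x => (we x).differentiableAt, my, Or.inr me, fun x hx => ?_⟩
    rw [hs x hx, (we x).deriv]
    refine sum_congr rfl fun j _ => ?_
    congr 2
    unfold kap
    ring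
lemma prim_eq {f : ℝ → ℂ} {F : ℂ → ℂ} (hF : Differentiable ℂ F) (my : F 0 = 0) (h : ∀ x ∈ Icc (0:ℝ) T, f x = deriv F x) {x : ℝ} (hx : x ∈ Icc (0:ℝ) T) : primitive f x = F x := by
  have me : primitive f x = ∫ s in (0:ℝ)..x, deriv F s := by
    apply intervalIntegral.integral_congr
    intro s hs
    rw [uIcc_of_le hx.1] at hs
    exact h s ⟨hs.1, hs.2.trans hx.2⟩
  have we := mom_one (n := 1) (A := fun _ => F) (T := x) (fun _ => hF) 0
  rw [me]
  simpa [ev, my] using we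
lemma mom_monomial (hT : 0 < T) {a : Fin n → ℝ → ℂ} {A : Fin n → ℂ → ℂ} (hA : ∀ i, Differentiable ℂ (A i)) (my : ∀ i, A i 0 = 0) (h : ∀ i, ∀ x ∈ Icc (0:ℝ) T, a i x = deriv (A i) x)
    (d : Fin n →₀ ℕ) (c : ℂ) (i : Fin n) : ∫ x in (0:ℝ)..T, ev (MvPolynomial.monomial d c) A x * deriv (A i) x = c * moment T a (d.support.toList.map fun k => (k, d k)) i := by
  unfold moment
  rw [← intervalIntegral.integral_const_mul]
  apply intervalIntegral.integral_congr
  intro x hx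
  rw [uIcc_of_le hT.le] at hx
  simp only [ev, MvPolynomial.eval_monomial, List.map_map]
  rw [h i x hx, mul_assoc]
  congr 2
  rw [Finsupp.prod, ← Finset.prod_map_toList]
  congr 1
  refine List.map_congr_left fun k _ => ?_
  simp only [Function.comp]
  rw [prim_eq (hA k) (my k) (h k) hx]
lemma momEq (hT : 0 < T) {a b : Fin n → ℝ → ℂ} {A B : Fin n → ℂ → ℂ} (hA : ∀ i, Differentiable ℂ (A i)) (fi : ∀ i, A i 0 = 0) (ha : ∀ i, ∀ x ∈ Icc (0:ℝ) T, a i x = deriv (A i) x)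
    (hB : ∀ i, Differentiable ℂ (B i)) (li : ∀ i, B i 0 = 0) (hb : ∀ i, ∀ x ∈ Icc (0:ℝ) T, b i x = deriv (B i) x)
    (hm : ∀ (ps : List (Fin n × ℕ)), (∀ q ∈ ps, 0 < q.2) → ∀ i : Fin n, moment T a ps i = moment T b ps i) : MomEq T A B := by
  intro P i
  induction P using MvPolynomial.induction_on' with
  | monomial u c =>
    rw [mom_monomial hT hA fi ha, mom_monomial hT hB li hb, hm _ _ i]
    intro q hq
    simp only [List.mem_map, Finset.mem_toList, Finsupp.mem_support_iff] at hq
    obtain ⟨k, hk, rfl⟩ := hq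
    exact Nat.pos_of_ne_zero hk
  | add p q hp hq =>
    have key : ∀ (A : Fin n → ℂ → ℂ), (∀ i, Differentiable ℂ (A i)) → ∫ x in (0:ℝ)..T, ev (p + q) A x * deriv (A i) x = (∫ x in (0:ℝ)..T, ev p A x * deriv (A i) x) + ∫ x in (0:ℝ)..T, ev q A x * deriv (A i) x := by
      intro A hA
      have hc : ∀ p : MvPolynomial (Fin n) ℂ, Continuous fun x : ℝ => ev p A x * deriv (A i) x := fun p =>
        ((ev_diff p hA).continuous.comp continuous_ofReal).mul (cont_a hA i)
      rw [← intervalIntegral.integral_add ((hc p).intervalIntegrable _ _) ((hc q).intervalIntegrable _ _)]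
      congr 1
      funext x
      simp only [ev, map_add, add_mul]
    rw [key A hA, key B hB, hp, hq]
lemma center_congr {a b : Fin n → ℝ → ℂ} (h : ∀ i, ∀ x ∈ Icc (0:ℝ) T, a i x = b i x) (hc : DeterminesCenter T a) : DeterminesCenter T b := by
  obtain ⟨ε, hε, hc⟩ := hc
  refine ⟨ε, hε, fun v hv => hc v fun x hx => ?_⟩
  rw [hv x hx]
  congr 1
  apply intervalIntegral.integral_congr
  intro s hs
  rw [uIcc_of_le hx.1] at hs
  simp only [fun i => h i s ⟨hs.1, hs.2.trans hx.2⟩]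
theorem FINAL
    (T : ℝ) (hT : 0 < T) (n : ℕ)
    (a b : Fin n → ℝ → ℂ)
    (ha : ∀ i, Admissible T (a i)) (hb : ∀ i, Admissible T (b i))
    (hcenter : DeterminesCenter T a)
    (hm : ∀ (ps : List (Fin n × ℕ)), (∀ q ∈ ps, 0 < q.2) →
      ∀ i : Fin n, moment T a ps i = moment T b ps i) :
    DeterminesCenter T b := by
  choose A hA fi tA ha using fun i => EXT hT (ha i)
  choose B hB li tB hb using fun i => EXT hT (hb i)
  have hmom := momEq hT hA fi ha hB li hb hm
  refine center_congr (a := fun i s => deriv (B i) s) (fun i x hx => (hb i x hx).symm) ?_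
  refine W_center hT hB fun K WB hWB => ?_
  obtain ⟨WA, hWA⟩ := exists_W (Om_diff (NP n K) hA) (Om_UT (NP_TP n K) A)
  exact MAINW hT (NP_TP n K) hA hB tA tB fi li hWA hWB hmom (center_W hT hA (center_congr ha hcenter) hWA)
end
end
end

/-- **Corollary 3.6.**  If `a` and `b` are tuples of admissible functions with the
same moments and the equation `E(a)` determines a center, then so does `E(b)`. -/
theorem center_propagates_along_equal_moments
    (T : ℝ) (hT : 0 < T) (n : ℕ) (hn : 1 ≤ n)
    (a b : Fin n → ℝ → ℂ)
    (ha : ∀ i, Admissible T (a i)) (hb : ∀ i, Admissible T (b i))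
    (hcenter : DeterminesCenter T a)
    (hm : ∀ (ps : List (Fin n × ℕ)), (∀ q ∈ ps, 0 < q.2) →
      ∀ i : Fin n, moment T a ps i = moment T b ps i) :
    DeterminesCenter T b := by
  exact FINAL T hT n a b ha hb hcenter hm

end
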